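/- arXiv:1708.06631 — 2 statements merged into one kernel-verified Lean document; each statement's English description precedes it below -/
import Mathlib

section
/- Let x̄ ∈ S(v̄,p̄,q̄) and assume (A1)–(A4). Consider: (i) x̄ is a Hölderian fully stable solution corresponding to (v̄,p̄,q̄) with moduli κ, ℓ > 0; (ii) there exist η, κ₀ > 0 such that for every (u,p,v) ∈ gph ∂_x g with ‖u−x̄‖ ≤ η, d₁(p,p̄) ≤ η, ‖v−v̂‖ ≤ η one has ⟨∇_x f(x̄,p̄,q̄)w, w⟩ + ⟨z, w⟩ ≥ κ₀‖w‖² for all w ∈ X and all z ∈ D̂*(∂g_p)(u,v)(w). Then (i) implies (ii), where κ₀ can be chosen smaller than but arbitrarily close to κ; and conversely (ii) implies (i), where κ can be chosen smaller than but arbitrarily close to κ₀. -/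
noncomputable section

open Filter Topology Metric Set MeasureTheory
open scoped RealInnerProductSpace Pointwise

namespace PVS

variable {X : Type*} [NormedAddCommGroup X] [InnerProductSpace ℝ X]
variable {Y : Type*} [NormedAddCommGroup Y] [InnerProductSpace ℝ Y]
variable {W : Type*} [NormedAddCommGroup W] [InnerProductSpace ℝ W]
variable {P : Type*} [MetricSpace P]
variable {Q : Type*} [MetricSpace Q]

/-- Regular (Fréchet) subdifferential of an extended-real-valued function. -/
def regSubdiff (h : X → EReal) (x : X) : Set X :=
  {v | h x ≠ ⊤ ∧ h x ≠ ⊥ ∧ ∀ ε > (0:ℝ), ∀ᶠ u in 𝓝 x,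
      h x + ((⟪v, u - x⟫ - ε * ‖u - x‖ : ℝ) : EReal) ≤ h u}

/-- Weak sequential convergence in an inner product space. -/
def WeakTendsto (xs : ℕ → X) (x : X) : Prop :=
  ∀ z : X, Tendsto (fun k => ⟪xs k, z⟫) atTop (𝓝 ⟪x, z⟫)

/-- Limiting (Mordukhovich) subdifferential. -/
def limSubdiff (h : X → EReal) (x : X) : Set X :=
  {v | ∃ xs vs : ℕ → X, Tendsto xs atTop (𝓝 x) ∧
      Tendsto (fun k => h (xs k)) atTop (𝓝 (h x)) ∧
      (∀ k, vs k ∈ regSubdiff h (xs k)) ∧ WeakTendsto vs v}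

/-- Partial limiting subdifferential with respect to the first variable. -/
def pSubdiff {PP : Type*} (g : X → PP → EReal) (x : X) (p : PP) : Set X :=
  limSubdiff (fun x' => g x' p) x

/-- Graph of a set-valued map. -/
def gph (F : X → Set Y) : Set (X × Y) := {t | t.2 ∈ F t.1}

/-- Regular normal cone. -/
def regNC (Ω : Set X) (x : X) : Set X :=
  {v | ∀ ε > (0:ℝ), ∀ᶠ y in 𝓝[Ω] x, ⟪v, y - x⟫ ≤ ε * ‖y - x‖}

/-- Limiting normal cone. -/
def limNC (Ω : Set X) (x : X) : Set X :=
  {v | ∃ xs vs : ℕ → X, (∀ k, xs k ∈ Ω) ∧ Tendsto xs atTop (𝓝 x) ∧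
      (∀ k, vs k ∈ regNC Ω (xs k)) ∧ Tendsto vs atTop (𝓝 v)}

/-- Regular normal cone to a subset of a product of two inner product spaces,
with the Euclidean product norm. -/
def regNC2 (Ω : Set (X × Y)) (ω : X × Y) : Set (X × Y) :=
  {ζ | ∀ ε > (0:ℝ), ∀ᶠ y in 𝓝[Ω] ω,
      ⟪ζ.1, y.1 - ω.1⟫ + ⟪ζ.2, y.2 - ω.2⟫
        ≤ ε * Real.sqrt (‖y.1 - ω.1‖ ^ 2 + ‖y.2 - ω.2‖ ^ 2)}

/-- Limiting normal cone in a product of two spaces. -/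
def limNC2 (Ω : Set (X × Y)) (ω : X × Y) : Set (X × Y) :=
  {ζ | ∃ ωs ζs : ℕ → X × Y, (∀ k, ωs k ∈ Ω) ∧ Tendsto ωs atTop (𝓝 ω) ∧
      (∀ k, ζs k ∈ regNC2 Ω (ωs k)) ∧ Tendsto ζs atTop (𝓝 ζ)}

/-- Regular coderivative of a set-valued map. -/
def regCoderiv (F : X → Set Y) (u : X) (v : Y) (w : Y) : Set X :=
  {z | (z, -w) ∈ regNC2 (gph F) (u, v)}

/-- Limiting coderivative of a set-valued map. -/
def limCoderiv (F : X → Set Y) (u : X) (v : Y) (w : Y) : Set X :=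
  {z | (z, -w) ∈ limNC2 (gph F) (u, v)}

/-- Regular normal cone in a product of three inner product spaces. -/
def regNC3 (Ω : Set (X × W × Y)) (ω : X × W × Y) : Set (X × W × Y) :=
  {ζ | ∀ ε > (0:ℝ), ∀ᶠ y in 𝓝[Ω] ω,
      ⟪ζ.1, y.1 - ω.1⟫ + ⟪ζ.2.1, y.2.1 - ω.2.1⟫ + ⟪ζ.2.2, y.2.2 - ω.2.2⟫
        ≤ ε * Real.sqrt (‖y.1 - ω.1‖ ^ 2 + ‖y.2.1 - ω.2.1‖ ^ 2 + ‖y.2.2 - ω.2.2‖ ^ 2)}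

/-- Limiting normal cone in a product of three inner product spaces. -/
def limNC3 (Ω : Set (X × W × Y)) (ω : X × W × Y) : Set (X × W × Y) :=
  {ζ | ∃ ωs ζs : ℕ → X × W × Y, (∀ k, ωs k ∈ Ω) ∧ Tendsto ωs atTop (𝓝 ω) ∧
      (∀ k, ζs k ∈ regNC3 Ω (ωs k)) ∧ Tendsto ζs atTop (𝓝 ζ)}

/-- Limiting coderivative of the full partial subdifferential map (x,p) ↦ ∂ₓ g(x,p). -/
def limCoderivFull (g : X → W → EReal) (xb : X) (pb : W) (vh : X) (w : X) : Set (X × W) :=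
  {zs | (zs.1, zs.2, -w) ∈ limNC3 {t : X × W × X | t.2.2 ∈ pSubdiff g t.1 t.2.1} (xb, pb, vh)}

/-- Lipschitz-like (Aubin) property of a set-valued map around a graph point. -/
def LipschitzLike {α Z : Type*} [MetricSpace α] [SeminormedAddCommGroup Z]
    (F : α → Set Z) (ab : α) (zb : Z) : Prop :=
  ∃ ℓ > (0:ℝ), ∃ U ∈ 𝓝 ab, ∃ V ∈ 𝓝 zb,
    ∀ a ∈ U, ∀ a' ∈ U, ∀ z ∈ F a ∩ V, ∃ z' ∈ F a', ‖z - z'‖ ≤ ℓ * dist a a'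

/-- Epigraph of g(·,p). -/
def epi {PP : Type*} (g : X → PP → EReal) (p : PP) : Set (X × ℝ) :=
  {q | g q.1 p ≤ (q.2 : EReal)}

/-- (A1): Lipschitz continuity of the base around the reference point. -/
def A1 (f : X → P → Q → X) (xb : X) (pb : P) (qb : Q) : Prop :=
  ∃ L > (0:ℝ), ∃ ε > (0:ℝ), ∀ x₁ x₂ p₁ p₂ q₁ q₂,
    ‖x₁ - xb‖ < ε → ‖x₂ - xb‖ < ε → dist p₁ pb < ε → dist p₂ pb < ε →
    dist q₁ qb < ε → dist q₂ qb < ε →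
    ‖f x₁ p₁ q₁ - f x₂ p₂ q₂‖ ≤ L * (‖x₁ - x₂‖ + dist p₁ p₂ + dist q₁ q₂)

/-- Parametric prox-regularity with prox-parameter r. -/
def ProxRegWith (g : X → P → EReal) (xb : X) (pb : P) (vh : X) (r : ℝ) : Prop :=
  ∃ ε > (0:ℝ), ∀ x u p v, ‖x - xb‖ < ε → ‖u - xb‖ < ε → dist p pb < ε → ‖v - vh‖ < ε →
    v ∈ pSubdiff g u p →
    g u p + ((⟪v, x - u⟫ - r / 2 * ‖x - u‖ ^ 2 : ℝ) : EReal) ≤ g x p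

/-- Subdifferential continuity with compatible parameterization. -/
def SubdiffCont (g : X → P → EReal) (xb : X) (pb : P) (vh : X) : Prop :=
  Tendsto (fun t : X × P × X => g t.1 t.2.1)
    (𝓝[{t : X × P × X | t.2.2 ∈ pSubdiff g t.1 t.2.1}] (xb, pb, vh)) (𝓝 (g xb pb))

/-- (A2): parametric continuous prox-regularity. -/
def A2 (g : X → P → EReal) (xb : X) (pb : P) (vh : X) : Prop :=
  (∃ r > (0:ℝ), ProxRegWith g xb pb vh r) ∧ SubdiffCont g xb pb vh

/-- Threshold of prox-regularity. -/
def proxThreshold (g : X → P → EReal) (xb : X) (pb : P) (vh : X) : ℝ :=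
  sInf {r : ℝ | 0 < r ∧ ProxRegWith g xb pb vh r}

/-- (A3): basic constraint qualification. -/
def A3 (g : X → P → EReal) (xb : X) (pb : P) : Prop :=
  LipschitzLike (fun p => epi g p) pb (xb, (g xb pb).toReal)

/-- (A4): uniform partial differentiability with partial Jacobian continuous at the point. -/
def A4 (f : X → P → Q → X) (Df : X → P → Q → X →L[ℝ] X) (xb : X) (pb : P) (qb : Q) : Prop :=
  (∃ η > (0:ℝ), ∀ ε > (0:ℝ), ∃ δ > (0:ℝ), ∀ x p q,
      ‖x - xb‖ < η → dist p pb < η → dist q qb < η →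
      ∀ x', ‖x' - x‖ < δ →
        ‖f x' p q - f x p q - Df x p q (x' - x)‖ ≤ ε * ‖x' - x‖) ∧
  Tendsto (fun t : X × P × Q => Df t.1 t.2.1 t.2.2) (𝓝 (xb, pb, qb)) (𝓝 (Df xb pb qb))

/-- Solution map of the parametric variational system. -/
def SolMap (f : X → P → Q → X) (g : X → P → EReal) (v : X) (p : P) (q : Q) : Set X :=
  {x | v - f x p q ∈ pSubdiff g x p}

/-- Single-valued localization of a three-parametric solution map. -/
def Localizes3 (S : X → P → Q → Set X) (V : Set X) (Pn : Set P) (Qn : Set Q) (U : Set X)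
    (ϑ : X → P → Q → X) : Prop :=
  ∀ v ∈ V, ∀ p ∈ Pn, ∀ q ∈ Qn,
    ϑ v p q ∈ U ∧ ϑ v p q ∈ S v p q ∧ ∀ x ∈ U, x ∈ S v p q → x = ϑ v p q

/-- Lipschitzian full stability. -/
def LipFullStable (S : X → P → Q → Set X) (xb vb : X) (pb : P) (qb : Q) : Prop :=
  ∃ V ∈ 𝓝 vb, ∃ Pn ∈ 𝓝 pb, ∃ Qn ∈ 𝓝 qb, ∃ U ∈ 𝓝 xb, ∃ ϑ : X → P → Q → X,
    Localizes3 S V Pn Qn U ϑ ∧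
    ∃ κ > (0:ℝ), ∃ ℓ > (0:ℝ), ∀ v₁ ∈ V, ∀ p₁ ∈ Pn, ∀ q₁ ∈ Qn, ∀ v₂ ∈ V, ∀ p₂ ∈ Pn, ∀ q₂ ∈ Qn,
      ‖(v₁ - v₂) - (2 * κ) • (ϑ v₁ p₁ q₁ - ϑ v₂ p₂ q₂)‖
        ≤ ‖v₁ - v₂‖ + ℓ * (dist p₁ p₂ + dist q₁ q₂)

/-- Hölderian full stability with given moduli. -/
def HolderFullStableWith (S : X → P → Q → Set X) (xb vb : X) (pb : P) (qb : Q) (κ ℓ : ℝ) : Prop :=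
  ∃ V ∈ 𝓝 vb, ∃ Pn ∈ 𝓝 pb, ∃ Qn ∈ 𝓝 qb, ∃ U ∈ 𝓝 xb, ∃ ϑ : X → P → Q → X,
    Localizes3 S V Pn Qn U ϑ ∧
    ∀ v₁ ∈ V, ∀ p₁ ∈ Pn, ∀ q₁ ∈ Qn, ∀ v₂ ∈ V, ∀ p₂ ∈ Pn, ∀ q₂ ∈ Qn,
      ‖(v₁ - v₂) - (2 * κ) • (ϑ v₁ p₁ q₁ - ϑ v₂ p₂ q₂)‖
        ≤ ‖v₁ - v₂‖ + ℓ * (Real.sqrt (dist p₁ p₂) + dist q₁ q₂)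

/-- Hölderian full stability. -/
def HolderFullStable (S : X → P → Q → Set X) (xb vb : X) (pb : P) (qb : Q) : Prop :=
  ∃ κ > (0:ℝ), ∃ ℓ > (0:ℝ), HolderFullStableWith S xb vb pb qb κ ℓ

/-- Neighborhood second-order condition via the regular coderivative of ∂g_p. -/
def SOC (g : X → P → EReal) (A : X →L[ℝ] X) (xb : X) (pb : P) (vh : X) (η κ₀ : ℝ) : Prop :=
  ∀ u p v, ‖u - xb‖ ≤ η → dist p pb ≤ η → ‖v - vh‖ ≤ η → v ∈ pSubdiff g u p →
    ∀ w z, z ∈ regCoderiv (fun y => pSubdiff g y p) u v w →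
      κ₀ * ‖w‖ ^ 2 ≤ ⟪A w, w⟫ + ⟪z, w⟫

/-- The graphical map p ↦ gph ∂ₓ g(·,p). -/
def gphMap (g : X → P → EReal) (p : P) : Set (X × X) := {t | t.2 ∈ pSubdiff g t.1 p}

/-- Local strong monotonicity of f in x with modulus σ. -/
def StrongMono (f : X → P → Q → X) (xb : X) (pb : P) (qb : Q) (σ : ℝ) : Prop :=
  ∃ ε > (0:ℝ), ∀ x₁ x₂ p q, ‖x₁ - xb‖ < ε → ‖x₂ - xb‖ < ε → dist p pb < ε → dist q qb < ε →
    σ * ‖x₁ - x₂‖ ^ 2 ≤ ⟪f x₁ p q - f x₂ p q, x₁ - x₂⟫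

/-- The proximal mapping P_λ(v,p) = {x : v ∈ x + λ ∂ₓ g(x,p)}. -/
def proxMap (g : X → P → EReal) (lam : ℝ) (v : X) (p : P) : Set X :=
  {x | ∃ s ∈ pSubdiff g x p, v = x + lam • s}

/-- Single-valued localization of a two-parametric solution map. -/
def Localizes2 (S : X → P → Set X) (V : Set X) (Pn : Set P) (U : Set X) (ϑ : X → P → X) : Prop :=
  ∀ v ∈ V, ∀ p ∈ Pn, ϑ v p ∈ U ∧ ϑ v p ∈ S v p ∧ ∀ x ∈ U, x ∈ S v p → x = ϑ v p

/-- (Lipschitzian) full stability of a two-parametric system. -/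
def FullStable2 (S : X → P → Set X) (xb vb : X) (pb : P) : Prop :=
  ∃ V ∈ 𝓝 vb, ∃ Pn ∈ 𝓝 pb, ∃ U ∈ 𝓝 xb, ∃ ϑ : X → P → X,
    Localizes2 S V Pn U ϑ ∧
    ∃ κ > (0:ℝ), ∃ ℓ > (0:ℝ), ∀ v₁ ∈ V, ∀ p₁ ∈ Pn, ∀ v₂ ∈ V, ∀ p₂ ∈ Pn,
      ‖(v₁ - v₂) - (2 * κ) • (ϑ v₁ p₁ - ϑ v₂ p₂)‖ ≤ ‖v₁ - v₂‖ + ℓ * dist p₁ p₂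

/-- Normal cone of convex analysis. -/
def convNC (C : Set X) (x : X) : Set X := {v | x ∈ C ∧ ∀ y ∈ C, ⟪v, y - x⟫ ≤ 0}

/-- Solution map of a parametric variational inequality. -/
def SolMapVI (f : X → P → X) (C : Set X) (v : X) (p : P) : Set X :=
  {x | v - f x p ∈ convNC C x}

/-- Radial cone. -/
def radialCone (C : Set X) (x : X) : Set X := {w | ∃ t > (0:ℝ), x + t • w ∈ C}

/-- Tangent cone (closure of the radial cone). -/
def tangentC (C : Set X) (x : X) : Set X := closure (radialCone C x)

/-- Critical cone. -/
def criticalCone (C : Set X) (x v : X) : Set X := tangentC C x ∩ {w | ⟪v, w⟫ = 0}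

/-- Polyhedricity of a closed convex set. -/
def Polyhedric (C : Set X) : Prop :=
  ∀ x ∈ C, ∀ v ∈ convNC C x,
    criticalCone C x v = closure (radialCone C x ∩ {w | ⟪v, w⟫ = 0})

/-- Weak sequential outer limit of critical cones. -/
def Hw (C : Set X) (xb vh : X) : Set X :=
  {w | ∃ xs vs ws : ℕ → X, (∀ k, vs k ∈ convNC C (xs k)) ∧
      Tendsto xs atTop (𝓝 xb) ∧ Tendsto vs atTop (𝓝 vh) ∧
      (∀ k, ws k ∈ criticalCone C (xs k) (vs k)) ∧ WeakTendsto ws w}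

/-- Strong sequential outer limit of critical cones. -/
def Hs (C : Set X) (xb vh : X) : Set X :=
  {w | ∃ xs vs ws : ℕ → X, (∀ k, vs k ∈ convNC C (xs k)) ∧
      Tendsto xs atTop (𝓝 xb) ∧ Tendsto vs atTop (𝓝 vh) ∧
      (∀ k, ws k ∈ criticalCone C (xs k) (vs k)) ∧ Tendsto ws atTop (𝓝 w)}

/-- Convex polyhedron: finite intersection of closed half-spaces. -/
def IsPolyhedron (C : Set X) : Prop :=
  ∃ (k : ℕ) (a : Fin k → X) (b : Fin k → ℝ), C = {x | ∀ i, ⟪a i, x⟫ ≤ b i}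

/-- Legendre form. -/
def LegendreForm (Qf : X → ℝ) : Prop :=
  (∃ A : X →L[ℝ] X, ∀ x, Qf x = ⟪A x, x⟫) ∧
  (∀ (xs : ℕ → X) (x : X), WeakTendsto xs x → Qf x ≤ liminf (fun k => Qf (xs k)) atTop) ∧
  (∀ (xs : ℕ → X) (x : X), WeakTendsto xs x →
     Tendsto (fun k => Qf (xs k)) atTop (𝓝 (Qf x)) → Tendsto xs atTop (𝓝 x))

/-- (A1) for a two-parametric base mapping. -/
def A1two (f : X → P → X) (xb : X) (pb : P) : Prop :=
  ∃ L > (0:ℝ), ∃ ε > (0:ℝ), ∀ x₁ x₂ p₁ p₂,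
    ‖x₁ - xb‖ < ε → ‖x₂ - xb‖ < ε → dist p₁ pb < ε → dist p₂ pb < ε →
    ‖f x₁ p₁ - f x₂ p₂‖ ≤ L * (‖x₁ - x₂‖ + dist p₁ p₂)

/-- (A4) for a two-parametric base mapping. -/
def A4two (f : X → P → X) (Df : X → P → X →L[ℝ] X) (xb : X) (pb : P) : Prop :=
  (∃ η > (0:ℝ), ∀ ε > (0:ℝ), ∃ δ > (0:ℝ), ∀ x p,
      ‖x - xb‖ < η → dist p pb < η →
      ∀ x', ‖x' - x‖ < δ → ‖f x' p - f x p - Df x p (x' - x)‖ ≤ ε * ‖x' - x‖) ∧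
  Tendsto (fun t : X × P => Df t.1 t.2) (𝓝 (xb, pb)) (𝓝 (Df xb pb))

/-- Euclidean distance in X × ℝ. -/
def pairDist (a b : X × ℝ) : ℝ := Real.sqrt (‖a.1 - b.1‖ ^ 2 + |a.2 - b.2| ^ 2)

/-- Pompeiu–Hausdorff distance between subsets of X × ℝ (Euclidean product norm). -/
def hausPH (C₁ C₂ : Set (X × ℝ)) : ℝ :=
  sInf {η : ℝ | 0 ≤ η ∧ (∀ a ∈ C₁, ∃ b ∈ C₂, pairDist a b ≤ η) ∧
                 ∀ b ∈ C₂, ∃ a ∈ C₁, pairDist a b ≤ η}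

/-- Nonparametric prox-regularity with parameter r. -/
def ProxRegWithNP (g : X → EReal) (xb vh : X) (r : ℝ) : Prop :=
  ∃ ε > (0:ℝ), ∀ x u v, ‖x - xb‖ < ε → ‖u - xb‖ < ε → ‖v - vh‖ < ε →
    v ∈ limSubdiff g u → g u ≤ g xb + (ε : EReal) →
    g u + ((⟪v, x - u⟫ - r / 2 * ‖x - u‖ ^ 2 : ℝ) : EReal) ≤ g x

/-- Nonparametric subdifferential continuity. -/
def SubdiffContNP (g : X → EReal) (xb vh : X) : Prop :=
  Tendsto (fun t : X × X => g t.1) (𝓝[gph (limSubdiff g)] (xb, vh)) (𝓝 (g xb))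

/-- Nonparametric threshold of prox-regularity. -/
def proxThresholdNP (g : X → EReal) (xb vh : X) : ℝ :=
  sInf {r : ℝ | 0 < r ∧ ProxRegWithNP g xb vh r}


/-- A bounded-below lower semicontinuous function on a bounded closed set of a Hilbert space
admits points where it is supported from below by a small concave quadratic. -/
theorem exists_small_proximal_subgradient [CompleteSpace X] {φ : X → ℝ} {D : Set X}
    (hD : IsClosed D) (hne : D.Nonempty) {R : ℝ} (hR : ∀ x ∈ D, ∀ y ∈ D, ‖x - y‖ ≤ R)
    (hφ : LowerSemicontinuousOn φ D) {m : ℝ} (hm : ∀ x ∈ D, m ≤ φ x) {ε : ℝ} (hε : 0 < ε) :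
    ∃ x ∈ D, ∃ ζ : X, ‖ζ‖ ≤ ε ∧ ∀ y ∈ D, φ x + ⟪ζ, y - x⟫ - ε * ‖y - x‖ ^ 2 ≤ φ y := by
  obtain ⟨x₀, hx₀⟩ := hne
  have hR0 : 0 ≤ R := by simpa using hR x₀ hx₀ x₀ hx₀
  set μ : ℝ := ε / (1 + 2 * R) with hμdef
  have hμ : 0 < μ := by positivity
  have hμε : μ * (1 + 2 * R) = ε := by rw [hμdef]; field_simp
  let q : ℕ → ℝ := fun k => (1 / 2 : ℝ) ^ k
  have hq : ∀ k, 0 < q k := fun k => by positivity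
  have hq1 : ∀ k, q k ≤ 1 := fun k => pow_le_one₀ (by norm_num) (by norm_num)
  have hqs : ∀ k, q (k + 1) = q k / 2 := fun k => by simp only [q, pow_succ]; ring
  have hq0 : Tendsto q atTop (𝓝 0) :=
    tendsto_pow_atTop_nhds_zero_of_lt_one (by norm_num) (by norm_num)
  let ψ : ℕ → X → X → ℝ := fun k c x => φ x + μ * (1 - q k) * ‖x‖ ^ 2 - 2 * ⟪c, x⟫
  have hnorm : ∀ x ∈ D, ‖x‖ ≤ ‖x₀‖ + R := fun x hx => by
    have h1 := hR x hx x₀ hx₀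
    have h2 : ‖x‖ ≤ ‖x₀‖ + ‖x - x₀‖ := by
      simpa using norm_add_le x₀ (x - x₀)
    linarith
  have hpick : ∀ k c, ∃ x ∈ D, ∀ y ∈ D, ψ k c x ≤ ψ k c y + μ * q k ^ 4 := by
    intro k c
    have hbdd : BddBelow (ψ k c '' D) := by
      refine ⟨m - 2 * (‖c‖ * (‖x₀‖ + R)), ?_⟩
      rintro _ ⟨x, hx, rfl⟩
      have h1 := hm x hx
      have h2 : ⟪c, x⟫ ≤ ‖c‖ * (‖x₀‖ + R) :=
        (real_inner_le_norm c x).trans (by gcongr; exact hnorm x hx)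
      have h3 : 0 ≤ μ * (1 - q k) * ‖x‖ ^ 2 := by
        have := hq1 k
        have : 0 ≤ 1 - q k := by linarith
        positivity
      simp only [ψ]
      linarith
    have hpos : 0 < μ * q k ^ 4 := by have := hq k; positivity
    obtain ⟨_, ⟨x, hx, rfl⟩, hlt⟩ :=
      exists_lt_of_csInf_lt (s := ψ k c '' D) ⟨_, x₀, hx₀, rfl⟩
        (b := sInf (ψ k c '' D) + μ * q k ^ 4) (by linarith)
    refine ⟨x, hx, fun y hy => ?_⟩
    have := csInf_le hbdd ⟨y, hy, rfl⟩
    linarith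
  choose pick hpickD hpick using hpick
  let c : ℕ → X := fun n => Nat.rec 0 (fun k c => c + (μ * q (k + 1)) • pick k c) n
  let x : ℕ → X := fun k => pick k (c k)
  have hc : ∀ k, c (k + 1) = c k + (μ * q (k + 1)) • x k := fun k => rfl
  have hxD : ∀ k, x k ∈ D := fun k => hpickD _ _
  have hx : ∀ k, ∀ y ∈ D, ψ k (c k) (x k) ≤ ψ k (c k) y + μ * q k ^ 4 := fun k => hpick _ _
  have hψ : ∀ k y, ψ (k + 1) (c (k + 1)) y =
      ψ k (c k) y + μ * q (k + 1) * (‖y - x k‖ ^ 2 - ‖x k‖ ^ 2) := by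
    intro k y
    simp only [ψ, hc, inner_add_left, real_inner_smul_left, norm_sub_sq_real,
      real_inner_comm (x k) y, hqs]
    ring
  have hstep : ∀ k, dist (x k) (x (k + 1)) ≤ 2 * (1 / 2) ^ k := by
    intro k
    have h1 := hx (k + 1) (x k) (hxD k)
    have h2 := hx k (x (k + 1)) (hxD (k + 1))
    rw [hψ, hψ] at h1
    simp only [sub_self, norm_zero] at h1
    have hk := hq k
    have h3 : μ * q (k + 1) * ‖x (k + 1) - x k‖ ^ 2 ≤ μ * q (k + 1) * (2 * q k) ^ 2 := by
      have h4 : μ * q (k + 1) * ‖x (k + 1) - x k‖ ^ 2 ≤ μ * q k ^ 4 + μ * q (k + 1) ^ 4 := by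
        linarith
      refine h4.trans ?_
      rw [hqs]
      have : q k ^ 4 ≤ q k ^ 3 := pow_le_pow_of_le_one hk.le (hq1 k) (by norm_num)
      have h5 : μ * q k ^ 4 ≤ μ * q k ^ 3 := by gcongr
      have h6 : 0 ≤ μ * q k ^ 3 := by positivity
      nlinarith
    have h4 : 0 < μ * q (k + 1) := by have := hq (k + 1); positivity
    have h5 := le_of_mul_le_mul_left h3 h4
    rw [dist_comm, dist_eq_norm]
    exact le_of_sq_le_sq h5 (by positivity)
  obtain ⟨xh, hxh⟩ := cauchySeq_tendsto_of_complete
    (cauchySeq_of_le_geometric (1 / 2) 2 (by norm_num) hstep)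
  have hxhD : xh ∈ D := hD.mem_of_tendsto hxh (Eventually.of_forall hxD)
  have hcstep : ∀ k, dist (c k) (c (k + 1)) ≤ μ * (‖x₀‖ + R) * (1 / 2) ^ k := by
    intro k
    have hk := hq k
    rw [hc, dist_self_add_right, norm_smul, Real.norm_of_nonneg (by have := hq (k+1); positivity),
      hqs]
    have := hnorm _ (hxD k)
    calc μ * (q k / 2) * ‖x k‖ ≤ μ * (q k / 2) * (‖x₀‖ + R) := by gcongr
      _ ≤ μ * (q k) * (‖x₀‖ + R) := by gcongr; linarith
      _ = _ := by simp only [q]; ring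
  obtain ⟨ch, hch⟩ := cauchySeq_tendsto_of_complete
    (cauchySeq_of_le_geometric (1 / 2) _ (by norm_num) hcstep)
  have hbound : ∀ k, ‖(μ * (1 - q k)) • xh - c k‖ ≤ μ * (1 - q k) * R := by
    intro k
    induction k with
    | zero => simp [q, c]
    | succ k ih =>
      have hk := hq k
      have h1 : (μ * (1 - q (k + 1))) • xh - c (k + 1) =
          ((μ * (1 - q k)) • xh - c k) + (μ * q (k + 1)) • (xh - x k) := by
        rw [hc, hqs]; module
      rw [h1]
      refine (norm_add_le _ _).trans ?_
      rw [norm_smul, Real.norm_of_nonneg (by have := hq (k+1); positivity)]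
      have h2 : μ * q (k + 1) * ‖xh - x k‖ ≤ μ * q (k + 1) * R := by
        have := hq (k+1)
        gcongr
        exact hR _ hxhD _ (hxD k)
      rw [hqs] at *
      linarith
  have hmlim : Tendsto (fun k => μ * (1 - q k)) atTop (𝓝 μ) := by
    simpa using ((tendsto_const_nhds (x := (1 : ℝ))).sub hq0).const_mul μ
  have hζ : ‖μ • xh - ch‖ ≤ μ * R :=
    le_of_tendsto_of_tendsto' ((hmlim.smul_const xh).sub hch).norm (hmlim.mul_const R) hbound
  refine ⟨xh, hxhD, (-2 : ℝ) • (μ • xh - ch), ?_, fun y hy => ?_⟩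
  · rw [norm_smul]
    norm_num
    nlinarith
  · have hlim : Tendsto (fun k => φ y + μ * (1 - q k) * (‖y‖ ^ 2 - ‖x k‖ ^ 2)
        - 2 * ⟪c k, y - x k⟫ + μ * q k ^ 4) atTop
        (𝓝 (φ y + μ * (‖y‖ ^ 2 - ‖xh‖ ^ 2) - 2 * ⟪ch, y - xh⟫ + μ * 0 ^ 4)) := by
      refine ((tendsto_const_nhds.add (hmlim.mul (tendsto_const_nhds.sub (hxh.norm.pow 2)))).sub
        ((hch.inner (tendsto_const_nhds.sub hxh)).const_mul 2)).add ((hq0.pow 4).const_mul μ)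
    have hle : ∀ k, φ (x k) ≤ φ y + μ * (1 - q k) * (‖y‖ ^ 2 - ‖x k‖ ^ 2)
        - 2 * ⟪c k, y - x k⟫ + μ * q k ^ 4 := fun k => by
      have := hx k y hy
      simp only [ψ] at this
      rw [inner_sub_right]
      linarith
    have hfin : φ xh ≤ φ y + μ * (‖y‖ ^ 2 - ‖xh‖ ^ 2) - 2 * ⟪ch, y - xh⟫ + μ * 0 ^ 4 := by
      refine le_of_forall_lt fun β hβ => ?_
      have hxh' : Tendsto x atTop (𝓝[D] xh) :=
        tendsto_nhdsWithin_iff.2 ⟨hxh, Eventually.of_forall hxD⟩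
      obtain ⟨β', hβ1, hβ2⟩ := exists_between hβ
      refine hβ1.trans_le (ge_of_tendsto hlim ?_)
      filter_upwards [hxh'.eventually (hφ xh hxhD β' hβ2)] with k hk
      exact hk.le.trans (hle k)
    have h1 : ‖y‖ ^ 2 - ‖xh‖ ^ 2 = ‖y - xh‖ ^ 2 + 2 * ⟪xh, y - xh⟫ := by
      rw [norm_sub_sq_real, inner_sub_right, real_inner_self_eq_norm_sq, real_inner_comm xh y]
      ring
    rw [h1] at hfin
    rw [real_inner_smul_left, inner_sub_left, real_inner_smul_left]
    have h2 : μ * ‖y - xh‖ ^ 2 ≤ ε * ‖y - xh‖ ^ 2 := by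
      gcongr
      nlinarith
    linarith

/-- Mean value inequality: a locally Lipschitz function all of whose proximal subgradients are
bounded by `M` is `M`-Lipschitz. -/
theorem sub_le_of_proximal_subgradient_bound [CompleteSpace X] {φ : X → ℝ} {c : X} {ρ L M : ℝ}
    (hρ : 0 < ρ) (hL : 0 ≤ L) (hM : 0 ≤ M)
    (hLip : ∀ x ∈ ball c (3 * ρ), ∀ y ∈ ball c (3 * ρ), |φ x - φ y| ≤ L * ‖x - y‖)
    (hsub : ∀ x ∈ ball c (3 * ρ), ∀ (ζ : X) (α : ℝ),
      (∀ᶠ y in 𝓝 x, φ x + ⟪ζ, y - x⟫ - α * ‖y - x‖ ^ 2 ≤ φ y) → ‖ζ‖ ≤ M) :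
    ∀ x ∈ ball c ρ, ∀ y ∈ ball c ρ, φ x - φ y ≤ M * ‖x - y‖ := by
  set C : ℝ := (L + 1) / ρ with hCdef
  have hC : 0 < C := by positivity
  have hCρ : C * ρ = L + 1 := by rw [hCdef]; field_simp
  have hloc : ∀ M' > M, ∀ x ∈ ball c ρ, ∀ y ∈ ball c ρ,
      φ x - φ y ≤ M' * ‖x - y‖ + C * ‖x - y‖ ^ 2 := by
    intro M' hM' y₁ hy₁ y₂ hy₂
    by_contra! hcon
    have hin : closedBall y₁ (2 * ρ) ⊆ ball c (3 * ρ) := fun z hz => by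
      have := dist_triangle z y₁ c
      rw [mem_closedBall] at hz
      rw [mem_ball] at *
      linarith
    have hy₂D : y₂ ∈ closedBall y₁ (2 * ρ) := by
      have := dist_triangle_right y₂ y₁ c
      rw [mem_ball] at *
      rw [mem_closedBall]
      linarith
    let ψ : X → ℝ := fun y => φ y + M' * ‖y - y₁‖ + C * ‖y - y₁‖ ^ 2
    have hφc : ContinuousOn φ (closedBall y₁ (2 * ρ)) := by
      have : LipschitzOnWith (Real.toNNReal L) φ (closedBall y₁ (2 * ρ)) :=
        LipschitzOnWith.of_dist_le_mul fun x hx y hy => by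
          rw [Real.dist_eq, dist_eq_norm, Real.coe_toNNReal _ hL]
          exact hLip x (hin hx) y (hin hy)
      exact this.continuousOn
    have hψc : ContinuousOn ψ (closedBall y₁ (2 * ρ)) := by
      simp only [ψ]; fun_prop
    have hbd : ∀ x ∈ closedBall y₁ (2 * ρ), φ y₁ - L * (2 * ρ) ≤ ψ x := fun x hx => by
      have h1 := (abs_le.1 (hLip y₁ (hin (mem_closedBall_self (by positivity))) x (hin hx))).2
      have h2 : ‖y₁ - x‖ ≤ 2 * ρ := by rw [← dist_eq_norm, dist_comm]; exact hx
      have h3 : L * ‖y₁ - x‖ ≤ L * (2 * ρ) := by gcongr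
      have h4 : 0 ≤ M' * ‖x - y₁‖ := by
        have : 0 ≤ M' := by linarith
        positivity
      have h5 : 0 ≤ C * ‖x - y₁‖ ^ 2 := by positivity
      simp only [ψ]
      linarith
    set γ : ℝ := φ y₁ - ψ y₂ with hγdef
    have hγ : 0 < γ := by
      simp only [hγdef, ψ]
      rw [norm_sub_rev] at hcon
      linarith
    obtain ⟨ε, hε, hε1, hε2⟩ : ∃ ε > 0, ε < M' - M ∧ ε * (4 * ρ + (4 * ρ) ^ 2) < γ := by
      have h1 : ∀ᶠ ε : ℝ in 𝓝[>] 0, ε * (4 * ρ + (4 * ρ) ^ 2) < γ := by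
        refine Filter.Eventually.filter_mono nhdsWithin_le_nhds ?_
        refine ContinuousAt.eventually_lt (by fun_prop) continuousAt_const (by simpa using hγ)
      have h2 : ∀ᶠ ε : ℝ in 𝓝[>] 0, ε ∈ Ioo 0 (M' - M) :=
        Ioo_mem_nhdsGT (by linarith)
      obtain ⟨ε, h1, h2⟩ := (h1.and h2).exists
      exact ⟨ε, h2.1, h2.2, h1⟩
    obtain ⟨xh, hxh, ζ, hζ, hmin⟩ := exists_small_proximal_subgradient (R := 4 * ρ)
      isClosed_closedBall ⟨y₂, hy₂D⟩
      (fun x hx y hy => by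
        rw [← dist_eq_norm]
        have := dist_triangle_right x y y₁
        rw [mem_closedBall] at *
        linarith) hψc.lowerSemicontinuousOn hbd hε
    have hval : ψ xh < φ y₁ := by
      have h1 := hmin y₂ hy₂D
      have h2 : ‖y₂ - xh‖ ≤ 4 * ρ := by
        rw [← dist_eq_norm]
        have := dist_triangle_right y₂ xh y₁
        rw [mem_closedBall] at *
        linarith
      have h3 := abs_le.1 (abs_real_inner_le_norm ζ (y₂ - xh))
      have h4 : ‖ζ‖ * ‖y₂ - xh‖ ≤ ε * (4 * ρ) := by gcongr
      have h5 : ε * ‖y₂ - xh‖ ^ 2 ≤ ε * (4 * ρ) ^ 2 := by gcongr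
      linarith [h3.1]
    have ht : 0 < ‖xh - y₁‖ := by
      rw [norm_pos_iff, sub_ne_zero]
      rintro rfl
      simp [ψ] at hval
    have ht' : ‖xh - y₁‖ < 2 * ρ := by
      refine lt_of_le_of_ne (by rw [← dist_eq_norm]; exact hxh) fun h => ?_
      have h1 := (abs_le.1 (hLip y₁ (hin (mem_closedBall_self (by positivity))) xh (hin hxh))).2
      rw [norm_sub_rev, h] at h1
      simp only [ψ, h] at hval
      have h4 : 0 ≤ M' * (2 * ρ) := by
        have : 0 ≤ M' := by linarith
        positivity
      nlinarith
    set t := ‖xh - y₁‖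
    have key := hsub xh (hin hxh) (ζ - (M' / t + 2 * C) • (xh - y₁)) (ε + M' / (2 * t) + C) (by
      filter_upwards [isOpen_ball.mem_nhds (show xh ∈ ball y₁ (2 * ρ) by
        rw [mem_ball, dist_eq_norm]; exact ht')] with y hy
      have h1 := hmin y (ball_subset_closedBall hy)
      have h2 : ‖y - y₁‖ ^ 2 = ‖y - xh‖ ^ 2 + 2 * ⟪xh - y₁, y - xh⟫ + t ^ 2 := by
        rw [show y - y₁ = (y - xh) + (xh - y₁) by abel, norm_add_sq_real, real_inner_comm]
      have h3 : M' * ‖y - y₁‖ ≤ M' / (2 * t) * (‖y - y₁‖ ^ 2 + t ^ 2) := by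
        have h4 : 2 * t * ‖y - y₁‖ ≤ ‖y - y₁‖ ^ 2 + t ^ 2 := by
          nlinarith [sq_nonneg (‖y - y₁‖ - t)]
        have h5 : 0 ≤ M' / (2 * t) := by
          have : 0 ≤ M' := by linarith
          positivity
        calc M' * ‖y - y₁‖ = M' / (2 * t) * (2 * t * ‖y - y₁‖) := by field_simp
          _ ≤ _ := by gcongr
      simp only [ψ] at h1
      rw [h2] at h3 h1
      rw [inner_sub_left, real_inner_smul_left]
      have h6 : M' / (2 * t) * (‖y - xh‖ ^ 2 + 2 * ⟪xh - y₁, y - xh⟫ + t ^ 2 + t ^ 2) =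
          M' / (2 * t) * ‖y - xh‖ ^ 2 + M' / t * ⟪xh - y₁, y - xh⟫ + M' * t := by
        field_simp; ring
      change φ xh + M' * t + C * t ^ 2 + _ - _ ≤ _ at h1
      linarith)
    have h1 : ‖(M' / t + 2 * C) • (xh - y₁)‖ = M' + 2 * C * t := by
      have : 0 ≤ M' / t + 2 * C := by
        have : 0 ≤ M' := by linarith
        positivity
      rw [norm_smul, Real.norm_of_nonneg this]
      change (M' / t + 2 * C) * t = _
      field_simp
    have h2 := norm_sub_norm_le ((M' / t + 2 * C) • (xh - y₁)) ζ
    rw [norm_sub_rev, h1] at h2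
    have : 0 < C * t := by positivity
    linarith
  have hhalf : ∀ n : ℕ, ∀ M' > M, ∀ x ∈ ball c ρ, ∀ y ∈ ball c ρ,
      φ x - φ y ≤ M' * ‖x - y‖ + C * (1 / 2) ^ n * ‖x - y‖ ^ 2 := by
    intro n
    induction n with
    | zero => simpa using hloc
    | succ n ih =>
      intro M' hM' x hx y hy
      have hz : midpoint ℝ x y ∈ ball c ρ := (convex_ball c ρ).midpoint_mem hx hy
      have h1 := ih M' hM' x hx _ hz
      have h2 := ih M' hM' _ hz y hy
      have h3 : ‖x - midpoint ℝ x y‖ = ‖x - y‖ / 2 := by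
        rw [← dist_eq_norm, dist_left_midpoint, dist_eq_norm]; norm_num; ring
      have h4 : ‖midpoint ℝ x y - y‖ = ‖x - y‖ / 2 := by
        rw [← dist_eq_norm, dist_midpoint_right, dist_eq_norm]; norm_num; ring
      rw [h3] at h1
      rw [h4] at h2
      rw [pow_succ]
      linarith
  intro x hx y hy
  have hq0 : Tendsto (fun n : ℕ => (1 / 2 : ℝ) ^ n) atTop (𝓝 0) :=
    tendsto_pow_atTop_nhds_zero_of_lt_one (by norm_num) (by norm_num)
  have hlim : Tendsto (fun n : ℕ => (M + (1 / 2 : ℝ) ^ n) * ‖x - y‖ +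
      C * (1 / 2) ^ n * ‖x - y‖ ^ 2) atTop
      (𝓝 ((M + 0) * ‖x - y‖ + C * 0 * ‖x - y‖ ^ 2)) :=
    (((tendsto_const_nhds.add hq0).mul_const _)).add ((hq0.const_mul C).mul_const _)
  have := ge_of_tendsto' hlim fun n =>
    hhalf n (M + (1 / 2) ^ n) (by have : (0 : ℝ) < (1 / 2) ^ n := by positivity
                                  linarith) x hx y hy
  simpa using this

section LocalInverse

variable {Pi : Type*} [PseudoMetricSpace Pi]

/-- The parametric inclusion `y ∈ G π x` has solutions near `xb` for `(π, y)` near `(πb, yb)`. -/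
def LocExist (G : Pi → X → Set X) (πb : Pi) (xb yb : X) : Prop :=
  ∀ a > (0 : ℝ), ∃ b > (0 : ℝ), ∀ π y, dist π πb < b → ‖y - yb‖ < b →
    ∃ x, ‖x - xb‖ < a ∧ y ∈ G π x

/-- `G π` is strongly monotone with modulus `m` near `(xb, yb)`, uniformly for `π` near `πb`. -/
def LocMono (G : Pi → X → Set X) (πb : Pi) (xb yb : X) (m : ℝ) : Prop :=
  ∃ δ > (0 : ℝ), ∀ π x₁ x₂ y₁ y₂, dist π πb < δ → ‖x₁ - xb‖ < δ → ‖x₂ - xb‖ < δ →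
    ‖y₁ - yb‖ < δ → ‖y₂ - yb‖ < δ → y₁ ∈ G π x₁ → y₂ ∈ G π x₂ →
    m * ‖x₁ - x₂‖ ^ 2 ≤ ⟪y₁ - y₂, x₁ - x₂⟫

theorem mul_norm_le_of_mul_sq_le_inner {m : ℝ} {x y : X}
    (h : m * ‖x‖ ^ 2 ≤ ⟪y, x⟫) : m * ‖x‖ ≤ ‖y‖ := by
  rcases eq_or_lt_of_le (norm_nonneg x) with h0 | h0
  · rw [← h0]; simp
  · have := real_inner_le_norm y x
    refine le_of_mul_le_mul_right ?_ h0
    nlinarith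

theorem LocExist.add_perturbation [CompleteSpace X] {G : Pi → X → Set X} {πb : Pi} {xb yb : X}
    {m : ℝ} (hE : LocExist G πb xb yb) (hM : LocMono G πb xb yb m)
    {e : Pi → X → X} {c : ℝ} (hc : 0 ≤ c) (hcm : c < m)
    (hLip : ∃ δ > (0 : ℝ), ∀ π x₁ x₂, dist π πb < δ → ‖x₁ - xb‖ < δ → ‖x₂ - xb‖ < δ →
      ‖e π x₁ - e π x₂‖ ≤ c * ‖x₁ - x₂‖)
    (hcont : ∀ ε > (0 : ℝ), ∃ η > (0 : ℝ), ∀ π, dist π πb < η → ‖e π xb - e πb xb‖ ≤ ε) :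
    LocExist (fun π x => {y | y - e π x ∈ G π x}) πb xb (yb + e πb xb) := by
  intro a ha
  have hm : 0 < m := hc.trans_lt hcm
  obtain ⟨δ₁, hδ₁, hM⟩ := hM
  obtain ⟨δ₂, hδ₂, hLip⟩ := hLip
  obtain ⟨b₁, hb₁, hE₁⟩ := hE δ₁ hδ₁
  obtain ⟨a₀, ha₀, ha₀a, ha₀δ₁, ha₀δ₂, ha₀b, ha₀c⟩ : ∃ a₀ > 0, a₀ < a ∧ a₀ < δ₁ ∧ a₀ < δ₂ ∧
      c * a₀ < b₁ / 2 ∧ c * a₀ < δ₁ / 2 := by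
    have h0 : ∀ᶠ t : ℝ in 𝓝[>] 0, 0 < t := self_mem_nhdsWithin
    have h1 : ∀ b > 0, ∀ᶠ t : ℝ in 𝓝[>] 0, t < b := fun b hb =>
      nhdsWithin_le_nhds (gt_mem_nhds hb)
    have h2 : ∀ b > 0, ∀ᶠ t : ℝ in 𝓝[>] 0, c * t < b := fun b hb =>
      nhdsWithin_le_nhds (ContinuousAt.eventually_lt (by fun_prop) continuousAt_const
        (by simpa using hb))
    obtain ⟨t, ht⟩ := (h0.and ((h1 a ha).and ((h1 δ₁ hδ₁).and ((h1 δ₂ hδ₂).and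
      ((h2 (b₁ / 2) (by positivity)).and (h2 (δ₁ / 2) (by positivity))))))).exists
    exact ⟨t, ht.1, ht.2.1, ht.2.2.1, ht.2.2.2.1, ht.2.2.2.2.1, ht.2.2.2.2.2⟩
  have hcm' : 0 < m - c := by linarith
  obtain ⟨b₂, hb₂, hE₂⟩ := hE ((m - c) * a₀ / (2 * m)) (by positivity)
  have ha₂ : (m - c) * a₀ / (2 * m) < a₀ := by
    rw [div_lt_iff₀ (by positivity)]
    nlinarith
  obtain ⟨ε, hε, hεb, hεδ, hεa⟩ : ∃ ε > 0, 4 * ε ≤ b₁ ∧ 4 * ε ≤ δ₁ ∧ 4 * ε ≤ (m - c) * a₀ := by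
    refine ⟨min b₁ (min δ₁ ((m - c) * a₀)) / 4, by positivity, ?_, ?_, ?_⟩
    · linarith [min_le_left b₁ (min δ₁ ((m - c) * a₀))]
    · linarith [min_le_right b₁ (min δ₁ ((m - c) * a₀)), min_le_left δ₁ ((m - c) * a₀)]
    · linarith [min_le_right b₁ (min δ₁ ((m - c) * a₀)), min_le_right δ₁ ((m - c) * a₀)]
  obtain ⟨η, hη, hcont⟩ := hcont ε hε
  refine ⟨min (min b₁ b₂) (min (min δ₁ δ₂) (min η ε)), by positivity, fun π y hπ hy => ?_⟩
  simp only [lt_min_iff] at hπ hy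
  obtain ⟨⟨hπ1, hπ2⟩, ⟨hπ3, hπ4⟩, hπ5, -⟩ := hπ
  have hsel : ∀ y', ∃ x, ‖y' - yb‖ < b₁ → ‖x - xb‖ < δ₁ ∧ y' ∈ G π x := fun y' => by
    by_cases h : ‖y' - yb‖ < b₁
    · obtain ⟨x, hx⟩ := hE₁ π y' hπ1 h
      exact ⟨x, fun _ => hx⟩
    · exact ⟨xb, fun h' => absurd h' h⟩
  choose ϑ hϑ using hsel
  obtain ⟨xs, hxs, hxsG⟩ := hE₂ π yb hπ2 (by simpa using hb₂)
  have hval : ∀ x ∈ closedBall xb a₀, ‖(y - e π x) - yb‖ ≤ 2 * ε + c * a₀ := fun x hx => by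
    rw [mem_closedBall, dist_eq_norm] at hx
    have h1 := hLip π x xb hπ4 (hx.trans_lt ha₀δ₂) (by simpa using hδ₂)
    have h2 := hcont π hπ5
    have h3 : (y - e π x) - yb =
      (y - (yb + e πb xb)) - (e π xb - e πb xb) - (e π x - e π xb) := by abel
    rw [h3]
    have h4 := norm_sub_le ((y - (yb + e πb xb)) - (e π xb - e πb xb)) (e π x - e π xb)
    have h5 := norm_sub_le (y - (yb + e πb xb)) (e π xb - e πb xb)
    have h6 : c * ‖x - xb‖ ≤ c * a₀ := by gcongr
    linarith [hy.2.2.2]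
  have hb' : ∀ x ∈ closedBall xb a₀, ‖(y - e π x) - yb‖ < b₁ := fun x hx =>
    (hval x hx).trans_lt (by linarith)
  have hδ' : ∀ x ∈ closedBall xb a₀, ‖(y - e π x) - yb‖ < δ₁ := fun x hx =>
    (hval x hx).trans_lt (by linarith)
  set Φ : X → X := fun x => ϑ (y - e π x) with hΦ
  have hmaps : MapsTo Φ (closedBall xb a₀) (closedBall xb a₀) := fun x hx => by
    have h1 := hM π (Φ x) xs (y - e π x) yb hπ3 (hϑ _ (hb' x hx)).1 (by linarith) (hδ' x hx)
      (by simpa using hδ₁) (hϑ _ (hb' x hx)).2 hxsG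
    have h2 := (mul_norm_le_of_mul_sq_le_inner h1).trans (hval x hx)
    have h3 : ‖Φ x - xb‖ ≤ ‖Φ x - xs‖ + ‖xs - xb‖ := by
      simpa using norm_add_le (Φ x - xs) (xs - xb)
    rw [lt_div_iff₀ (by positivity)] at hxs
    rw [mem_closedBall, dist_eq_norm]
    refine le_of_mul_le_mul_left ?_ hm
    nlinarith
  have hK : c / m < 1 := by rwa [div_lt_one hm]
  have hcontr : ContractingWith (Real.toNNReal (c / m)) (hmaps.restrict Φ _ _) := by
    refine ⟨by rw [← Real.toNNReal_one, Real.toNNReal_lt_toNNReal_iff one_pos]; exact hK,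
      LipschitzWith.of_dist_le_mul ?_⟩
    rintro ⟨x₁, hx₁⟩ ⟨x₂, hx₂⟩
    rw [Real.coe_toNNReal _ (by positivity), Subtype.dist_eq, Subtype.dist_eq,
      MapsTo.val_restrict_apply, MapsTo.val_restrict_apply, dist_eq_norm, dist_eq_norm]
    have h1 := mul_norm_le_of_mul_sq_le_inner (hM π (Φ x₁) (Φ x₂) _ _ hπ3 (hϑ _ (hb' x₁ hx₁)).1
      (hϑ _ (hb' x₂ hx₂)).1 (hδ' x₁ hx₁) (hδ' x₂ hx₂) (hϑ _ (hb' x₁ hx₁)).2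
      (hϑ _ (hb' x₂ hx₂)).2)
    rw [sub_sub_sub_cancel_left] at h1
    rw [mem_closedBall, dist_eq_norm] at hx₁ hx₂
    have h2 := hLip π x₂ x₁ hπ4 (by linarith) (by linarith)
    rw [norm_sub_rev x₂] at h2
    rw [div_mul_eq_mul_div, le_div_iff₀ hm]
    linarith
  obtain ⟨x, hx, hfix, -⟩ := ContractingWith.exists_fixedPoint' isClosed_closedBall.isComplete
    hmaps hcontr (mem_closedBall_self ha₀.le) (edist_ne_top _ _)
  refine ⟨x, ?_, ?_⟩
  · rw [mem_closedBall, dist_eq_norm] at hx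
    linarith
  · have h1 := (hϑ _ (hb' x hx)).2
    have h2 : ϑ (y - e π x) = x := hfix
    rwa [h2] at h1

/-- A proximal subgradient of `y ↦ ⟪z, y - (2 * K) • ϑ y⟫`, where `ϑ` is a local inverse of
`F + B`, yields an element of the regular coderivative of `F`. -/
theorem mem_regCoderiv_of_proximal_of_localInverse [CompleteSpace X] {F : X → Set X}
    {B : X →L[ℝ] X} {ϑ : X → X} {x y z ζ : X} {K α : ℝ} (hx : ϑ y = x)
    (hloc : ∀ᶠ t in 𝓝[gph F] (x, y - B x), ϑ (t.2 + B t.1) = t.1)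
    (hζ : ∀ᶠ y' in 𝓝 y, ⟪z, y - (2 * K) • ϑ y⟫ + ⟪ζ, y' - y⟫ - α * ‖y' - y‖ ^ 2 ≤
      ⟪z, y' - (2 * K) • ϑ y'⟫) :
    (2 * K) • z - ContinuousLinearMap.adjoint B (z - ζ) ∈ regCoderiv F x (y - B x) (z - ζ) := by
  intro ε hε
  obtain ⟨τ, hτ, hτε⟩ : ∃ τ > 0, ∀ t : X, ‖t‖ < τ →
      α * ‖t‖ ^ 2 ≤ ε / (2 * (‖B‖ + 1)) * ‖t‖ := by
    refine ⟨ε / (2 * (‖B‖ + 1)) / (|α| + 1), by positivity, fun t ht => ?_⟩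
    rw [lt_div_iff₀ (by positivity)] at ht
    have h1 := le_abs_self α
    have h2 := norm_nonneg t
    rw [sq, ← mul_assoc]
    gcongr
    nlinarith
  have hyc : Continuous fun t : X × X => t.2 + B t.1 := by fun_prop
  have hyc' : Tendsto (fun t : X × X => t.2 + B t.1) (𝓝[gph F] (x, y - B x)) (𝓝 y) := by
    have := (hyc.tendsto (x, y - B x)).mono_left (nhdsWithin_le_nhds (s := gph F))
    simpa using this
  filter_upwards [hyc'.eventually hζ, hloc, hyc'.eventually (ball_mem_nhds y hτ)] with t h1 h6 h5
  rw [h6, hx] at h1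
  set Δx := t.1 - x with hΔx
  set Δv := t.2 - (y - B x) with hΔv
  set ν := Real.sqrt (‖Δx‖ ^ 2 + ‖Δv‖ ^ 2) with hν
  have h7 : t.2 + B t.1 - y = B Δx + Δv := by rw [hΔx, hΔv, map_sub]; abel
  rw [dist_eq_norm, h7] at h5
  have h9 : ‖B Δx + Δv‖ ≤ (2 * (‖B‖ + 1)) * ν := by
    have e1 : ‖Δx‖ ≤ ν := Real.le_sqrt_of_sq_le (le_add_of_nonneg_right (sq_nonneg _))
    have e2 : ‖Δv‖ ≤ ν := Real.le_sqrt_of_sq_le (le_add_of_nonneg_left (sq_nonneg _))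
    have e3 := norm_add_le (B Δx) Δv
    have e4 := B.le_opNorm Δx
    have e5 : ‖B‖ * ‖Δx‖ ≤ ‖B‖ * ν := by gcongr
    have e6 : 0 ≤ ν := Real.sqrt_nonneg _
    have e7 : 0 ≤ ‖B‖ * ν := by positivity
    linarith
  have h10 : α * ‖B Δx + Δv‖ ^ 2 ≤ ε * ν := by
    refine (hτε _ h5).trans ?_
    calc ε / (2 * (‖B‖ + 1)) * ‖B Δx + Δv‖
        ≤ ε / (2 * (‖B‖ + 1)) * ((2 * (‖B‖ + 1)) * ν) := by gcongr
      _ = _ := by field_simp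
  have h11 : t.2 + B t.1 - (2 * K) • t.1 =
      (y - (2 * K) • x) + (B Δx + Δv) - (2 * K) • Δx := by
    rw [← h7, hΔx]; module
  rw [h7, h11, inner_sub_right z y, inner_add_right ζ, real_inner_smul_right] at h1
  have h12 : ⟪(2 * K) • z - ContinuousLinearMap.adjoint B (z - ζ), Δx⟫ + ⟪-(z - ζ), Δv⟫ =
      2 * K * ⟪z, Δx⟫ - ⟪z, B Δx + Δv⟫ + (⟪ζ, B Δx⟫ + ⟪ζ, Δv⟫) := by
    rw [inner_sub_left, real_inner_smul_left, ContinuousLinearMap.adjoint_inner_left,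
      inner_neg_left, inner_sub_left, inner_sub_left, inner_add_right]
    ring
  have h13 : ⟪z, y - (2 * K) • x + (B Δx + Δv) - (2 * K) • Δx⟫ =
      ⟪z, y⟫ - 2 * K * ⟪z, x⟫ + ⟪z, B Δx + Δv⟫ - 2 * K * ⟪z, Δx⟫ := by
    simp only [inner_sub_right, inner_add_right, real_inner_smul_right]
  change ⟪(2 * K) • z - ContinuousLinearMap.adjoint B (z - ζ), Δx⟫ + ⟪-(z - ζ), Δv⟫ ≤ ε * ν
  rw [h12]
  linarith

/-- A local Lipschitzian inverse whose graph satisfies the coderivative condition with modulus `K`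
is strongly monotone with that modulus. -/
theorem LocMono.of_coderivative [CompleteSpace X] {F : Pi → X → Set X} {B : X →L[ℝ] X}
    {πb : Pi} {xb vh : X} {K m : ℝ} (hK : 0 < K) (hm : 0 < m)
    (hE : LocExist (fun π x => {y | y - B x ∈ F π x}) πb xb (vh + B xb))
    (hM : LocMono (fun π x => {y | y - B x ∈ F π x}) πb xb (vh + B xb) m)
    (hS : ∃ η > (0 : ℝ), ∀ π u v, dist π πb ≤ η → ‖u - xb‖ ≤ η → ‖v - vh‖ ≤ η → v ∈ F π u →
      ∀ w z, z ∈ regCoderiv (F π) u v w → K * ‖w‖ ^ 2 ≤ ⟪B w, w⟫ + ⟪z, w⟫) :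
    LocMono (fun π x => {y | y - B x ∈ F π x}) πb xb (vh + B xb) K := by
  obtain ⟨δ, hδ, hM⟩ := hM
  obtain ⟨η, hη, hS⟩ := hS
  set a : ℝ := min δ (η / (2 * (‖B‖ + 1))) with hadef
  have haδ : a ≤ δ := min_le_left _ _
  have haη : a * (2 * (‖B‖ + 1)) ≤ η := by
    rw [← le_div_iff₀ (by positivity)]; exact min_le_right _ _
  have ha : 0 < a := by positivity
  have haη' : a ≤ η := by nlinarith [norm_nonneg B]
  obtain ⟨b, hb, hE⟩ := hE a ha
  set ρ : ℝ := min a b / 3 with hρdef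
  have hρ : 0 < ρ := by positivity
  have hρa : 3 * ρ ≤ a := by linarith [min_le_left a b]
  have hρb : 3 * ρ ≤ b := by linarith [min_le_right a b]
  refine ⟨ρ, hρ, fun π x₁ x₂ y₁ y₂ hπ hx₁ hx₂ hy₁ hy₂ hG₁ hG₂ => ?_⟩
  set yb := vh + B xb with hyb
  have hπδ : dist π πb < δ := by linarith
  have hsel : ∀ y, ∃ x, y ∈ ball yb (3 * ρ) → ‖x - xb‖ < a ∧ y - B x ∈ F π x := fun y => by
    by_cases h : y ∈ ball yb (3 * ρ)
    · rw [mem_ball, dist_eq_norm] at h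
      obtain ⟨x, hx⟩ := hE π y (by linarith) (by linarith)
      exact ⟨x, fun _ => hx⟩
    · exact ⟨xb, fun h' => absurd h' h⟩
  choose ϑ hϑ using hsel
  have hyδ : ∀ y ∈ ball yb (3 * ρ), ‖y - yb‖ < δ := fun y hy => by
    rw [mem_ball, dist_eq_norm] at hy; linarith
  have huniq : ∀ y ∈ ball yb (3 * ρ), ∀ x, ‖x - xb‖ < δ → y - B x ∈ F π x → ϑ y = x := by
    intro y hy x hx hxy
    have h1 := hM π (ϑ y) x y y hπδ ((hϑ y hy).1.trans_le haδ) hx (hyδ y hy) (hyδ y hy)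
      (hϑ y hy).2 hxy
    rw [sub_self, inner_zero_left] at h1
    have h2 : ‖ϑ y - x‖ ^ 2 ≤ 0 := by
      by_contra! h
      have := mul_pos hm h
      linarith
    have h3 : ‖ϑ y - x‖ = 0 := by nlinarith [norm_nonneg (ϑ y - x)]
    rwa [norm_eq_zero, sub_eq_zero] at h3
  have hϑLip : ∀ y ∈ ball yb (3 * ρ), ∀ y' ∈ ball yb (3 * ρ), m * ‖ϑ y - ϑ y'‖ ≤ ‖y - y'‖ :=
    fun y hy y' hy' => mul_norm_le_of_mul_sq_le_inner
      (hM π (ϑ y) (ϑ y') y y' hπδ ((hϑ y hy).1.trans_le haδ) ((hϑ y' hy').1.trans_le haδ)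
        (hyδ y hy) (hyδ y' hy') (hϑ y hy).2 (hϑ y' hy').2)
  let N : X → X := fun y => y - (2 * K) • ϑ y
  have hNLip : ∀ y ∈ ball yb (3 * ρ), ∀ y' ∈ ball yb (3 * ρ),
      ‖N y - N y'‖ ≤ (1 + 2 * K / m) * ‖y - y'‖ := fun y hy y' hy' => by
    have h1 : N y - N y' = (y - y') - (2 * K) • (ϑ y - ϑ y') := by simp only [N]; module
    have h2 := hϑLip y hy y' hy'
    rw [h1]
    refine (norm_sub_le _ _).trans ?_
    rw [norm_smul, Real.norm_of_nonneg (by positivity)]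
    have h3 : ‖ϑ y - ϑ y'‖ ≤ ‖y - y'‖ / m := by rw [le_div_iff₀ hm]; linarith
    calc ‖y - y'‖ + 2 * K * ‖ϑ y - ϑ y'‖ ≤ ‖y - y'‖ + 2 * K * (‖y - y'‖ / m) := by gcongr
      _ = _ := by ring
  have hNnonexp : ∀ z : X, ∀ y ∈ ball yb ρ, ∀ y' ∈ ball yb ρ,
      ⟪z, N y⟫ - ⟪z, N y'⟫ ≤ ‖z‖ * ‖y - y'‖ := by
    intro z
    refine sub_le_of_proximal_subgradient_bound (φ := fun y => ⟪z, N y⟫) hρ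
      (L := ‖z‖ * (1 + 2 * K / m)) (by positivity) (norm_nonneg z) ?_ ?_
    · intro y hy y' hy'
      rw [← inner_sub_right, mul_assoc]
      exact (abs_real_inner_le_norm _ _).trans (by gcongr; exact hNLip y hy y' hy')
    · intro y hy ζ α hζ
      set x := ϑ y with hxdef
      have hx := (hϑ y hy).1
      have hxF := (hϑ y hy).2
      set w := z - ζ with hw
      have hv : ‖(y - B x) - vh‖ ≤ η := by
        have h1 : (y - B x) - vh = (y - yb) - B (x - xb) := by rw [map_sub, hyb]; abel
        rw [h1]
        have h2 := norm_sub_le (y - yb) (B (x - xb))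
        have h3 := B.le_opNorm (x - xb)
        have h4 : ‖B‖ * ‖x - xb‖ ≤ ‖B‖ * a := by gcongr
        rw [mem_ball, dist_eq_norm] at hy
        nlinarith [norm_nonneg B]
      have hcod : (2 * K) • z - ContinuousLinearMap.adjoint B w ∈
          regCoderiv (F π) x (y - B x) w := by
        refine mem_regCoderiv_of_proximal_of_localInverse hxdef.symm ?_ hζ
        have hyc' : Tendsto (fun t : X × X => t.2 + B t.1)
            (𝓝[gph (F π)] (x, y - B x)) (𝓝 y) := by
          have hyc : Continuous fun t : X × X => t.2 + B t.1 := by fun_prop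
          have := (hyc.tendsto (x, y - B x)).mono_left
            (nhdsWithin_le_nhds (s := gph (F π)))
          simpa using this
        have hxc : ∀ᶠ t : X × X in 𝓝[gph (F π)] (x, y - B x), ‖t.1 - xb‖ < δ :=
          nhdsWithin_le_nhds (ContinuousAt.eventually_lt (by fun_prop) continuousAt_const
            (hx.trans_le haδ))
        filter_upwards [hyc'.eventually (isOpen_ball.mem_nhds hy), hxc, self_mem_nhdsWithin]
          with t h2 h3 h4
        exact huniq _ h2 _ h3 (by simpa [gph] using h4)
      have h1 := hS π x (y - B x) (by linarith) (by linarith) hv hxF w _ hcod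
      rw [inner_sub_left, real_inner_smul_left, ContinuousLinearMap.adjoint_inner_left,
        real_inner_comm (B w) w] at h1
      have h2 : ‖w‖ ^ 2 ≤ 2 * ⟪z, w⟫ := by
        refine le_of_mul_le_mul_left ?_ hK
        linarith
      rw [hw, norm_sub_sq_real, inner_sub_right, real_inner_self_eq_norm_sq] at h2
      exact le_of_sq_le_sq (by linarith) (norm_nonneg z)
  have hy₁' : y₁ ∈ ball yb ρ := by rwa [mem_ball, dist_eq_norm]
  have hy₂' : y₂ ∈ ball yb ρ := by rwa [mem_ball, dist_eq_norm]
  have h3ρ : ball yb ρ ⊆ ball yb (3 * ρ) := ball_subset_ball (by linarith)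
  have h1 := hNnonexp (N y₁ - N y₂) y₁ hy₁' y₂ hy₂'
  rw [← inner_sub_right, real_inner_self_eq_norm_mul_norm] at h1
  have hNe : N y₁ - N y₂ = (y₁ - y₂) - (2 * K) • (x₁ - x₂) := by
    simp only [N, huniq y₁ (h3ρ hy₁') x₁ (by linarith) hG₁,
      huniq y₂ (h3ρ hy₂') x₂ (by linarith) hG₂]
    module
  have h2 : ‖N y₁ - N y₂‖ ≤ ‖y₁ - y₂‖ := by
    rcases eq_or_lt_of_le (norm_nonneg (N y₁ - N y₂)) with h0 | h0
    · rw [← h0]; exact norm_nonneg _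
    · exact le_of_mul_le_mul_left h1 h0
  have h3 : ‖N y₁ - N y₂‖ ^ 2 ≤ ‖y₁ - y₂‖ ^ 2 := by gcongr
  rw [hNe, norm_sub_sq_real, real_inner_smul_right, norm_smul, mul_pow,
    Real.norm_of_nonneg (by positivity)] at h3
  refine le_of_mul_le_mul_left ?_ (show 0 < 4 * K by positivity)
  linarith

end LocalInverse

theorem mem_limSubdiff_of_proximal {h : X → EReal} {x v : X} {α c : ℝ} (hα : h x = α)
    (hv : ∀ᶠ u in 𝓝 x, ((α + ⟪v, u - x⟫ - c * ‖u - x‖ ^ 2 : ℝ) : EReal) ≤ h u) :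
    v ∈ limSubdiff h x := by
  refine ⟨fun _ => x, fun _ => v, tendsto_const_nhds, tendsto_const_nhds, fun _ => ?_,
    fun _ => tendsto_const_nhds⟩
  refine ⟨by rw [hα]; exact EReal.coe_ne_top _, by rw [hα]; exact EReal.coe_ne_bot _,
    fun ε hε => ?_⟩
  filter_upwards [hv, ball_mem_nhds x (show 0 < ε / (|c| + 1) by positivity)] with u hu hux
  rw [hα]
  refine le_trans ?_ hu
  rw [← EReal.coe_add, EReal.coe_le_coe_iff]
  rw [mem_ball, dist_eq_norm, lt_div_iff₀ (by positivity)] at hux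
  have h1 := le_abs_self c
  have h2 := norm_nonneg (u - x)
  have h3 : c * ‖u - x‖ * ‖u - x‖ ≤ ε * ‖u - x‖ := by
    gcongr
    nlinarith
  linarith

theorem exists_truncation {Z : Type*} [TopologicalSpace Z] {h : Z → EReal}
    (hh : LowerSemicontinuous h) (a b : ℝ) :
    ∃ τ : Z → ℝ, LowerSemicontinuous τ ∧
      ∀ x, ((τ x : ℝ) : EReal) = max (a : EReal) (min (h x) b) := by
  have key : ∀ x, (((max (a : EReal) (min (h x) b)).toReal : ℝ) : EReal) =
      max (a : EReal) (min (h x) b) := fun x => by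
    refine EReal.coe_toReal (ne_of_lt ?_) (ne_of_gt ?_)
    · exact max_lt (EReal.coe_lt_top a) ((min_le_right _ _).trans_lt (EReal.coe_lt_top b))
    · exact (EReal.bot_lt_coe a).trans_le (le_max_left _ _)
  refine ⟨fun x => (max (a : EReal) (min (h x) b)).toReal, fun x β hβ => ?_, key⟩
  have h1 : ∀ u, β < (max (a : EReal) (min (h u) b)).toReal ↔
      (β : EReal) < max (a : EReal) (min (h u) b) := fun u => by
    rw [← EReal.coe_lt_coe_iff, key]
  simp only [h1, lt_max_iff, lt_min_iff] at hβ ⊢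
  rcases hβ with hβ | hβ
  · exact Eventually.of_forall fun _ => Or.inl hβ
  · filter_upwards [hh x β hβ.1] with u hu
    exact Or.inr ⟨hu, hβ.2⟩

section ProxRegular

variable {g : X → P → EReal} {xb vh : X} {pb : P} {γ r : ℝ}

/-- The prox-regularity inequality persists between different parameter values, up to an error
that is linear in the distance between the parameters. -/
theorem prox_inequality_of_parameters (hr : 0 ≤ r)
    (hlsc : LowerSemicontinuous fun t : X × P => g t.1 t.2) (hγ : g xb pb = γ)
    (hprox : ProxRegWith g xb pb vh r) (hcont : SubdiffCont g xb pb vh) (hA3 : A3 g xb pb) :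
    ∃ δ > (0 : ℝ), ∃ C ≥ (0 : ℝ), ∀ p₁ p₂ x₁ x₂ v₁, dist p₁ pb < δ → dist p₂ pb < δ →
      ‖x₁ - xb‖ < δ → ‖x₂ - xb‖ < δ → ‖v₁ - vh‖ < δ → v₁ ∈ pSubdiff g x₁ p₁ →
      ∃ α : ℝ, g x₁ p₁ = α ∧ α ≤ γ + 1 ∧
        ((α + ⟪v₁, x₂ - x₁⟫ - r / 2 * ‖x₂ - x₁‖ ^ 2 - C * dist p₁ p₂ : ℝ) : EReal) ≤ g x₂ p₂ := by
  obtain ⟨ℓ, hℓ, U, hU, V, hV, hLL⟩ := hA3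
  rw [hγ, EReal.toReal_coe] at hV
  obtain ⟨ε, hε, hprox⟩ := hprox
  obtain ⟨θ, hθ, hθV⟩ := Metric.mem_nhds_iff.1 hV
  obtain ⟨δU, hδU, hUs⟩ := Metric.mem_nhds_iff.1 hU
  set θ' : ℝ := min θ 1 with hθ'def
  have hθ' : 0 < θ' := by positivity
  have hθθ : θ' ≤ θ := min_le_left _ _
  have hθ1 : θ' ≤ 1 := min_le_right _ _
  unfold SubdiffCont at hcont
  rw [hγ] at hcont
  obtain ⟨δc, hδc, hc⟩ := Metric.mem_nhdsWithin_iff.1 (hcont.eventually (Ioo_mem_nhds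
    (EReal.coe_lt_coe_iff.2 (show γ - 1 < γ by linarith))
    (EReal.coe_lt_coe_iff.2 (show γ < γ + θ' / 4 by linarith))))
  obtain ⟨δl, hδl, hl⟩ := Metric.mem_nhds_iff.1 (hlsc (xb, pb) ((γ - θ' / 2 : ℝ) : EReal)
    (by simp only [hγ]; exact EReal.coe_lt_coe_iff.2 (by linarith)))
  set nv := ‖vh‖ + 1 with hnv
  have hnv1 : 1 ≤ nv := by linarith [norm_nonneg vh]
  obtain ⟨δ, hδ, hd1, hd2, hd3, hd4, hd5, hd6, hd7⟩ : ∃ δ > 0, δ ≤ δU ∧ δ < θ ∧ δ ≤ δc ∧ δ ≤ δl ∧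
      δ ≤ 1 ∧ δ * (1 + 2 * ℓ) ≤ ε ∧ δ * (8 * nv) ≤ θ' := by
    refine ⟨min (min δU (θ / 2)) (min (min δc δl) (min 1 (min (ε / (1 + 2 * ℓ)) (θ' / (8 * nv))))),
      by positivity, ?_, ?_, ?_, ?_, ?_, ?_, ?_⟩
    · simp
    · refine lt_of_le_of_lt ((min_le_left _ _).trans (min_le_right _ _)) (by linarith)
    · simp
    · simp
    · simp
    · rw [← le_div_iff₀ (by positivity)]; simp
    · rw [← le_div_iff₀ (by positivity)]; simp
  refine ⟨δ, hδ, ℓ + nv * ℓ + r / 2 * (ℓ * (4 + 2 * ℓ)), by positivity, ?_⟩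
  intro p₁ p₂ x₁ x₂ v₁ hp₁ hp₂ hx₁ hx₂ hv₁ hmem
  have h1 : g x₁ p₁ ∈ Ioo (((γ - 1 : ℝ)) : EReal) ((γ + θ' / 4 : ℝ) : EReal) := by
    refine hc (show (x₁, p₁, v₁) ∈ _ from ⟨?_, hmem⟩)
    rw [mem_ball, Prod.dist_eq, Prod.dist_eq, dist_eq_norm, dist_eq_norm]
    simp only [max_lt_iff]
    exact ⟨by linarith, by linarith, by linarith⟩
  obtain ⟨α, hα⟩ : ∃ α : ℝ, g x₁ p₁ = α :=
    ⟨_, (EReal.coe_toReal (ne_of_lt (h1.2.trans (EReal.coe_lt_top _)))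
      (ne_of_gt ((EReal.bot_lt_coe _).trans h1.1))).symm⟩
  rw [hα] at h1
  have hα1 := EReal.coe_lt_coe_iff.1 h1.2
  refine ⟨α, hα, by linarith, ?_⟩
  set d := dist p₁ p₂ with hd
  have hd0 : 0 ≤ d := dist_nonneg
  have hd2' : d ≤ 2 * δ := by linarith [dist_triangle_right p₁ p₂ pb]
  have hvn : ‖v₁‖ ≤ nv := by
    have := norm_add_le (v₁ - vh) vh
    rw [sub_add_cancel] at this
    linarith
  have hx12 : ‖x₂ - x₁‖ ≤ 2 * δ := by
    have := norm_sub_le (x₂ - xb) (x₁ - xb)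
    rw [sub_sub_sub_cancel_right] at this
    linarith
  rcases lt_or_ge ((γ + θ' / 2 : ℝ) : EReal) (g x₂ p₂) with hbig | hsmall
  · refine le_trans (EReal.coe_le_coe_iff.2 ?_) hbig.le
    have h2 : ⟪v₁, x₂ - x₁⟫ ≤ nv * (2 * δ) := (real_inner_le_norm _ _).trans (by gcongr)
    have h3 : 0 ≤ r / 2 * ‖x₂ - x₁‖ ^ 2 := by positivity
    have h4 : 0 ≤ (ℓ + nv * ℓ + r / 2 * (ℓ * (4 + 2 * ℓ))) * d := by positivity
    linarith
  · have h2 : ((γ - θ' / 2 : ℝ) : EReal) < g x₂ p₂ := by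
      refine hl (show (x₂, p₂) ∈ ball (xb, pb) δl from ?_)
      rw [mem_ball, Prod.dist_eq, dist_eq_norm]
      simp only [max_lt_iff]
      exact ⟨by linarith, by linarith⟩
    obtain ⟨β, hβ⟩ : ∃ β : ℝ, g x₂ p₂ = β :=
      ⟨_, (EReal.coe_toReal (ne_of_lt (hsmall.trans_lt (EReal.coe_lt_top _)))
        (ne_of_gt ((EReal.bot_lt_coe _).trans h2))).symm⟩
    rw [hβ, EReal.coe_le_coe_iff] at hsmall
    rw [hβ, EReal.coe_lt_coe_iff] at h2
    obtain ⟨⟨x', β'⟩, hx'e, hx'⟩ := hLL p₂ (hUs (by rw [mem_ball]; linarith)) p₁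
      (hUs (by rw [mem_ball]; linarith)) (x₂, β) ⟨by simp [epi, hβ], hθV (by
        rw [mem_ball, Prod.dist_eq, dist_eq_norm, Real.dist_eq]
        simp only [max_lt_iff]
        refine ⟨by linarith, ?_⟩
        rw [abs_lt]
        constructor <;> linarith)⟩
    rw [dist_comm, ← hd] at hx'
    have h3 : ‖x₂ - x'‖ ≤ ℓ * d := (norm_fst_le ((x₂, β) - (x', β'))).trans hx'
    have h4 : |β - β'| ≤ ℓ * d := (norm_snd_le ((x₂, β) - (x', β'))).trans hx'
    have h5 : ‖x' - xb‖ < ε := by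
      have h6 := norm_sub_le (x₂ - xb) (x₂ - x')
      rw [show x₂ - xb - (x₂ - x') = x' - xb by abel] at h6
      have h7 : ℓ * d ≤ ℓ * (2 * δ) := by gcongr
      linarith
    have hδε : δ ≤ ε := by nlinarith
    have h6 := (hprox x' x₁ p₁ v₁ h5 (by linarith) (by linarith) (by linarith) hmem).trans hx'e
    rw [hα, ← EReal.coe_add, EReal.coe_le_coe_iff] at h6
    rw [hβ, EReal.coe_le_coe_iff]
    have h7 : ⟪v₁, x₂ - x₁⟫ ≤ ⟪v₁, x' - x₁⟫ + nv * (ℓ * d) := by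
      have : ⟪v₁, x₂ - x'⟫ ≤ nv * (ℓ * d) := (real_inner_le_norm _ _).trans (by gcongr)
      rw [show x₂ - x₁ = (x₂ - x') + (x' - x₁) by abel, inner_add_right]
      linarith
    have h8 : ‖x' - x₁‖ ^ 2 ≤ ‖x₂ - x₁‖ ^ 2 + (ℓ * (4 + 2 * ℓ)) * d := by
      have h9 : ‖x' - x₁‖ ≤ ‖x₂ - x₁‖ + ℓ * d := by
        have := norm_sub_le (x₂ - x₁) (x₂ - x')
        rw [show x₂ - x₁ - (x₂ - x') = x' - x₁ by abel] at this
        linarith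
      have h10 : ‖x' - x₁‖ ^ 2 ≤ (‖x₂ - x₁‖ + ℓ * d) ^ 2 := by gcongr
      have h11 : ‖x₂ - x₁‖ * (ℓ * d) ≤ 2 * (ℓ * d) := by gcongr; linarith
      have h12 : d * d ≤ 2 * d := by gcongr; linarith
      have h13 : ℓ ^ 2 * (d * d) ≤ ℓ ^ 2 * (2 * d) := by gcongr
      nlinarith
    have h9 : r / 2 * ‖x' - x₁‖ ^ 2 ≤ r / 2 * (‖x₂ - x₁‖ ^ 2 + (ℓ * (4 + 2 * ℓ)) * d) := by
      gcongr
    have h10 := (abs_le.1 h4).1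
    linarith

/-- Subgradients at different parameter values are hypomonotone up to the distance between the
parameters. -/
theorem hypomonotone_of_parameters (hr : 0 ≤ r)
    (hlsc : LowerSemicontinuous fun t : X × P => g t.1 t.2) (hγ : g xb pb = γ)
    (hprox : ProxRegWith g xb pb vh r) (hcont : SubdiffCont g xb pb vh) (hA3 : A3 g xb pb) :
    ∃ δ > (0 : ℝ), ∃ C ≥ (0 : ℝ), ∀ p₁ p₂ x₁ x₂ v₁ v₂, dist p₁ pb < δ → dist p₂ pb < δ →
      ‖x₁ - xb‖ < δ → ‖x₂ - xb‖ < δ → ‖v₁ - vh‖ < δ → ‖v₂ - vh‖ < δ →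
      v₁ ∈ pSubdiff g x₁ p₁ → v₂ ∈ pSubdiff g x₂ p₂ →
      -r * ‖x₁ - x₂‖ ^ 2 - C * dist p₁ p₂ ≤ ⟪v₁ - v₂, x₁ - x₂⟫ := by
  obtain ⟨δ, hδ, C, hC, h⟩ := prox_inequality_of_parameters hr hlsc hγ hprox hcont hA3
  refine ⟨δ, hδ, 2 * C, by positivity, fun p₁ p₂ x₁ x₂ v₁ v₂ hp₁ hp₂ hx₁ hx₂ hv₁ hv₂ h₁ h₂ => ?_⟩
  obtain ⟨α₁, e₁, -, i₁⟩ := h p₁ p₂ x₁ x₂ v₁ hp₁ hp₂ hx₁ hx₂ hv₁ h₁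
  obtain ⟨α₂, e₂, -, i₂⟩ := h p₂ p₁ x₂ x₁ v₂ hp₂ hp₁ hx₂ hx₁ hv₂ h₂
  rw [e₂, EReal.coe_le_coe_iff] at i₁
  rw [e₁, EReal.coe_le_coe_iff, dist_comm] at i₂
  have e3 : ⟪v₁, x₂ - x₁⟫ = -⟪v₁, x₁ - x₂⟫ := by rw [← inner_neg_right, neg_sub]
  rw [norm_sub_rev] at i₁
  rw [inner_sub_left]
  linarith

theorem locMono_subdiff_add_smul (hr : 0 ≤ r)
    (hlsc : LowerSemicontinuous fun t : X × P => g t.1 t.2) (hγ : g xb pb = γ)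
    (hprox : ProxRegWith g xb pb vh r) (hcont : SubdiffCont g xb pb vh) (hA3 : A3 g xb pb)
    {s : ℝ} (hs : 0 ≤ s) :
    LocMono (fun p x => {y | y - s • x ∈ pSubdiff g x p}) pb xb (vh + s • xb) (s - r) := by
  obtain ⟨δ, hδ, C, hC, h⟩ := hypomonotone_of_parameters hr hlsc hγ hprox hcont hA3
  have hδ' : δ / (1 + s) ≤ δ := div_le_self hδ.le (by linarith)
  refine ⟨δ / (1 + s), by positivity, fun p x₁ x₂ y₁ y₂ hp hx₁ hx₂ hy₁ hy₂ h₁ h₂ => ?_⟩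
  have hv : ∀ x y : X, ‖x - xb‖ < δ / (1 + s) → ‖y - (vh + s • xb)‖ < δ / (1 + s) →
      ‖(y - s • x) - vh‖ < δ := fun x y hx hy => by
    rw [show (y - s • x) - vh = (y - (vh + s • xb)) - s • (x - xb) by module]
    refine (norm_sub_le _ _).trans_lt ?_
    rw [norm_smul, Real.norm_of_nonneg hs]
    rw [lt_div_iff₀ (by positivity)] at hx hy
    have : (‖y - (vh + s • xb)‖ + s * ‖x - xb‖) * (1 + s) < δ * (1 + s) := by nlinarith
    exact lt_of_mul_lt_mul_right this (by positivity)
  have h3 := h p p x₁ x₂ _ _ (hp.trans_le hδ') (hp.trans_le hδ') (hx₁.trans_le hδ')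
    (hx₂.trans_le hδ') (hv _ _ hx₁ hy₁) (hv _ _ hx₂ hy₂) h₁ h₂
  rw [dist_self, show (y₁ - s • x₁) - (y₂ - s • x₂) = (y₁ - y₂) - s • (x₁ - x₂) by module,
    inner_sub_left, real_inner_smul_left, real_inner_self_eq_norm_sq] at h3
  linarith

/-- Near-optimal points exist at nearby parameters. -/
theorem exists_value_le_of_A3 {Z : Type*} [NormedAddCommGroup Z] {g : Z → P → EReal} {xb : Z}
    (hγ : g xb pb = γ) (hA3 : A3 g xb pb) :
    ∃ ℓ > (0 : ℝ), ∃ δ > (0 : ℝ), ∀ p, dist p pb < δ →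
      ∃ x, ‖x - xb‖ ≤ ℓ * dist p pb ∧ g x p ≤ ((γ + ℓ * dist p pb : ℝ) : EReal) := by
  obtain ⟨ℓ, hℓ, U, hU, V, hV, h⟩ := hA3
  rw [hγ, EReal.toReal_coe] at hV
  obtain ⟨δ, hδ, hUs⟩ := Metric.mem_nhds_iff.1 hU
  refine ⟨ℓ, hℓ, δ, hδ, fun p hp => ?_⟩
  obtain ⟨⟨x, β⟩, hx, hd⟩ := h pb (mem_of_mem_nhds hU) p (hUs hp) (xb, γ)
    ⟨by simp [epi, hγ], mem_of_mem_nhds hV⟩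
  rw [dist_comm] at hd
  have h1 : ‖xb - x‖ ≤ ℓ * dist p pb := (norm_fst_le ((xb, γ) - (x, β))).trans hd
  have h2 : |γ - β| ≤ ℓ * dist p pb := (norm_snd_le ((xb, γ) - (x, β))).trans hd
  refine ⟨x, by rwa [norm_sub_rev], hx.trans (EReal.coe_le_coe_iff.2 ?_)⟩
  have := (abs_le.1 h2).1
  change β ≤ _
  linarith

/-- A lower semicontinuous function with a quadratic lower bound on a ball and a nearly optimal
point there has subgradients approximately solving the resolvent equation. -/
theorem exists_approx_limSubdiff_add_smul [CompleteSpace X] {h : X → EReal}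
    (hl : LowerSemicontinuous h) {xb vh v' x0 : X} {γ r s ρ b e β : ℝ} (hr : 0 ≤ r) (hs : r < s)
    (hρ : 0 < ρ) (hρ1 : ρ ≤ 1) (hρs : ρ * (‖vh‖ + 1 + r + s) ≤ 1 / 4) (he : 0 ≤ e)
    (he1 : e ≤ 1 / 32) (hb1 : b ≤ 1) (hvv : ‖v' - vh‖ ≤ b)
    (hgrow : ∀ x ∈ closedBall xb ρ,
      ((γ + ⟪vh, x - xb⟫ - r / 2 * ‖x - xb‖ ^ 2 - e : ℝ) : EReal) ≤ h x)
    (hx0D : x0 ∈ closedBall xb ρ) (hgx0 : h x0 ≤ ((γ + β : ℝ) : EReal))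
    (hβ : β + s / 2 * ‖x0 - xb‖ ^ 2 - ⟪v', x0 - xb⟫ + e + b * ρ ≤ (s - r) * ρ ^ 2 / 8)
    {ε : ℝ} (hε : 0 < ε) :
    ∃ x v, ‖x - xb‖ < ρ ∧ v ∈ limSubdiff h x ∧ ‖v + s • x - (v' + s • xb)‖ ≤ ε := by
  have hs0 : 0 < s := hr.trans_lt hs
  set nv := ‖vh‖ + 1 with hnv
  have hnv1 : 1 ≤ nv := by linarith [norm_nonneg vh]
  have hρnv : ρ * nv ≤ 1 / 4 := by nlinarith [mul_nonneg hρ.le hr, mul_nonneg hρ.le hs0.le]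
  have hρr : ρ * r ≤ 1 / 4 := by
    nlinarith [mul_nonneg hρ.le hs0.le, mul_pos hρ (zero_lt_one.trans_le hnv1)]
  have hρs' : ρ * s ≤ 1 / 4 := by
    nlinarith [mul_nonneg hρ.le hr, mul_pos hρ (zero_lt_one.trans_le hnv1)]
  have hsr : 0 < s - r := by linarith
  have hsrρ : (s - r) * ρ ^ 2 ≤ 1 / 4 := by nlinarith [mul_nonneg hρ.le hr]
  have hv'n : ‖v'‖ ≤ nv := by
    have := norm_add_le (v' - vh) vh
    rw [sub_add_cancel] at this
    linarith
  have hin : ∀ x ∈ closedBall xb ρ, |⟪vh, x - xb⟫| ≤ 1 / 4 ∧ r / 2 * ‖x - xb‖ ^ 2 ≤ 1 / 8 := by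
    intro x hx
    rw [mem_closedBall, dist_eq_norm] at hx
    constructor
    · refine (abs_real_inner_le_norm _ _).trans (le_trans ?_ hρnv)
      rw [mul_comm]
      gcongr
      linarith
    · calc r / 2 * ‖x - xb‖ ^ 2 ≤ r / 2 * ρ ^ 2 := by gcongr
        _ ≤ 1 / 8 := by nlinarith
  obtain ⟨τ, hτl, hτ⟩ := exists_truncation hl (γ - 1) (γ + 1)
  have hτgrow : ∀ x ∈ closedBall xb ρ,
      γ + ⟪vh, x - xb⟫ - r / 2 * ‖x - xb‖ ^ 2 - e ≤ τ x := by
    intro x hx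
    rw [← EReal.coe_le_coe_iff, hτ]
    refine le_max_of_le_right (le_min (hgrow x hx) (EReal.coe_le_coe_iff.2 ?_))
    have h1 := (abs_le.1 (hin x hx).1).2
    have h2 : 0 ≤ r / 2 * ‖x - xb‖ ^ 2 := by positivity
    linarith
  have hτle : ∀ x ∈ closedBall xb ρ, ((τ x : ℝ) : EReal) ≤ h x := by
    intro x hx
    rw [hτ]
    refine max_le (le_trans (EReal.coe_le_coe_iff.2 ?_) (hgrow x hx)) (min_le_left _ _)
    have h1 := (abs_le.1 (hin x hx).1).1
    have h2 := (hin x hx).2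
    linarith
  let φ : X → ℝ := fun x => τ x + (s / 2 * ‖x - xb‖ ^ 2 - ⟪v', x - xb⟫)
  have hφl : LowerSemicontinuous φ :=
    hτl.add (Continuous.lowerSemicontinuous (by fun_prop))
  have hφgrow : ∀ x ∈ closedBall xb ρ, γ + (s - r) / 2 * ‖x - xb‖ ^ 2 - e - b * ρ ≤ φ x := by
    intro x hx
    have h1 := hτgrow x hx
    rw [mem_closedBall, dist_eq_norm] at hx
    have h2 : ⟪v' - vh, x - xb⟫ ≤ b * ρ :=
      (real_inner_le_norm _ _).trans (mul_le_mul hvv hx (norm_nonneg _) ((norm_nonneg _).trans hvv))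
    rw [inner_sub_left] at h2
    simp only [φ]
    linarith
  have hφx0 : φ x0 ≤ γ - e - b * ρ + (s - r) * ρ ^ 2 / 8 := by
    have h1 : τ x0 ≤ γ + β := EReal.coe_le_coe_iff.1 ((hτle x0 hx0D).trans hgx0)
    simp only [φ]
    linarith
  obtain ⟨ε', hε', hεε, hε'ρ⟩ : ∃ ε' > 0, ε' ≤ ε ∧ ε' * (2 * ρ + 4 * ρ ^ 2) ≤
      (s - r) * ρ ^ 2 / 8 := by
    refine ⟨min ε ((s - r) * ρ ^ 2 / 8 / (2 * ρ + 4 * ρ ^ 2)), by positivity, by simp, ?_⟩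
    rw [← le_div_iff₀ (by positivity)]; simp
  have hdiam : ∀ x ∈ closedBall xb ρ, ∀ z ∈ closedBall xb ρ, ‖x - z‖ ≤ 2 * ρ := by
    intro x hx z hz
    rw [mem_closedBall] at hx hz
    rw [← dist_eq_norm]
    linarith [dist_triangle_right x z xb]
  obtain ⟨x, hxD, ζ, hζ, hmin⟩ := exists_small_proximal_subgradient isClosed_closedBall
    ⟨x0, hx0D⟩ hdiam (hφl.lowerSemicontinuousOn _) (m := γ - e - b * ρ)
    (fun x hx => by
      have h1 := hφgrow x hx
      have h2 : 0 ≤ (s - r) / 2 * ‖x - xb‖ ^ 2 := by positivity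
      linarith) hε'
  have hφx : φ x ≤ φ x0 + (s - r) * ρ ^ 2 / 8 := by
    have h1 := hmin x0 hx0D
    have h2 := hdiam x0 hx0D x hxD
    have h3 : -⟪ζ, x0 - x⟫ ≤ ε' * (2 * ρ) := by
      rw [← inner_neg_right]
      refine (real_inner_le_norm _ _).trans ?_
      rw [norm_neg]
      gcongr
    have h4 : ε' * ‖x0 - x‖ ^ 2 ≤ ε' * (2 * ρ) ^ 2 := by gcongr
    linarith
  have hxρ : ‖x - xb‖ < ρ := by
    have h1 := hφgrow x hxD
    have h2 : (s - r) * ‖x - xb‖ ^ 2 < (s - r) * ρ ^ 2 := by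
      have : 0 < (s - r) * ρ ^ 2 := by positivity
      linarith
    exact lt_of_pow_lt_pow_left₀ 2 hρ.le (lt_of_mul_lt_mul_left h2 hsr.le)
  have hgx : h x = τ x := by
    have h1 : γ - 1 < τ x := by
      have h2 := hτgrow x hxD
      have h3 := (abs_le.1 (hin x hxD).1).1
      have h4 := (hin x hxD).2
      linarith
    have h2 : τ x < γ + 1 := by
      have h3 : ⟪v', x - xb⟫ ≤ 1 / 4 := by
        refine (real_inner_le_norm _ _).trans (le_trans ?_ hρnv)
        rw [mul_comm]
        gcongr
      have h4 : 0 ≤ s / 2 * ‖x - xb‖ ^ 2 := by positivity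
      have h5 : 0 ≤ b * ρ := mul_nonneg ((norm_nonneg _).trans hvv) hρ.le
      simp only [φ] at hφx hφx0
      linarith
    rw [← EReal.coe_lt_coe_iff, hτ, lt_max_iff] at h1
    rw [← EReal.coe_lt_coe_iff, hτ, max_lt_iff, min_lt_iff] at h2
    rw [hτ]
    have h3 := h1.resolve_left (lt_irrefl _)
    have h4 := h2.2.resolve_right (lt_irrefl _)
    rw [max_eq_right h3.le, min_eq_left h4.le]
  refine ⟨x, ζ - s • (x - xb) + v', hxρ, ?_, ?_⟩
  · refine mem_limSubdiff_of_proximal (α := τ x) (c := ε' + s / 2) hgx ?_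
    have hnb : closedBall xb ρ ∈ 𝓝 x :=
      mem_of_superset (isOpen_ball.mem_nhds (by rwa [mem_ball, dist_eq_norm]))
        ball_subset_closedBall
    filter_upwards [hnb] with z hz
    refine le_trans (EReal.coe_le_coe_iff.2 ?_) (hτle z hz)
    have h1 := hmin z hz
    have h2 : ‖z - xb‖ ^ 2 = ‖z - x‖ ^ 2 + 2 * ⟪x - xb, z - x⟫ + ‖x - xb‖ ^ 2 := by
      rw [show z - xb = (x - xb) + (z - x) by abel, norm_add_sq_real]; ring
    have h3 : ⟪v', z - xb⟫ = ⟪v', z - x⟫ + ⟪v', x - xb⟫ := by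
      rw [← inner_add_right]; congr 1; abel
    simp only [φ, h2, h3] at h1
    rw [inner_add_left, inner_sub_left, real_inner_smul_left]
    linarith
  · rw [show ζ - s • (x - xb) + v' + s • x - (v' + s • xb) = ζ by module]
    exact hζ.trans hεε

/-- The resolvent equation `y ∈ ∂ₓ g(x, p) + s x` is approximately solvable near the reference
point. -/
theorem exists_approx_subdiff_add_smul [CompleteSpace X] (hr : 0 ≤ r)
    (hlsc : LowerSemicontinuous fun t : X × P => g t.1 t.2) (hγ : g xb pb = γ)
    (hprox : ProxRegWith g xb pb vh r) (hcont : SubdiffCont g xb pb vh) (hA3 : A3 g xb pb)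
    (hvh : vh ∈ pSubdiff g xb pb) {s : ℝ} (hs : r < s) {a : ℝ} (ha : 0 < a) :
    ∃ b > (0 : ℝ), ∀ p y, dist p pb < b → ‖y - (vh + s • xb)‖ < b → ∀ ε > (0 : ℝ),
      ∃ x v, ‖x - xb‖ < a ∧ v ∈ pSubdiff g x p ∧ ‖v + s • x - y‖ ≤ ε := by
  obtain ⟨δ, hδ, C, hC, hineq⟩ := prox_inequality_of_parameters hr hlsc hγ hprox hcont hA3
  obtain ⟨ℓ, hℓ, u, hu, hval⟩ := exists_value_le_of_A3 hγ hA3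
  have hs0 : 0 < s := hr.trans_lt hs
  set nv := ‖vh‖ + 1 with hnv
  have hnv1 : 1 ≤ nv := by linarith [norm_nonneg vh]
  obtain ⟨ρ, hρ, hρa, hρδ, hρ1, hρs⟩ : ∃ ρ > 0, ρ ≤ a ∧ ρ < δ ∧ ρ ≤ 1 ∧ ρ * (nv + r + s) ≤ 1 / 4 := by
    refine ⟨min (min a (δ / 2)) (min 1 (1 / 4 / (nv + r + s))), by positivity, ?_, ?_, ?_, ?_⟩
    · simp
    · exact ((min_le_left _ _).trans (min_le_right _ _)).trans_lt (by linarith)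
    · simp
    · rw [← le_div_iff₀ (by positivity)]; simp
  have hρs' : ρ * s ≤ 1 / 4 := by
    nlinarith [mul_nonneg hρ.le hr, mul_pos hρ (zero_lt_one.trans_le hnv1)]
  have hsr : 0 < s - r := by linarith
  set E := C + ρ + ℓ + s / 2 * ℓ ^ 2 + nv * ℓ with hE
  have hE0 : 0 < E := by positivity
  obtain ⟨b, hb, hbu, hbδ, hb1, hbℓ, hbE⟩ : ∃ b > 0, b ≤ u ∧ b ≤ δ ∧ b ≤ 1 ∧ b * ℓ ≤ ρ ∧
      b * E ≤ (s - r) * ρ ^ 2 / 8 := by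
    refine ⟨min (min u δ) (min 1 (min (ρ / ℓ) ((s - r) * ρ ^ 2 / 8 / E))), by positivity,
      ?_, ?_, ?_, ?_, ?_⟩
    · simp
    · simp
    · simp
    · rw [← le_div_iff₀ (by positivity)]; simp
    · rw [← le_div_iff₀ (by positivity)]; simp
  have hsrρ : (s - r) * ρ ^ 2 ≤ 1 / 4 := by nlinarith [mul_nonneg hρ.le hr]
  refine ⟨b, hb, fun p y hp hy ε hε => ?_⟩
  set d := dist p pb with hd
  have hd0 : 0 ≤ d := dist_nonneg
  have hdE : (C + ℓ + s / 2 * ℓ ^ 2 + nv * ℓ) * d + b * ρ ≤ (s - r) * ρ ^ 2 / 8 := by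
    have h1 : (C + ℓ + s / 2 * ℓ ^ 2 + nv * ℓ) * d ≤ (C + ℓ + s / 2 * ℓ ^ 2 + nv * ℓ) * b := by
      gcongr
    rw [hE] at hbE
    linarith
  have hCd : C * d ≤ 1 / 32 := by
    have h1 : 0 ≤ (ℓ + s / 2 * ℓ ^ 2 + nv * ℓ) * d + b * ρ := by positivity
    linarith
  set v' := y - s • xb with hv'
  have hvv : ‖v' - vh‖ ≤ b := by
    rw [hv', show y - s • xb - vh = y - (vh + s • xb) by abel]; exact hy.le
  have hv'n : ‖v'‖ ≤ nv := by
    have := norm_add_le (v' - vh) vh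
    rw [sub_add_cancel] at this
    linarith
  have hgrow : ∀ x ∈ closedBall xb ρ,
      ((γ + ⟪vh, x - xb⟫ - r / 2 * ‖x - xb‖ ^ 2 - C * d : ℝ) : EReal) ≤ g x p := by
    intro x hx
    rw [mem_closedBall, dist_eq_norm] at hx
    obtain ⟨α, hα, -, h⟩ := hineq pb p xb x vh (by simpa using hδ) (by linarith)
      (by simpa using hδ) (by linarith) (by simpa using hδ) hvh
    rw [hγ, EReal.coe_eq_coe_iff] at hα
    rwa [← hα, dist_comm pb p] at h
  obtain ⟨x0, hx0, hgx0⟩ := hval p (by linarith)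
  have hx0ρ : ‖x0 - xb‖ ≤ ρ := by
    refine hx0.trans (le_trans ?_ hbℓ)
    rw [mul_comm]
    gcongr
  have hx0D : x0 ∈ closedBall xb ρ := by rwa [mem_closedBall, dist_eq_norm]
  have h2 : s / 2 * ‖x0 - xb‖ ^ 2 ≤ s / 2 * ℓ ^ 2 * d := by
    have h3 : ‖x0 - xb‖ ^ 2 ≤ (ℓ * d) ^ 2 := by gcongr
    have h4 : d * d ≤ 1 * d := by gcongr; linarith
    calc s / 2 * ‖x0 - xb‖ ^ 2 ≤ s / 2 * (ℓ * d) ^ 2 := by gcongr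
      _ = s / 2 * ℓ ^ 2 * (d * d) := by ring
      _ ≤ s / 2 * ℓ ^ 2 * d := by gcongr; linarith
  have h3 : -⟪v', x0 - xb⟫ ≤ nv * (ℓ * d) := by
    rw [← inner_neg_right]
    refine (real_inner_le_norm _ _).trans ?_
    rw [norm_neg]
    gcongr
  have hslice : LowerSemicontinuous fun x => g x p :=
    hlsc.comp (by fun_prop : Continuous fun x : X => (x, p))
  obtain ⟨x, v, hx, hv, hxv⟩ := exists_approx_limSubdiff_add_smul hslice hr hs hρ hρ1 hρs
    (by positivity) (by linarith) hb1 hvv hgrow hx0D hgx0 (by linarith) hε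
  rw [hv', sub_add_cancel] at hxv
  exact ⟨x, v, hx.trans_le hρa, hv, hxv⟩

/-- The graph of the partial subdifferential at a fixed parameter is closed near the reference
point. -/
theorem exists_mem_pSubdiff_of_tendsto (hr : 0 ≤ r)
    (hlsc : LowerSemicontinuous fun t : X × P => g t.1 t.2) (hg : ∀ x p, g x p ≠ ⊥)
    (hγ : g xb pb = γ)
    (hprox : ProxRegWith g xb pb vh r) (hcont : SubdiffCont g xb pb vh) (hA3 : A3 g xb pb) :
    ∃ δ > (0 : ℝ), ∀ p, dist p pb < δ → ∀ (xs vs : ℕ → X) (x v : X),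
      (∀ k, ‖xs k - xb‖ < δ) → (∀ k, ‖vs k - vh‖ < δ) → (∀ k, vs k ∈ pSubdiff g (xs k) p) →
      Tendsto xs atTop (𝓝 x) → Tendsto vs atTop (𝓝 v) → ‖x - xb‖ < δ → v ∈ pSubdiff g x p := by
  obtain ⟨δ, hδ, C, hC, h⟩ := prox_inequality_of_parameters hr hlsc hγ hprox hcont hA3
  refine ⟨δ, hδ, fun p hp xs vs x v hxs hvs hmem hx hv hxδ => ?_⟩
  have h' := fun k u hu => h p p (xs k) u (vs k) hp hp (hxs k) hu (hvs k) (hmem k)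
  choose α hα using fun k => h p p (xs k) x (vs k) hp hp (hxs k) hxδ (hvs k) (hmem k)
  have hslice : LowerSemicontinuous fun x => g x p :=
    hlsc.comp (by fun_prop : Continuous fun x : X => (x, p))
  have hle : ∀ β : ℝ, (β : EReal) < g x p → ∀ᶠ k in atTop, β < α k := by
    intro β hβ
    filter_upwards [hx.eventually (hslice x β hβ)] with k hk
    rw [(hα k).1] at hk
    exact EReal.coe_lt_coe_iff.1 hk
  obtain ⟨ξ, hξ⟩ : ∃ ξ : ℝ, g x p = ξ := by
    refine ⟨_, (EReal.coe_toReal (fun htop => ?_) (hg x p)).symm⟩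
    obtain ⟨k, hk⟩ := (hle (γ + 1) (by rw [htop]; exact EReal.coe_lt_top _)).exists
    exact absurd (hα k).2.1 (not_le.2 hk)
  refine mem_limSubdiff_of_proximal (α := ξ) (c := r / 2) hξ ?_
  have hnb : ∀ᶠ u in 𝓝 x, ‖u - xb‖ < δ :=
    ContinuousAt.eventually_lt (by fun_prop) continuousAt_const hxδ
  filter_upwards [hnb] with u hu
  rcases eq_or_ne (g u p) ⊤ with htop | htop
  · rw [htop]; exact le_top
  obtain ⟨β, hβ⟩ : ∃ β : ℝ, g u p = β := ⟨_, (EReal.coe_toReal htop (hg u p)).symm⟩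
  rw [hβ, EReal.coe_le_coe_iff]
  have hk : ∀ k, α k + ⟪vs k, u - xs k⟫ - r / 2 * ‖u - xs k‖ ^ 2 ≤ β := by
    intro k
    obtain ⟨α', hα', -, hk⟩ := h' k u hu
    rw [(hα k).1, EReal.coe_eq_coe_iff] at hα'
    rw [hβ, EReal.coe_le_coe_iff, dist_self, mul_zero, sub_zero, ← hα'] at hk
    exact hk
  have hlim : Tendsto (fun k => ⟪vs k, u - xs k⟫ - r / 2 * ‖u - xs k‖ ^ 2) atTop
      (𝓝 (⟪v, u - x⟫ - r / 2 * ‖u - x‖ ^ 2)) := by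
    have hux : Tendsto (fun k => u - xs k) atTop (𝓝 (u - x)) := tendsto_const_nhds.sub hx
    exact (hv.inner hux).sub ((hux.norm.pow 2).const_mul _)
  refine le_of_forall_pos_le_add fun e he => ?_
  have h2 : ∀ᶠ k in atTop, ξ - e < α k := hle _ (by
    rw [hξ]; exact EReal.coe_lt_coe_iff.2 (by linarith))
  have h3 : ⟪v, u - x⟫ - r / 2 * ‖u - x‖ ^ 2 ≤ β - (ξ - e) := by
    refine le_of_tendsto hlim ?_
    filter_upwards [h2] with k h2
    have := hk k
    linarith
  linarith

/-- Existence of local solutions of the resolvent equation `y ∈ ∂ₓ g(x, p) + s x`. -/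
theorem locExist_subdiff_add_smul [CompleteSpace X] (hr : 0 ≤ r)
    (hlsc : LowerSemicontinuous fun t : X × P => g t.1 t.2) (hg : ∀ x p, g x p ≠ ⊥)
    (hγ : g xb pb = γ)
    (hprox : ProxRegWith g xb pb vh r) (hcont : SubdiffCont g xb pb vh) (hA3 : A3 g xb pb)
    (hvh : vh ∈ pSubdiff g xb pb) {s : ℝ} (hs : r < s) :
    LocExist (fun p x => {y | y - s • x ∈ pSubdiff g x p}) pb xb (vh + s • xb) := by
  intro a ha
  have hs0 : 0 < s := hr.trans_lt hs
  obtain ⟨δ₁, hδ₁, hmono⟩ := locMono_subdiff_add_smul hr hlsc hγ hprox hcont hA3 hs0.le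
  obtain ⟨δ₂, hδ₂, hclosed⟩ := exists_mem_pSubdiff_of_tendsto hr hlsc hg hγ hprox hcont hA3
  set a' := min (a / 2) (min (δ₁ / 2) (min (δ₂ / 2) (δ₂ / (4 * s)))) with ha'
  have ha'0 : 0 < a' := by positivity
  have ha'a : a' < a := (min_le_left _ _).trans_lt (by linarith)
  have ha'1 : a' < δ₁ := ((min_le_right _ _).trans (min_le_left _ _)).trans_lt (by linarith)
  have ha'2 : a' < δ₂ := (((min_le_right _ _).trans (min_le_right _ _)).trans
    (min_le_left _ _)).trans_lt (by linarith)
  have ha's : a' * (4 * s) ≤ δ₂ := by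
    rw [← le_div_iff₀ (by positivity)]
    exact ((min_le_right _ _).trans (min_le_right _ _)).trans (min_le_right _ _)
  obtain ⟨b, hb, happ⟩ := exists_approx_subdiff_add_smul hr hlsc hγ hprox hcont hA3 hvh hs ha'0
  set b' := min b (min (δ₁ / 2) (δ₂ / 4)) with hb'
  have hb'0 : 0 < b' := by positivity
  have hb'b : b' ≤ b := min_le_left _ _
  have hb'1 : b' ≤ δ₁ / 2 := (min_le_right _ _).trans (min_le_left _ _)
  have hb'2 : b' ≤ δ₂ / 4 := (min_le_right _ _).trans (min_le_right _ _)
  refine ⟨b', hb'0, fun p y hp hy => ?_⟩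
  choose xs vs hxs hvs hxv using fun k : ℕ => happ p y (hp.trans_le hb'b) (hy.trans_le hb'b)
    (min (b' : ℝ) (1 / ((k : ℝ) + 1))) (by positivity)
  have hxv' : Tendsto (fun k => vs k + s • xs k) atTop (𝓝 y) := by
    rw [tendsto_iff_norm_sub_tendsto_zero]
    exact squeeze_zero (fun _ => norm_nonneg _) (fun k => (hxv k).trans (min_le_right _ _))
      tendsto_one_div_add_atTop_nhds_zero_nat
  have hyk : ∀ k, ‖vs k + s • xs k - (vh + s • xb)‖ < 2 * b' := fun k => by
    rw [show vs k + s • xs k - (vh + s • xb) =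
      (vs k + s • xs k - y) + (y - (vh + s • xb)) by abel]
    refine (norm_add_le _ _).trans_lt ?_
    have := (hxv k).trans (min_le_left _ _)
    linarith
  have hlip : ∀ j k, (s - r) * ‖xs j - xs k‖ ≤
      ‖(vs j + s • xs j) - (vs k + s • xs k)‖ := fun j k =>
    mul_norm_le_of_mul_sq_le_inner (hmono p (xs j) (xs k) _ _ (by linarith)
      ((hxs j).trans ha'1) ((hxs k).trans ha'1) ((hyk j).trans_le (by linarith))
      ((hyk k).trans_le (by linarith)) (by simpa using hvs j) (by simpa using hvs k))
  have hsr : 0 < s - r := by linarith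
  have hcau : CauchySeq xs := by
    rw [Metric.cauchySeq_iff']
    intro e he
    obtain ⟨N, hN⟩ := Metric.cauchySeq_iff'.1 hxv'.cauchySeq ((s - r) * e) (by positivity)
    refine ⟨N, fun n hn => ?_⟩
    have h1 := hN n hn
    rw [dist_eq_norm] at h1 ⊢
    exact lt_of_mul_lt_mul_left ((hlip n N).trans_lt h1) hsr.le
  obtain ⟨x, hx⟩ := cauchySeq_tendsto_of_complete hcau
  have hxa : ‖x - xb‖ ≤ a' :=
    le_of_tendsto (hx.sub_const xb).norm (Eventually.of_forall fun k => (hxs k).le)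
  have hvlim : Tendsto vs atTop (𝓝 (y - s • x)) := by
    have := hxv'.sub (hx.const_smul s)
    simpa using this
  refine ⟨x, by linarith, hclosed p (by linarith) xs vs x _ (fun k => (hxs k).trans ha'2)
    (fun k => ?_) hvs hx hvlim (by linarith)⟩
  rw [show vs k - vh = (vs k + s • xs k - (vh + s • xb)) - s • (xs k - xb) by module]
  refine (norm_sub_le _ _).trans_lt ?_
  rw [norm_smul, Real.norm_of_nonneg hs0.le]
  have h1 := hyk k
  have h2 : s * ‖xs k - xb‖ ≤ s * a' := by gcongr; exact (hxs k).le
  linarith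

end ProxRegular

theorem A4.exists_hasFDerivAt {f : X → P → Q → X} {Df : X → P → Q → X →L[ℝ] X} {xb : X} {pb : P}
    {qb : Q} (h : A4 f Df xb pb qb) :
    ∃ η > (0 : ℝ), ∀ x p q, ‖x - xb‖ < η → dist p pb < η → dist q qb < η →
      HasFDerivAt (fun x => f x p q) (Df x p q) x := by
  obtain ⟨⟨η, hη, h⟩, -⟩ := h
  refine ⟨η, hη, fun x p q hx hp hq => HasFDerivAt.of_isLittleO ?_⟩
  rw [Asymptotics.isLittleO_iff]
  intro ε hε
  obtain ⟨δ, hδ, h⟩ := h ε hε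
  filter_upwards [ball_mem_nhds x hδ] with x' hx'
  rw [mem_ball, dist_eq_norm] at hx'
  exact h x p q hx hp hq x' hx'

theorem A4.exists_norm_sub_le {f : X → P → Q → X} {Df : X → P → Q → X →L[ℝ] X} {xb : X} {pb : P}
    {qb : Q} (h : A4 f Df xb pb qb) {ε : ℝ} (hε : 0 < ε) :
    ∃ η > (0 : ℝ), ∀ x p q, ‖x - xb‖ < η → dist p pb < η → dist q qb < η →
      ‖Df x p q - Df xb pb qb‖ ≤ ε := by
  obtain ⟨η, hη, h⟩ := Metric.mem_nhds_iff.1 (h.2.eventually (closedBall_mem_nhds _ hε))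
  refine ⟨η, hη, fun x p q hx hp hq => ?_⟩
  have h1 := h (show (x, p, q) ∈ ball (xb, pb, qb) η by
    rw [mem_ball, Prod.dist_eq, Prod.dist_eq, dist_eq_norm]
    exact max_lt hx (max_lt hp hq))
  rw [← dist_eq_norm]
  exact h1

/-- If `F + φ` has a local inverse `ϑ` such that `y ↦ y - (2 * κ) • ϑ y` is nonexpansive, then
the regular coderivative of `F + φ` is bounded below by `κ`. -/
theorem mul_sq_le_of_nonexpansive_localInverse [CompleteSpace X] {F : X → Set X} {φ ϑ : X → X}
    {B : X →L[ℝ] X} {u v w z : X} {κ : ℝ} {V : Set X} (hκ : 0 < κ) (hφ : HasFDerivAt φ B u)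
    (hV : V ∈ 𝓝 (v + φ u)) (hϑ : ∀ y ∈ V, y - φ (ϑ y) ∈ F (ϑ y)) (hu : ϑ (v + φ u) = u)
    (hne : ∀ y₁ ∈ V, ∀ y₂ ∈ V, ‖(y₁ - y₂) - (2 * κ) • (ϑ y₁ - ϑ y₂)‖ ≤ ‖y₁ - y₂‖)
    (hz : z ∈ regCoderiv F u v w) : κ * ‖w‖ ^ 2 ≤ ⟪B w, w⟫ + ⟪z, w⟫ := by
  set z' := z + ContinuousLinearMap.adjoint B w with hz'
  set c := (1 / (2 * κ)) • z' with hc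
  set d := c - w with hd
  set y : ℝ → X := fun t => (v + φ u) + t • d with hy
  have hy0 : Tendsto y (𝓝[>] 0) (𝓝 (v + φ u)) := by
    have h1 : Continuous y := by fun_prop
    have h2 := (h1.tendsto 0).mono_left (nhdsWithin_le_nhds (s := Ioi 0))
    simpa [hy] using h2
  have hyV : ∀ᶠ t in 𝓝[>] 0, y t ∈ V := hy0.eventually hV
  set Δx : ℝ → X := fun t => ϑ (y t) - u with hΔx
  have hn : ∀ᶠ t in 𝓝[>] 0, ‖t • d - (2 * κ) • Δx t‖ ≤ t * ‖d‖ := by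
    filter_upwards [hyV, self_mem_nhdsWithin] with t ht ht0
    have h1 := hne _ ht _ (mem_of_mem_nhds hV)
    rw [hu] at h1
    simp only [hy, add_sub_cancel_left] at h1
    rwa [norm_smul t, Real.norm_of_nonneg (le_of_lt ht0)] at h1
  have hΔ : ∀ᶠ t in 𝓝[>] 0, ‖Δx t‖ ≤ t * (‖d‖ / κ) := by
    filter_upwards [hn, self_mem_nhdsWithin] with t ht ht0
    have h1 : ‖(2 * κ) • Δx t‖ ≤ ‖t • d‖ + ‖t • d - (2 * κ) • Δx t‖ := by
      have := norm_sub_le (t • d) (t • d - (2 * κ) • Δx t)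
      rwa [sub_sub_cancel] at this
    rw [norm_smul, norm_smul, Real.norm_of_nonneg (by positivity),
      Real.norm_of_nonneg (le_of_lt ht0)] at h1
    rw [← mul_div_assoc, le_div_iff₀ hκ]
    linarith
  have hΔ0 : Tendsto Δx (𝓝[>] 0) (𝓝 0) := by
    refine squeeze_zero_norm' hΔ ?_
    have h1 : Continuous fun t : ℝ => t * (‖d‖ / κ) := by fun_prop
    have h2 := (h1.tendsto 0).mono_left (nhdsWithin_le_nhds (s := Ioi 0))
    simpa using h2
  have hx : Tendsto (fun t => ϑ (y t)) (𝓝[>] 0) (𝓝 u) := by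
    have h1 := hΔ0.add_const u
    simpa [hΔx] using h1
  have hv : Tendsto (fun t => y t - φ (ϑ (y t))) (𝓝[>] 0) (𝓝 v) := by
    have h1 := hy0.sub (hφ.continuousAt.tendsto.comp hx)
    rwa [add_sub_cancel_right] at h1
  have hgph : Tendsto (fun t => (ϑ (y t), y t - φ (ϑ (y t)))) (𝓝[>] 0) (𝓝[gph F] (u, v)) := by
    refine tendsto_nhdsWithin_iff.2 ⟨hx.prodMk_nhds hv, ?_⟩
    filter_upwards [hyV] with t ht
    exact hϑ _ ht
  set M := (1 + ‖w‖ + (‖B‖ + 1)) * (‖d‖ / κ) + ‖d‖ with hM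
  have hM0 : 0 ≤ M := by positivity
  have key : ∀ ε, 0 < ε → ε ≤ 1 → ‖d‖ ^ 2 ≤ ‖c‖ * ‖d‖ + ε * M := by
    intro ε hε hε1
    obtain ⟨t, h1, h2, h3, h4, ht⟩ := ((hgph.eventually (hz ε hε)).and
      ((hx.eventually (hφ.isLittleO.def hε)).and
        (hn.and (hΔ.and self_mem_nhdsWithin)))).exists
    change ⟪z, Δx t⟫ + ⟪-w, y t - φ (ϑ (y t)) - v⟫ ≤
      ε * Real.sqrt (‖Δx t‖ ^ 2 + ‖y t - φ (ϑ (y t)) - v‖ ^ 2) at h1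
    set R := φ (ϑ (y t)) - φ u - B (ϑ (y t) - u) with hR
    have hΔv : y t - φ (ϑ (y t)) - v = t • d - B (Δx t) - R := by
      simp only [hy, hR, hΔx, map_sub]; abel
    rw [hΔv] at h1
    have hRn : ‖R‖ ≤ ε * (t * (‖d‖ / κ)) := h2.trans (by gcongr)
    have hBn : ‖B (Δx t)‖ ≤ ‖B‖ * (t * (‖d‖ / κ)) := (B.le_opNorm _).trans (by gcongr)
    have hsq : Real.sqrt (‖Δx t‖ ^ 2 + ‖t • d - B (Δx t) - R‖ ^ 2) ≤
        t * ((1 + (‖B‖ + 1)) * (‖d‖ / κ) + ‖d‖) := by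
      have e1 : Real.sqrt (‖Δx t‖ ^ 2 + ‖t • d - B (Δx t) - R‖ ^ 2) ≤
          ‖Δx t‖ + ‖t • d - B (Δx t) - R‖ := by
        rw [Real.sqrt_le_left (by positivity)]
        nlinarith [mul_nonneg (norm_nonneg (Δx t)) (norm_nonneg (t • d - B (Δx t) - R))]
      have e2 := norm_sub_le (t • d - B (Δx t)) R
      have e3 := norm_sub_le (t • d) (B (Δx t))
      have e4 : ‖t • d‖ = t * ‖d‖ := by rw [norm_smul, Real.norm_of_nonneg ht.le]
      have e5 : ε * (t * (‖d‖ / κ)) ≤ 1 * (t * (‖d‖ / κ)) := by gcongr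
      linarith
    have hwR : -⟪w, R⟫ ≤ ε * (‖w‖ * (t * (‖d‖ / κ))) := by
      rw [← inner_neg_right]
      refine (real_inner_le_norm _ _).trans ?_
      rw [norm_neg]
      calc ‖w‖ * ‖R‖ ≤ ‖w‖ * (ε * (t * (‖d‖ / κ))) := by gcongr
        _ = _ := by ring
    have hcn : ⟪c, t • d - (2 * κ) • Δx t⟫ ≤ ‖c‖ * (t * ‖d‖) :=
      (real_inner_le_norm _ _).trans (by gcongr)
    have hcz : ⟪z', Δx t⟫ = 2 * κ * ⟪c, Δx t⟫ := by
      rw [hc, real_inner_smul_left]; field_simp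
    have hzB : ⟪z', Δx t⟫ = ⟪z, Δx t⟫ + ⟪w, B (Δx t)⟫ := by
      rw [hz', inner_add_left, ContinuousLinearMap.adjoint_inner_left]
    have hdd : ‖d‖ ^ 2 = ⟪c, d⟫ - ⟪w, d⟫ := by
      rw [← inner_sub_left, ← hd, real_inner_self_eq_norm_sq]
    have h5 := mul_le_mul_of_nonneg_left hsq hε.le
    rw [inner_neg_left, inner_sub_right w, inner_sub_right w, real_inner_smul_right w] at h1
    rw [inner_sub_right, real_inner_smul_right, real_inner_smul_right] at hcn
    refine le_of_mul_le_mul_left ?_ ht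
    rw [hdd, hM]
    linarith
  have h1 : ‖d‖ ^ 2 ≤ ‖c‖ * ‖d‖ := by
    refine le_of_forall_pos_le_add fun e he => ?_
    refine (key (min 1 (e / (M + 1))) (by positivity) (min_le_left _ _)).trans ?_
    gcongr
    calc min 1 (e / (M + 1)) * M ≤ e / (M + 1) * M := by gcongr; exact min_le_right _ _
      _ ≤ e / (M + 1) * (M + 1) := by gcongr; linarith
      _ = e := by field_simp
  have h2 : ‖d‖ ≤ ‖c‖ := by
    rcases eq_or_lt_of_le (norm_nonneg d) with h0 | h0
    · rw [← h0]; exact norm_nonneg _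
    · rw [sq] at h1; exact le_of_mul_le_mul_right h1 h0
  have h3 : ‖d‖ ^ 2 ≤ ‖c‖ ^ 2 := by gcongr
  rw [hd, norm_sub_sq_real, hc, real_inner_smul_left, ← hc] at h3
  have h4 : ⟪z', w⟫ = ⟪B w, w⟫ + ⟪z, w⟫ := by
    rw [hz', inner_add_left, ContinuousLinearMap.adjoint_inner_left, real_inner_comm (B w) w]; ring
  rw [← h4]
  have h5 : 2 * (1 / (2 * κ) * ⟪z', w⟫) = ⟪z', w⟫ / κ := by field_simp
  have h6 : ‖w‖ ^ 2 ≤ ⟪z', w⟫ / κ := by linarith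
  rw [le_div_iff₀ hκ] at h6
  linarith

/-- Hölderian full stability implies the second-order condition. -/
theorem HolderFullStableWith.exists_SOC [CompleteSpace X] {f : X → P → Q → X}
    {Df : X → P → Q → X →L[ℝ] X} {g : X → P → EReal} {xb vb vh : X} {pb : P} {qb : Q}
    (hvh : vh = vb - f xb pb qb) (hA1 : A1 f xb pb qb) (hA4 : A4 f Df xb pb qb)
    {κ ℓ : ℝ} (hκ : 0 < κ) (h : HolderFullStableWith (SolMap f g) xb vb pb qb κ ℓ)
    {κ₀ : ℝ} (hκ₀ : κ₀ < κ) : ∃ η > (0 : ℝ), SOC g (Df xb pb qb) xb pb vh η κ₀ := by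
  obtain ⟨V, hV, Pn, hPn, Qn, hQn, U, hU, ϑ, hloc, hest⟩ := h
  obtain ⟨L, hL, ε₁, hε₁, hf⟩ := hA1
  obtain ⟨η₁, hη₁, hder⟩ := hA4.exists_hasFDerivAt
  obtain ⟨η₂, hη₂, hcon⟩ := hA4.exists_norm_sub_le (sub_pos.2 hκ₀)
  obtain ⟨εV, hεV, hVs⟩ := Metric.mem_nhds_iff.1 hV
  obtain ⟨εP, hεP, hPs⟩ := Metric.mem_nhds_iff.1 hPn
  obtain ⟨εU, hεU, hUs⟩ := Metric.mem_nhds_iff.1 hU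
  have hqb := mem_of_mem_nhds hQn
  set η := min (min ε₁ (min η₁ η₂)) (min εP (min εU (εV / (1 + 2 * L)))) / 2 with hη
  have hη0 : 0 < η := by positivity
  have h2η : 2 * η = min (min ε₁ (min η₁ η₂)) (min εP (min εU (εV / (1 + 2 * L)))) := by
    rw [hη]; ring
  have e1 : η < ε₁ := lt_of_lt_of_le (by linarith) (h2η.le.trans (by simp))
  have e2 : η < η₁ := lt_of_lt_of_le (by linarith) (h2η.le.trans (by simp))
  have e3 : η < η₂ := lt_of_lt_of_le (by linarith) (h2η.le.trans (by simp))
  have e4 : η < εP := lt_of_lt_of_le (by linarith) (h2η.le.trans (by simp))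
  have e5 : η < εU := lt_of_lt_of_le (by linarith) (h2η.le.trans (by simp))
  have e6 : η * (1 + 2 * L) < εV := by
    rw [← lt_div_iff₀ (by positivity)]
    exact lt_of_lt_of_le (by linarith) (h2η.le.trans (by simp))
  refine ⟨η, hη0, fun u p v hu hp hv hmem w z hz => ?_⟩
  have hpP : p ∈ Pn := hPs (by rw [mem_ball]; linarith)
  have huU : u ∈ U := hUs (by rw [mem_ball, dist_eq_norm]; linarith)
  have hfu := hf u xb p pb qb qb (by linarith) (by simpa) (by linarith) (by simpa) (by simpa)
    (by simpa)
  rw [dist_self] at hfu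
  have hball : ball vb εV ∈ 𝓝 (v + f u p qb) := by
    refine isOpen_ball.mem_nhds ?_
    rw [mem_ball, dist_eq_norm, show v + f u p qb - vb = (v - vh) + (f u p qb - f xb pb qb) by
      rw [hvh]; abel]
    refine (norm_add_le _ _).trans_lt ?_
    have : L * (‖u - xb‖ + dist p pb + 0) ≤ L * (η + η + 0) := by gcongr
    linarith
  have hV' : V ∈ 𝓝 (v + f u p qb) := mem_of_superset hball hVs
  have huϑ : ϑ (v + f u p qb) p qb = u :=
    ((hloc _ (mem_of_mem_nhds hV') p hpP qb hqb).2.2 u huU (by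
      change v + f u p qb - f u p qb ∈ pSubdiff g u p
      rwa [add_sub_cancel_right])).symm
  have h1 := mul_sq_le_of_nonexpansive_localInverse (F := fun y => pSubdiff g y p)
    (φ := fun x => f x p qb) (ϑ := fun y => ϑ y p qb) hκ
    (hder u p qb (by linarith) (by linarith) (by simpa)) hV'
    (fun y hy => (hloc y hy p hpP qb hqb).2.1) huϑ
    (fun y₁ hy₁ y₂ hy₂ => by
      simpa using hest y₁ hy₁ p hpP qb hqb y₂ hy₂ p hpP qb hqb) hz
  have h2 := hcon u p qb (by linarith) (by linarith) (by simpa)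
  have h3 : ⟪(Df u p qb - Df xb pb qb) w, w⟫ ≤ (κ - κ₀) * ‖w‖ ^ 2 := by
    refine (real_inner_le_norm _ _).trans ?_
    calc ‖(Df u p qb - Df xb pb qb) w‖ * ‖w‖ ≤ ((κ - κ₀) * ‖w‖) * ‖w‖ := by
          gcongr; exact ContinuousLinearMap.le_of_opNorm_le _ h2 w
      _ = _ := by ring
  rw [sub_apply, inner_sub_left] at h3
  linarith

section Stability

variable {Pi : Type*} [PseudoMetricSpace Pi]

theorem LocMono.add_perturbation {G : Pi → X → Set X} {πb : Pi} {xb yb : X} {m : ℝ}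
    (hM : LocMono G πb xb yb m) {e : Pi → X → X} {c : ℝ} (hc : 0 ≤ c)
    (hLip : ∃ δ > (0 : ℝ), ∀ π x₁ x₂, dist π πb < δ → ‖x₁ - xb‖ < δ → ‖x₂ - xb‖ < δ →
      ‖e π x₁ - e π x₂‖ ≤ c * ‖x₁ - x₂‖)
    (hcont : ∀ ε > (0 : ℝ), ∃ η > (0 : ℝ), ∀ π, dist π πb < η → ‖e π xb - e πb xb‖ ≤ ε) :
    LocMono (fun π x => {y | y - e π x ∈ G π x}) πb xb (yb + e πb xb) (m - c) := by
  obtain ⟨δ₁, hδ₁, hM⟩ := hM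
  obtain ⟨δ₂, hδ₂, hLip⟩ := hLip
  obtain ⟨η, hη, hcont⟩ := hcont (δ₁ / 2) (by positivity)
  refine ⟨min (min δ₁ δ₂) (min η (δ₁ / (2 * (1 + c)))), by positivity,
    fun π x₁ x₂ y₁ y₂ hπ hx₁ hx₂ hy₁ hy₂ h₁ h₂ => ?_⟩
  simp only [lt_min_iff] at hπ hx₁ hx₂ hy₁ hy₂
  have hval : ∀ x y, ‖x - xb‖ < δ₂ → ‖x - xb‖ < δ₁ / (2 * (1 + c)) →
      ‖y - (yb + e πb xb)‖ < δ₁ / (2 * (1 + c)) → ‖y - e π x - yb‖ < δ₁ := by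
    intro x y hx hx' hy
    have i1 := hLip π x xb hπ.1.2 hx (by simpa)
    have i2 := hcont π hπ.2.1
    have i3 : c * ‖x - xb‖ ≤ c * (δ₁ / (2 * (1 + c))) := by gcongr
    have i4 : δ₁ / (2 * (1 + c)) + c * (δ₁ / (2 * (1 + c))) = δ₁ / 2 := by field_simp
    rw [show y - e π x - yb =
      (y - (yb + e πb xb)) - (e π x - e π xb) - (e π xb - e πb xb) by abel]
    have i5 := norm_sub_le ((y - (yb + e πb xb)) - (e π x - e π xb)) (e π xb - e πb xb)
    have i6 := norm_sub_le (y - (yb + e πb xb)) (e π x - e π xb)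
    linarith
  have h := hM π x₁ x₂ _ _ hπ.1.1 hx₁.1.1 hx₂.1.1 (hval x₁ y₁ hx₁.1.2 hx₁.2.2 hy₁.2.2)
    (hval x₂ y₂ hx₂.1.2 hx₂.2.2 hy₂.2.2) h₁ h₂
  rw [show y₁ - e π x₁ - (y₂ - e π x₂) = (y₁ - y₂) - (e π x₁ - e π x₂) by abel,
    inner_sub_left] at h
  have i1 := hLip π x₁ x₂ hπ.1.2 hx₁.1.2 hx₂.1.2
  have i2 := neg_le_of_abs_le (abs_real_inner_le_norm (e π x₁ - e π x₂) (x₁ - x₂))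
  have i3 : ‖e π x₁ - e π x₂‖ * ‖x₁ - x₂‖ ≤ c * ‖x₁ - x₂‖ * ‖x₁ - x₂‖ := by gcongr
  rw [sub_mul, sq] at *
  linarith

theorem LocExist.congr_linear [CompleteSpace X] {F : Pi → X → Set X} {πb : Pi} {xb vh : X}
    {B B' : X →L[ℝ] X} {m c : ℝ} (hE : LocExist (fun π x => {y | y - B x ∈ F π x}) πb xb (vh + B xb))
    (hM : LocMono (fun π x => {y | y - B x ∈ F π x}) πb xb (vh + B xb) m)
    (hB : ‖B' - B‖ ≤ c) (hcm : c < m) :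
    LocExist (fun π x => {y | y - B' x ∈ F π x}) πb xb (vh + B' xb) ∧
      LocMono (fun π x => {y | y - B' x ∈ F π x}) πb xb (vh + B' xb) (m - c) := by
  have hc : 0 ≤ c := (norm_nonneg _).trans hB
  have hLip : ∃ δ > (0 : ℝ), ∀ (π : Pi) (x₁ x₂ : X), dist π πb < δ → ‖x₁ - xb‖ < δ →
      ‖x₂ - xb‖ < δ → ‖(B' - B) x₁ - (B' - B) x₂‖ ≤ c * ‖x₁ - x₂‖ :=
    ⟨1, one_pos, fun _ x₁ x₂ _ _ _ => by
      rw [← map_sub]; exact ContinuousLinearMap.le_of_opNorm_le _ hB _⟩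
  have hcont : ∀ ε > (0 : ℝ), ∃ η > (0 : ℝ), ∀ π : Pi, dist π πb < η →
      ‖(B' - B) xb - (B' - B) xb‖ ≤ ε := fun ε hε => ⟨1, one_pos, fun _ _ => by simpa using hε.le⟩
  have h1 := hE.add_perturbation hM (e := fun _ x => (B' - B) x) hc hcm hLip hcont
  have h2 := hM.add_perturbation (e := fun _ x => (B' - B) x) hc hLip hcont
  have hG : ∀ x y : X, y - (B' - B) x - B x = y - B' x := fun x y => by
    rw [sub_apply]; abel
  have hb : vh + B xb + (B' - B) xb = vh + B' xb := by rw [sub_apply]; abel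
  simp only [mem_ofPred_eq, hG, hb] at h1 h2
  exact ⟨h1, h2⟩

/-- Continuation: a local strongly monotone inverse of `F + A + σ` and a coderivative condition
for `F + A` yield a local strongly monotone inverse of `F + A`. -/
theorem LocExist.of_coderivative [CompleteSpace X] {F : Pi → X → Set X} {πb : Pi} {xb vh : X}
    {A : X →L[ℝ] X} {K σ m : ℝ} (hK : 0 < K) (hσ : 0 ≤ σ) (hm : 0 < m)
    (hE : LocExist (fun π x => {y | y - (A + σ • ContinuousLinearMap.id ℝ X) x ∈ F π x}) πb xb
      (vh + (A + σ • ContinuousLinearMap.id ℝ X) xb))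
    (hM : LocMono (fun π x => {y | y - (A + σ • ContinuousLinearMap.id ℝ X) x ∈ F π x}) πb xb
      (vh + (A + σ • ContinuousLinearMap.id ℝ X) xb) m)
    (hS : ∃ η > (0 : ℝ), ∀ π u v, dist π πb ≤ η → ‖u - xb‖ ≤ η → ‖v - vh‖ ≤ η → v ∈ F π u →
      ∀ w z, z ∈ regCoderiv (F π) u v w → K * ‖w‖ ^ 2 ≤ ⟪A w, w⟫ + ⟪z, w⟫) :
    LocExist (fun π x => {y | y - A x ∈ F π x}) πb xb (vh + A xb) ∧
      LocMono (fun π x => {y | y - A x ∈ F π x}) πb xb (vh + A xb) K := by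
  obtain ⟨n, hn⟩ := exists_nat_gt (σ / K)
  have hn0 : (0 : ℝ) < n := (by positivity : 0 ≤ σ / K).trans_lt hn
  set τ := σ / n with hτ
  have hτ0 : 0 ≤ τ := by positivity
  have hτK : τ < K := by
    rw [div_lt_iff₀ hK] at hn
    rw [hτ, div_lt_iff₀ hn0]
    linarith
  set B : ℕ → X →L[ℝ] X := fun k => A + (k * τ) • ContinuousLinearMap.id ℝ X with hB
  have hup : ∀ k : ℕ, ∀ m > 0,
      LocExist (fun π x => {y | y - B k x ∈ F π x}) πb xb (vh + B k xb) →
      LocMono (fun π x => {y | y - B k x ∈ F π x}) πb xb (vh + B k xb) m →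
      LocMono (fun π x => {y | y - B k x ∈ F π x}) πb xb (vh + B k xb) (K + k * τ) := by
    intro k m hm hE hM
    obtain ⟨η, hη, hS⟩ := hS
    refine LocMono.of_coderivative (by positivity) hm hE hM
      ⟨η, hη, fun π u v h1 h2 h3 h4 w z hz => ?_⟩
    have h := hS π u v h1 h2 h3 h4 w z hz
    have hBw : ⟪B k w, w⟫ = ⟪A w, w⟫ + k * τ * ‖w‖ ^ 2 := by
      simp [hB, inner_add_left, real_inner_smul_left]
    rw [hBw]
    linarith
  have key : ∀ k : ℕ, ∀ m > 0,
      LocExist (fun π x => {y | y - B k x ∈ F π x}) πb xb (vh + B k xb) →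
      LocMono (fun π x => {y | y - B k x ∈ F π x}) πb xb (vh + B k xb) m →
      LocExist (fun π x => {y | y - B 0 x ∈ F π x}) πb xb (vh + B 0 xb) ∧
      LocMono (fun π x => {y | y - B 0 x ∈ F π x}) πb xb (vh + B 0 xb) K := by
    intro k
    induction k with
    | zero =>
      intro m hm hE hM
      have h := hup 0 m hm hE hM
      rw [Nat.cast_zero, zero_mul, add_zero] at h
      exact ⟨hE, h⟩
    | succ k ih =>
      intro m hm hE hM
      have hBB : ‖B k - B (k + 1)‖ ≤ τ := by
        have : B k - B (k + 1) = -(τ • ContinuousLinearMap.id ℝ X) := by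
          simp only [hB]; push_cast; module
        rw [this, norm_neg]
        refine ContinuousLinearMap.opNorm_le_bound _ hτ0 fun x => ?_
        simp [norm_smul, abs_of_nonneg hτ0]
      have hk : τ < K + (k + 1 : ℕ) * τ := by
        have : 0 ≤ (k + 1 : ℕ) * τ := by positivity
        linarith
      have h := LocExist.congr_linear hE (hup (k + 1) m hm hE hM) hBB hk
      exact ih _ (sub_pos.2 hk) h.1 h.2
  have hB0 : B 0 = A := by simp [hB]
  have hBn : B n = A + σ • ContinuousLinearMap.id ℝ X := by
    simp only [hB, hτ]
    rw [mul_div_cancel₀ _ hn0.ne']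
  have h := key n m hm (by rwa [hBn]) (by rwa [hBn])
  rwa [hB0] at h

end Stability

theorem ProxRegWith.exists_eq_coe {g : X → P → EReal} {xb vh : X} {pb : P} {r : ℝ}
    (hprox : ProxRegWith g xb pb vh r) (hvh : vh ∈ pSubdiff g xb pb) (hg : ∀ x p, g x p ≠ ⊥) :
    ∃ γ : ℝ, g xb pb = γ := by
  obtain ⟨ε, hε, hprox⟩ := hprox
  by_cases htop : g xb pb = ⊤
  · obtain ⟨xs, vs, hxs, hgs, hreg, hvs⟩ := hvh
    obtain ⟨k, hk⟩ := (hxs.eventually (ball_mem_nhds xb hε)).exists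
    rw [dist_eq_norm] at hk
    have h := hprox (xs k) xb pb vh hk (by simpa) (by simpa) (by simpa)
      ⟨xs, vs, hxs, hgs, hreg, hvs⟩
    rw [htop, EReal.top_add_coe, top_le_iff] at h
    exact absurd h (hreg k).1
  · exact ⟨(g xb pb).toReal, (EReal.coe_toReal htop (hg xb pb)).symm⟩

/-- Under the second-order condition, `∂g_p + A` has a local strongly monotone inverse. -/
theorem SOC.locExist_locMono [CompleteSpace X] {g : X → P → EReal} {A : X →L[ℝ] X} {xb vh : X}
    {pb : P} {γ r η κ₀ : ℝ} (hr : 0 ≤ r) (hη : 0 < η) (hκ₀ : 0 < κ₀)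
    (hlsc : LowerSemicontinuous fun t : X × P => g t.1 t.2) (hg : ∀ x p, g x p ≠ ⊥)
    (hγ : g xb pb = γ) (hprox : ProxRegWith g xb pb vh r) (hcont : SubdiffCont g xb pb vh)
    (hA3 : A3 g xb pb) (hvh : vh ∈ pSubdiff g xb pb) (h : SOC g A xb pb vh η κ₀) :
    LocExist (fun p x => {y | y - A x ∈ pSubdiff g x p}) pb xb (vh + A xb) ∧
      LocMono (fun p x => {y | y - A x ∈ pSubdiff g x p}) pb xb (vh + A xb) κ₀ := by
  set s := r + ‖A‖ + 1 with hs
  have hs0 : 0 ≤ s := by positivity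
  have hrs : r < s := by have := norm_nonneg A; linarith
  have hcm : ‖A‖ < s - r := by linarith
  have hE := locExist_subdiff_add_smul hr hlsc hg hγ hprox hcont hA3 hvh hrs
  have hM := locMono_subdiff_add_smul hr hlsc hγ hprox hcont hA3 hs0
  obtain ⟨hE', hM'⟩ := LocExist.congr_linear (F := fun p x => pSubdiff g x p)
    (B := s • ContinuousLinearMap.id ℝ X) (B' := A + s • ContinuousLinearMap.id ℝ X) (c := ‖A‖)
    hE hM (by rw [add_sub_cancel_right]) hcm
  exact hE'.of_coderivative hκ₀ hs0 (sub_pos.2 hcm) hM'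
    ⟨η, hη, fun p u v h1 h2 h3 h4 w z hz => h u p v h2 h1 h3 h4 w z hz⟩

theorem A4.exists_lipschitz_sub {f : X → P → Q → X} {Df : X → P → Q → X →L[ℝ] X} {xb : X}
    {pb : P} {qb : Q} (h : A4 f Df xb pb qb) {c : ℝ} (hc : 0 < c) :
    ∃ δ > (0 : ℝ), ∀ x₁ x₂ p q, ‖x₁ - xb‖ < δ → ‖x₂ - xb‖ < δ → dist p pb < δ → dist q qb < δ →
      ‖(f x₁ p q - Df xb pb qb x₁) - (f x₂ p q - Df xb pb qb x₂)‖ ≤ c * ‖x₁ - x₂‖ := by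
  obtain ⟨η₁, hη₁, h1⟩ := h.exists_hasFDerivAt
  obtain ⟨η₂, hη₂, h2⟩ := h.exists_norm_sub_le hc
  refine ⟨min η₁ η₂, by positivity, fun x₁ x₂ p q hx₁ hx₂ hp hq => ?_⟩
  rw [lt_min_iff] at hp hq
  have key := (convex_ball xb (min η₁ η₂)).norm_image_sub_le_of_norm_hasFDerivWithin_le'
    (f := fun x => f x p q) (f' := fun x => Df x p q) (φ := Df xb pb qb) (C := c) (x := x₂)
    (y := x₁)
    (fun x hx => by
      rw [mem_ball, dist_eq_norm, lt_min_iff] at hx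
      exact (h1 x p q hx.1 hp.1 hq.1).hasFDerivWithinAt)
    (fun x hx => by
      rw [mem_ball, dist_eq_norm, lt_min_iff] at hx
      exact h2 x p q hx.2 hp.2 hq.2)
    (by rwa [mem_ball, dist_eq_norm]) (by rwa [mem_ball, dist_eq_norm])
  rw [map_sub] at key
  rwa [show f x₁ p q - Df xb pb qb x₁ - (f x₂ p q - Df xb pb qb x₂) =
    f x₁ p q - f x₂ p q - (Df xb pb qb x₁ - Df xb pb qb x₂) by abel]

/-- Passage from the linearized system to the original one. -/
theorem locExist_locMono_of_linearization [CompleteSpace X] {f : X → P → Q → X}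
    {Df : X → P → Q → X →L[ℝ] X} {F : P → X → Set X} {xb vb vh : X} {pb : P} {qb : Q}
    {κ κ₀ : ℝ} (hvh : vh = vb - f xb pb qb) (hA1 : A1 f xb pb qb) (hA4 : A4 f Df xb pb qb)
    (hκ : 0 < κ) (hκ₀ : κ < κ₀)
    (hE : LocExist (fun p x => {y | y - Df xb pb qb x ∈ F p x}) pb xb (vh + Df xb pb qb xb))
    (hM : LocMono (fun p x => {y | y - Df xb pb qb x ∈ F p x}) pb xb (vh + Df xb pb qb xb) κ₀) :
    LocExist (fun (π : P × Q) x => {y | y - f x π.1 π.2 ∈ F π.1 x}) (pb, qb) xb vb ∧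
      LocMono (fun (π : P × Q) x => {y | y - f x π.1 π.2 ∈ F π.1 x}) (pb, qb) xb vb κ := by
  set A := Df xb pb qb with hA
  have hE' : LocExist (fun (π : P × Q) x => {y | y - A x ∈ F π.1 x}) (pb, qb) xb (vh + A xb) := by
    intro a ha
    obtain ⟨b, hb, h⟩ := hE a ha
    exact ⟨b, hb, fun π y hπ hy => h π.1 y ((le_max_left _ _).trans_lt hπ) hy⟩
  have hM' : LocMono (fun (π : P × Q) x => {y | y - A x ∈ F π.1 x}) (pb, qb) xb (vh + A xb) κ₀ := by
    obtain ⟨δ, hδ, h⟩ := hM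
    exact ⟨δ, hδ, fun π x₁ x₂ y₁ y₂ hπ => h π.1 x₁ x₂ y₁ y₂ ((le_max_left _ _).trans_lt hπ)⟩
  have hc : 0 < κ₀ - κ := sub_pos.2 hκ₀
  have hLip : ∃ δ > (0 : ℝ), ∀ (π : P × Q) (x₁ x₂ : X), dist π (pb, qb) < δ → ‖x₁ - xb‖ < δ →
      ‖x₂ - xb‖ < δ → ‖(f x₁ π.1 π.2 - A x₁) - (f x₂ π.1 π.2 - A x₂)‖ ≤
        (κ₀ - κ) * ‖x₁ - x₂‖ := by
    obtain ⟨δ, hδ, h⟩ := hA4.exists_lipschitz_sub hc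
    exact ⟨δ, hδ, fun π x₁ x₂ hπ h₁ h₂ => h x₁ x₂ π.1 π.2 h₁ h₂
      ((le_max_left _ _).trans_lt hπ) ((le_max_right _ _).trans_lt hπ)⟩
  have hcont : ∀ ε > (0 : ℝ), ∃ η > (0 : ℝ), ∀ π : P × Q, dist π (pb, qb) < η →
      ‖(f xb π.1 π.2 - A xb) - (f xb pb qb - A xb)‖ ≤ ε := by
    intro ε hε
    obtain ⟨L, hL, δ, hδ, h⟩ := hA1
    refine ⟨min δ (ε / (2 * L)), by positivity, fun π hπ => ?_⟩
    rw [lt_min_iff] at hπ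
    have h1 : dist π.1 pb ≤ dist π (pb, qb) := le_max_left _ _
    have h2 : dist π.2 qb ≤ dist π (pb, qb) := le_max_right _ _
    have h3 := h xb xb π.1 pb π.2 qb (by simpa) (by simpa) (by linarith) (by simpa)
      (by linarith) (by simpa)
    rw [sub_self, norm_zero] at h3
    rw [sub_sub_sub_cancel_right]
    refine h3.trans ?_
    calc L * (0 + dist π.1 pb + dist π.2 qb) ≤ L * (0 + ε / (2 * L) + ε / (2 * L)) := by
          gcongr <;> linarith
      _ = ε := by field_simp; ring
  have h1 := hE'.add_perturbation hM' (e := fun π x => f x π.1 π.2 - A x) hc.le (by linarith)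
    hLip hcont
  have h2 := hM'.add_perturbation (e := fun π x => f x π.1 π.2 - A x) hc.le hLip hcont
  have hG : ∀ (x y : X) (π : P × Q), y - (f x π.1 π.2 - A x) - A x = y - f x π.1 π.2 :=
    fun x y π => by abel
  have hb : vh + A xb + (f xb pb qb - A xb) = vb := by rw [hvh]; abel
  simp only [mem_ofPred_eq, hG, hb, sub_sub_cancel] at h1 h2
  exact ⟨h1, h2⟩

/-- Solutions of the variational system depend in a Hölderian way on the parameters. -/
theorem exists_holder_estimate {f : X → P → Q → X} {F : P → X → Set X} {xb vb vh : X} {pb : P}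
    {qb : Q} {r C κ δ s : ℝ} (hvh : vh = vb - f xb pb qb) (hA1 : A1 f xb pb qb) (hκ : 0 < κ)
    (hC : 0 ≤ C) (hδ : 0 < δ) (hs : 0 ≤ s) (hrs : s - r = 1)
    (hF : ∀ p₁ p₂ x₁ x₂ v₁ v₂, dist p₁ pb < δ → dist p₂ pb < δ →
      ‖x₁ - xb‖ < δ → ‖x₂ - xb‖ < δ → ‖v₁ - vh‖ < δ → ‖v₂ - vh‖ < δ →
      v₁ ∈ F p₁ x₁ → v₂ ∈ F p₂ x₂ → -r * ‖x₁ - x₂‖ ^ 2 - C * dist p₁ p₂ ≤ ⟪v₁ - v₂, x₁ - x₂⟫)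
    (hE : LocExist (fun p x => {y | y - s • x ∈ F p x}) pb xb (vh + s • xb))
    (hM : LocMono (fun (π : P × Q) x => {y | y - f x π.1 π.2 ∈ F π.1 x}) (pb, qb) xb vb κ) :
    ∃ a > (0 : ℝ), ∃ K ≥ (0 : ℝ), ∀ p₁ p₂ q₁ q₂ v x₁ x₂, dist p₁ pb < a → dist p₂ pb < a →
      dist q₁ qb < a → dist q₂ qb < a → ‖v - vb‖ < a → ‖x₁ - xb‖ < a → ‖x₂ - xb‖ < a →
      v - f x₁ p₁ q₁ ∈ F p₁ x₁ → v - f x₂ p₂ q₂ ∈ F p₂ x₂ →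
      ‖x₁ - x₂‖ ≤ K * (Real.sqrt (dist p₁ p₂) + dist q₁ q₂) := by
  obtain ⟨L, hL, ε, hε, hf⟩ := hA1
  obtain ⟨μ, hμ, hM⟩ := hM
  set ρ := min ε (min δ μ) with hρ
  have hρ0 : 0 < ρ := by positivity
  have hρε : ρ ≤ ε := min_le_left _ _
  have hρδ : ρ ≤ δ := (min_le_right _ _).trans (min_le_left _ _)
  have hρμ : ρ ≤ μ := (min_le_right _ _).trans (min_le_right _ _)
  set a₁ := ρ / (1 + 6 * L + 2 * s) with ha₁
  have ha₁0 : 0 < a₁ := by positivity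
  have ha₁ρ : a₁ + 6 * (L * a₁) + 2 * (s * a₁) = ρ := by rw [ha₁]; field_simp
  have hLa : 0 < L * a₁ := by positivity
  have hsa : 0 ≤ s * a₁ := by positivity
  obtain ⟨b, hb, hE⟩ := hE a₁ ha₁0
  set a := min a₁ (min (1 / 2) (b / (1 + 3 * L + s))) with ha
  have ha0 : 0 < a := by positivity
  have haa : a ≤ a₁ := min_le_left _ _
  have ha2 : a ≤ 1 / 2 := (min_le_right _ _).trans (min_le_left _ _)
  have hab : a * (1 + 3 * L + s) ≤ b := by
    rw [← le_div_iff₀ (by positivity)]; exact (min_le_right _ _).trans (min_le_right _ _)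
  have hLaa : L * a ≤ L * a₁ := by gcongr
  have hsaa : s * a ≤ s * a₁ := by gcongr
  have hb1 : a ≤ b := by
    refine le_trans ?_ hab
    have : 0 ≤ a * (3 * L + s) := by positivity
    linarith
  refine ⟨a, ha0, Real.sqrt C * (1 + (s + L) / κ) + L / κ, by positivity,
    fun p₁ p₂ q₁ q₂ v x₁ x₂ hp₁ hp₂ hq₁ hq₂ hv hx₁ hx₂ hS₁ hS₂ => ?_⟩
  set w := v - f x₁ p₁ q₁ with hw
  have hwn : ‖w - vh‖ < a + 3 * (L * a) := by
    have i1 := hf x₁ xb p₁ pb q₁ qb (by linarith) (by simpa) (by linarith) (by simpa)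
      (by linarith) (by simpa)
    have i2 : L * (‖x₁ - xb‖ + dist p₁ pb + dist q₁ qb) ≤ L * (a + a + a) := by gcongr
    rw [show w - vh = (v - vb) - (f x₁ p₁ q₁ - f xb pb qb) by rw [hw, hvh]; abel]
    have i3 := norm_sub_le (v - vb) (f x₁ p₁ q₁ - f xb pb qb)
    linarith
  have hsx : ∀ x d, ‖x - xb‖ < d → ‖s • (x - xb)‖ ≤ s * d := fun x d hx => by
    rw [norm_smul, Real.norm_of_nonneg hs]; gcongr
  have hsx₁ := hsx x₁ a hx₁
  obtain ⟨x, hx, hxF⟩ := hE p₂ (w + s • x₁) (by linarith) (by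
    rw [show w + s • x₁ - (vh + s • xb) = (w - vh) + s • (x₁ - xb) by module]
    have := norm_add_le (w - vh) (s • (x₁ - xb))
    linarith)
  set w' := w + s • x₁ - s • x with hw'
  have hsx' := hsx x a₁ hx
  have hw'n : ‖w' - vh‖ < a + 3 * (L * a) + s * a + s * a₁ := by
    rw [show w' - vh = (w - vh) + s • (x₁ - xb) - s • (x - xb) by rw [hw']; module]
    have i1 := norm_sub_le ((w - vh) + s • (x₁ - xb)) (s • (x - xb))
    have i2 := norm_add_le (w - vh) (s • (x₁ - xb))
    linarith
  have hh := hF p₁ p₂ x₁ x w w' (by linarith) (by linarith) (by linarith) (by linarith)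
    (by linarith) (by linarith) hS₁ hxF
  have hΔ : ‖x₁ - x‖ ≤ Real.sqrt C * Real.sqrt (dist p₁ p₂) := by
    rw [show w - w' = -(s • (x₁ - x)) by rw [hw']; module, inner_neg_left, real_inner_smul_left,
      real_inner_self_eq_norm_sq] at hh
    rw [← Real.sqrt_mul hC]
    refine Real.le_sqrt_of_sq_le ?_
    have : s * ‖x₁ - x‖ ^ 2 - r * ‖x₁ - x‖ ^ 2 = ‖x₁ - x‖ ^ 2 := by rw [← sub_mul, hrs, one_mul]
    linarith
  set v' := w' + f x p₂ q₂ with hv'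
  have hv'n : ‖v' - vb‖ < μ := by
    have i1 := hf x xb p₂ pb q₂ qb (by linarith) (by simpa) (by linarith) (by simpa)
      (by linarith) (by simpa)
    have i2 : L * (‖x - xb‖ + dist p₂ pb + dist q₂ qb) ≤ L * (a₁ + a₁ + a₁) := by
      gcongr <;> linarith
    rw [show v' - vb = (w' - vh) + (f x p₂ q₂ - f xb pb qb) by rw [hv', hvh]; abel]
    have i3 := norm_add_le (w' - vh) (f x p₂ q₂ - f xb pb qb)
    linarith
  have hm := hM (p₂, q₂) x x₂ v' v (max_lt (by linarith) (by linarith)) (by linarith)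
    (by linarith) hv'n (by linarith)
    (show v' - f x p₂ q₂ ∈ F p₂ x by rwa [hv', add_sub_cancel_right]) hS₂
  have hm' := mul_norm_le_of_mul_sq_le_inner hm
  have hvv : ‖v' - v‖ ≤ (s + L) * ‖x₁ - x‖ + L * (dist p₁ p₂ + dist q₁ q₂) := by
    rw [show v' - v = s • (x₁ - x) - (f x₁ p₁ q₁ - f x p₂ q₂) by
      rw [hv', hw', hw]; module]
    have i1 := hf x₁ x p₁ p₂ q₁ q₂ (by linarith) (by linarith) (by linarith) (by linarith)
      (by linarith) (by linarith)
    have i2 := norm_sub_le (s • (x₁ - x)) (f x₁ p₁ q₁ - f x p₂ q₂)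
    rw [norm_smul, Real.norm_of_nonneg hs] at i2
    linarith
  have hd : dist p₁ p₂ ≤ Real.sqrt (dist p₁ p₂) := by
    have i1 := dist_triangle_right p₁ p₂ pb
    refine Real.le_sqrt_of_sq_le ?_
    rw [sq]
    exact mul_le_of_le_one_left dist_nonneg (by linarith)
  have hx2 : ‖x - x₂‖ ≤ ((s + L) * ‖x₁ - x‖ + L * (dist p₁ p₂ + dist q₁ q₂)) / κ := by
    rw [le_div_iff₀ hκ]; linarith
  have htri := norm_sub_le_norm_sub_add_norm_sub x₁ x x₂
  have hq : 0 ≤ Real.sqrt C * (1 + (s + L) / κ) * dist q₁ q₂ := by positivity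
  calc ‖x₁ - x₂‖ ≤ ‖x₁ - x‖ + ((s + L) * ‖x₁ - x‖ + L * (dist p₁ p₂ + dist q₁ q₂)) / κ := by
        linarith
    _ ≤ Real.sqrt C * Real.sqrt (dist p₁ p₂) + ((s + L) * (Real.sqrt C * Real.sqrt (dist p₁ p₂)) +
        L * (Real.sqrt (dist p₁ p₂) + dist q₁ q₂)) / κ := by gcongr
    _ = (Real.sqrt C * (1 + (s + L) / κ) + L / κ) * (Real.sqrt (dist p₁ p₂) + dist q₁ q₂) -
        Real.sqrt C * (1 + (s + L) / κ) * dist q₁ q₂ := by ring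
    _ ≤ _ := by linarith

theorem norm_sub_smul_le_of_mul_sq_le_inner {κ : ℝ} {x y : X} (hκ : 0 ≤ κ)
    (h : κ * ‖x‖ ^ 2 ≤ ⟪y, x⟫) : ‖y - (2 * κ) • x‖ ≤ ‖y‖ := by
  refine le_of_sq_le_sq ?_ (norm_nonneg _)
  rw [norm_sub_sq_real, real_inner_smul_right, norm_smul, Real.norm_of_nonneg (by positivity)]
  nlinarith [mul_le_mul_of_nonneg_left h hκ]

/-- The localization built from local solvability, local strong monotonicity and a Hölderian
estimate in the parameters. -/
theorem HolderFullStableWith.of_locExist_locMono {f : X → P → Q → X} {g : X → P → EReal}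
    {xb vb : X} {pb : P} {qb : Q} {κ a K : ℝ} (hκ : 0 < κ) (ha : 0 < a) (hK : 0 ≤ K)
    (hE : LocExist (fun (π : P × Q) x => {y | y - f x π.1 π.2 ∈ pSubdiff g x π.1}) (pb, qb) xb vb)
    (hM : LocMono (fun (π : P × Q) x => {y | y - f x π.1 π.2 ∈ pSubdiff g x π.1}) (pb, qb) xb vb κ)
    (hH : ∀ p₁ p₂ q₁ q₂ v x₁ x₂, dist p₁ pb < a → dist p₂ pb < a →
      dist q₁ qb < a → dist q₂ qb < a → ‖v - vb‖ < a → ‖x₁ - xb‖ < a → ‖x₂ - xb‖ < a →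
      v - f x₁ p₁ q₁ ∈ pSubdiff g x₁ p₁ → v - f x₂ p₂ q₂ ∈ pSubdiff g x₂ p₂ →
      ‖x₁ - x₂‖ ≤ K * (Real.sqrt (dist p₁ p₂) + dist q₁ q₂)) :
    ∃ ℓ > (0 : ℝ), HolderFullStableWith (SolMap f g) xb vb pb qb κ ℓ := by
  obtain ⟨δ, hδ, hM⟩ := hM
  obtain ⟨b, hb, hE⟩ := hE (min a δ) (by positivity)
  set β := min b (min a δ) with hβ
  have hβ0 : 0 < β := by positivity
  have hβb : β ≤ b := min_le_left _ _
  have hβa : β ≤ a := (min_le_right _ _).trans (min_le_left _ _)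
  have hβδ : β ≤ δ := (min_le_right _ _).trans (min_le_right _ _)
  have hex : ∀ v p q, ∃ x, ‖v - vb‖ < β → dist p pb < β → dist q qb < β →
      ‖x - xb‖ < min a δ ∧ v - f x p q ∈ pSubdiff g x p := by
    intro v p q
    by_cases h : ‖v - vb‖ < β ∧ dist p pb < β ∧ dist q qb < β
    · obtain ⟨x, hx⟩ := hE (p, q) v (max_lt (by linarith) (by linarith)) (by linarith)
      exact ⟨x, fun _ _ _ => hx⟩
    · exact ⟨xb, fun h1 h2 h3 => absurd ⟨h1, h2, h3⟩ h⟩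
  choose ϑ hϑ using hex
  have hmono : ∀ v₁ v₂ x₁ x₂ p q, ‖v₁ - vb‖ < β → ‖v₂ - vb‖ < β → dist p pb < β →
      dist q qb < β → ‖x₁ - xb‖ < min a δ → ‖x₂ - xb‖ < min a δ →
      v₁ - f x₁ p q ∈ pSubdiff g x₁ p → v₂ - f x₂ p q ∈ pSubdiff g x₂ p →
      κ * ‖x₁ - x₂‖ ^ 2 ≤ ⟪v₁ - v₂, x₁ - x₂⟫ := fun v₁ v₂ x₁ x₂ p q hv₁ hv₂ hp hq hx₁ hx₂ h₁ h₂ =>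
    hM (p, q) x₁ x₂ v₁ v₂ (max_lt (by linarith) (by linarith)) (lt_min_iff.1 hx₁).2
      (lt_min_iff.1 hx₂).2 (by linarith) (by linarith) h₁ h₂
  refine ⟨2 * κ * K + 1, by positivity, ball vb β, ball_mem_nhds _ hβ0, ball pb β,
    ball_mem_nhds _ hβ0, ball qb β, ball_mem_nhds _ hβ0, ball xb (min a δ),
    ball_mem_nhds _ (by positivity), ϑ, ?_, ?_⟩
  · intro v hv p hp q hq
    rw [mem_ball, dist_eq_norm] at hv
    obtain ⟨h1, h2⟩ := hϑ v p q hv hp hq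
    refine ⟨by rwa [mem_ball, dist_eq_norm], h2, fun x hx hxS => ?_⟩
    rw [mem_ball, dist_eq_norm] at hx
    have h3 := hmono v v x (ϑ v p q) p q hv hv hp hq hx h1 hxS h2
    rw [sub_self, inner_zero_left] at h3
    have h4 : ‖x - ϑ v p q‖ ^ 2 ≤ 0 := by
      by_contra h; push Not at h; nlinarith
    exact sub_eq_zero.1 (norm_eq_zero.1 (pow_eq_zero_iff two_ne_zero |>.1
      (le_antisymm h4 (sq_nonneg _))))
  · intro v₁ hv₁ p₁ hp₁ q₁ hq₁ v₂ hv₂ p₂ hp₂ q₂ hq₂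
    rw [mem_ball, dist_eq_norm] at hv₁ hv₂
    rw [mem_ball] at hp₁ hp₂ hq₁ hq₂
    obtain ⟨h1, h1'⟩ := hϑ v₁ p₁ q₁ hv₁ hp₁ hq₁
    obtain ⟨h2, h2'⟩ := hϑ v₂ p₂ q₂ hv₂ hp₂ hq₂
    obtain ⟨h3, h3'⟩ := hϑ v₂ p₁ q₁ hv₂ hp₁ hq₁
    have i1 := norm_sub_smul_le_of_mul_sq_le_inner hκ.le
      (hmono v₁ v₂ _ _ p₁ q₁ hv₁ hv₂ hp₁ hq₁ h1 h3 h1' h3')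
    have i2 := hH p₁ p₂ q₁ q₂ v₂ _ _ (by linarith) (by linarith) (by linarith) (by linarith)
      (by linarith) (lt_min_iff.1 h3).1 (lt_min_iff.1 h2).1 h3' h2'
    have i3 := norm_sub_le ((v₁ - v₂) - (2 * κ) • (ϑ v₁ p₁ q₁ - ϑ v₂ p₁ q₁))
      ((2 * κ) • (ϑ v₂ p₁ q₁ - ϑ v₂ p₂ q₂))
    rw [norm_smul, Real.norm_of_nonneg (by positivity), show
      (v₁ - v₂) - (2 * κ) • (ϑ v₁ p₁ q₁ - ϑ v₂ p₁ q₁) - (2 * κ) • (ϑ v₂ p₁ q₁ - ϑ v₂ p₂ q₂) =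
        (v₁ - v₂) - (2 * κ) • (ϑ v₁ p₁ q₁ - ϑ v₂ p₂ q₂) by module] at i3
    have i4 := mul_le_mul_of_nonneg_left i2 (by positivity : 0 ≤ 2 * κ)
    have i5 : 0 ≤ Real.sqrt (dist p₁ p₂) + dist q₁ q₂ := by positivity
    linarith

/-- The second-order condition implies Hölderian full stability. -/
theorem SOC.exists_holderFullStableWith [CompleteSpace X] {f : X → P → Q → X}
    {Df : X → P → Q → X →L[ℝ] X} {g : X → P → EReal} {xb vb vh : X} {pb : P} {qb : Q}
    {η κ κ₀ : ℝ} (hlsc : LowerSemicontinuous fun t : X × P => g t.1 t.2)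
    (hg : ∀ x p, g x p ≠ ⊥) (hvh : vh = vb - f xb pb qb) (hsol : xb ∈ SolMap f g vb pb qb)
    (hA1 : A1 f xb pb qb) (hA2 : A2 g xb pb vh) (hA3 : A3 g xb pb) (hA4 : A4 f Df xb pb qb)
    (hη : 0 < η) (hκ : 0 < κ) (hκ₀ : κ < κ₀) (h : SOC g (Df xb pb qb) xb pb vh η κ₀) :
    ∃ ℓ > (0 : ℝ), HolderFullStableWith (SolMap f g) xb vb pb qb κ ℓ := by
  obtain ⟨⟨r, hr, hprox⟩, hcont⟩ := hA2
  have hmem : vh ∈ pSubdiff g xb pb := hvh ▸ hsol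
  obtain ⟨γ, hγ⟩ := hprox.exists_eq_coe hmem hg
  obtain ⟨hE, hM⟩ := h.locExist_locMono hr.le hη (hκ.trans hκ₀) hlsc hg hγ hprox hcont hA3 hmem
  obtain ⟨hE, hM⟩ := locExist_locMono_of_linearization (F := fun p x => pSubdiff g x p)
    hvh hA1 hA4 hκ hκ₀ hE hM
  obtain ⟨δ, hδ, C, hC, hmono⟩ := hypomonotone_of_parameters hr.le hlsc hγ hprox hcont hA3
  obtain ⟨a, ha, K, hK, hH⟩ := exists_holder_estimate (F := fun p x => pSubdiff g x p) (s := r + 1)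
    hvh hA1 hκ hC hδ (by positivity) (by ring) hmono
    (locExist_subdiff_add_smul hr.le hlsc hg hγ hprox hcont hA3 hmem (by linarith)) hM
  exact HolderFullStableWith.of_locExist_locMono hκ ha hK hE hM hH

/-- second-order characterization of Hölderian full stability for
general PVS (Theorem 4.3). -/
theorem statement2
    {X : Type*} [NormedAddCommGroup X] [InnerProductSpace ℝ X] [CompleteSpace X]
    {P : Type*} [MetricSpace P] {Q : Type*} [MetricSpace Q]
    (f : X → P → Q → X) (Df : X → P → Q → X →L[ℝ] X) (g : X → P → EReal)
    (xb vb vh : X) (pb : P) (qb : Q)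
    (hg_lsc : LowerSemicontinuous fun t : X × P => g t.1 t.2)
    (hg_proper : ∀ x p, g x p ≠ ⊥)
    (hvh : vh = vb - f xb pb qb)
    (hsol : xb ∈ SolMap f g vb pb qb)
    (hA1 : A1 f xb pb qb) (hA2 : A2 g xb pb vh) (hA3 : A3 g xb pb)
    (hA4 : A4 f Df xb pb qb) :
    (∀ κ ℓ : ℝ, 0 < κ → 0 < ℓ →
        HolderFullStableWith (SolMap f g) xb vb pb qb κ ℓ →
        ∀ κ₀ : ℝ, 0 < κ₀ → κ₀ < κ →
          ∃ η > (0:ℝ), SOC g (Df xb pb qb) xb pb vh η κ₀) ∧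
    (∀ η κ₀ : ℝ, 0 < η → 0 < κ₀ →
        SOC g (Df xb pb qb) xb pb vh η κ₀ →
        ∀ κ : ℝ, 0 < κ → κ < κ₀ →
          ∃ ℓ > (0:ℝ), HolderFullStableWith (SolMap f g) xb vb pb qb κ ℓ) := by
  refine ⟨fun κ ℓ hκ _ h κ₀ _ hκ₀ => h.exists_SOC hvh hA1 hA4 hκ hκ₀,
    fun η κ₀ hη _ h κ hκ hκ₀ => ?_⟩
  exact h.exists_holderFullStableWith hg_lsc hg_proper hvh hsol hA1 hA2 hA3 hA4 hη hκ hκ₀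

end PVS
end
end

section
/- Let X be a real Hilbert space, (𝒫,d₁) a metric space, and let g : X × 𝒫 → ℝ ∪ {+∞} with v̂ ∈ ∂_x g(x̄,p̄) satisfy (A2) and (A3), with ℛ the threshold of prox-regularity of g at (x̄,p̄) for v̂. Then for every r > ℛ there is a neighborhood U × P × V of (x̄,p̄,v̂) such that for every (u,p,v) ∈ gph ∂_x g ∩ (U × P × V) one has ⟨z, w⟩ ≥ −r‖w‖² for all w ∈ X and all z ∈ D̂*(∂g_p)(u,v)(w). -/
noncomputable section

open Filter Topology Metric Set MeasureTheory
open scoped RealInnerProductSpace Pointwise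

namespace PVS

variable {X : Type*} [NormedAddCommGroup X] [InnerProductSpace ℝ X]
variable {Y : Type*} [NormedAddCommGroup Y] [InnerProductSpace ℝ Y]
variable {W : Type*} [NormedAddCommGroup W] [InnerProductSpace ℝ W]
variable {P : Type*} [MetricSpace P]
variable {Q : Type*} [MetricSpace Q]

/-- A smooth variational principle in a Hilbert space: a function with closed epigraph that is
bounded below on a bounded set attains its minimum after an arbitrarily small perturbation, up to
an arbitrarily small quadratic error. -/
theorem exists_perturbed_minimizer [CompleteSpace X] {D : Set X} {f : X → ℝ} {m R η : ℝ}
    (hclosed : IsClosed {q : X × ℝ | q.1 ∈ D ∧ f q.1 ≤ q.2}) (hne : D.Nonempty)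
    (hR : 0 < R) (hdiam : ∀ x ∈ D, ∀ y ∈ D, ‖x - y‖ ≤ R)
    (hm : ∀ x ∈ D, m ≤ f x) (hη : 0 < η) :
    ∃ x' ∈ D, ∃ e : X, ‖e‖ ≤ η ∧
      ∀ x ∈ D, f x' + ⟪e, x - x'⟫ - η * ‖x - x'‖ ^ 2 ≤ f x := by
  obtain ⟨a, ha0, ha1, ha2⟩ : ∃ a : ℝ, 0 < a ∧ 2 * a ≤ η ∧ 4 * a * R ≤ η := by
    refine ⟨min (η / 2) (η / (4 * R)), by positivity, ?_, ?_⟩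
    · linarith [min_le_left (η / 2) (η / (4 * R))]
    · have h := min_le_right (η / 2) (η / (4 * R))
      rw [le_div_iff₀ (by positivity)] at h
      linarith
  set c : ℕ → ℝ := fun n => a / 2 / 2 ^ n * 2 with hc
  have hc0 : ∀ n, 0 < c n := fun n => by positivity
  have hcs : HasSum c (2 * a) := by
    have := (hasSum_geometric_two' a).mul_right 2
    simpa [hc, mul_comm] using this
  set δ : ℕ → ℝ := fun n => c n * (1 / 2 ^ n) ^ 2 with hδ
  have hδ0 : ∀ n, 0 < δ n := fun n => by positivity
  have hδ_anti : ∀ n, δ (n + 1) ≤ δ n := fun n => by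
    simp only [hδ, hc]
    gcongr <;> norm_num
  have hδ_lim : Tendsto δ atTop (𝓝 0) := by
    have h1 : Tendsto (fun n : ℕ => (1 / (2 : ℝ) ^ n)) atTop (𝓝 0) := by
      simpa using tendsto_pow_atTop_nhds_zero_of_lt_one (r := (1 / 2 : ℝ)) (by norm_num)
        (by norm_num)
    simpa [hδ] using hcs.summable.tendsto_atTop_zero.mul (h1.pow 2)
  have hpick : ∀ (n : ℕ) (q : X → ℝ), ∃ y, y ∈ D ∧
      ((∀ x, 0 ≤ q x) → ∀ x ∈ D, f y + q y ≤ f x + q x + δ n) := by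
    intro n q
    by_cases hq : ∀ x, 0 ≤ q x
    · have hb : BddBelow ((fun x => f x + q x) '' D) :=
        ⟨m, by rintro _ ⟨x, hx, rfl⟩; linarith [hm x hx, hq x]⟩
      obtain ⟨_, ⟨y, hy, rfl⟩, hlt⟩ := Real.lt_sInf_add_pos (hne.image (fun x => f x + q x)) (hδ0 n)
      refine ⟨y, hy, fun _ x hx => ?_⟩
      have := csInf_le hb (mem_image_of_mem _ hx)
      simp only at this hlt
      linarith
    · exact ⟨hne.some, hne.some_mem, fun h => absurd h hq⟩
  choose pick hpickD hpick using hpick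
  let q : ℕ → X → ℝ :=
    fun n => Nat.rec (fun _ => 0) (fun n q x => q x + c n * ‖x - pick n q‖ ^ 2) n
  set xs : ℕ → X := fun n => pick n (q n) with hxs
  have hq_succ : ∀ n x, q (n + 1) x = q n x + c n * ‖x - xs n‖ ^ 2 := fun _ _ => rfl
  have hq_sum : ∀ n x, q n x = ∑ i ∈ Finset.range n, c i * ‖x - xs i‖ ^ 2 := by
    intro n x
    induction n with
    | zero => rfl
    | succ n ih => rw [hq_succ, Finset.sum_range_succ, ih]
  have hterm : ∀ i x, 0 ≤ c i * ‖x - xs i‖ ^ 2 := fun i x => by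
    have := hc0 i
    positivity
  have hq0 : ∀ n x, 0 ≤ q n x := fun n x => by
    rw [hq_sum]
    exact Finset.sum_nonneg fun i _ => hterm i x
  have hq_mono : ∀ x, Monotone fun n => q n x := fun x =>
    monotone_nat_of_le_succ fun n => by linarith [hq_succ n x, hterm n x]
  have hq_cont : ∀ n, Continuous (q n) := fun n => by
    have : q n = fun x => ∑ i ∈ Finset.range n, c i * ‖x - xs i‖ ^ 2 := funext (hq_sum n)
    rw [this]
    fun_prop
  have hxsD : ∀ n, xs n ∈ D := fun n => hpickD n _
  have hmin : ∀ n, ∀ x ∈ D, f (xs n) + q n (xs n) ≤ f x + q n x + δ n :=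
    fun n => hpick n (q n) (hq0 n)
  have hstep : ∀ n, dist (xs n) (xs (n + 1)) ≤ 4 / 2 / 2 ^ n := by
    intro n
    have h1 := hmin (n + 1) (xs n) (hxsD n)
    have h2 := hmin n (xs (n + 1)) (hxsD (n + 1))
    rw [hq_succ, hq_succ, sub_self, norm_zero] at h1
    have h3 : c n * ‖xs (n + 1) - xs n‖ ^ 2 ≤ c n * (2 * (1 / 2 ^ n) ^ 2) := by
      have : c n * (2 * (1 / 2 ^ n) ^ 2) = 2 * δ n := by simp only [hδ]; ring
      linarith [hδ_anti n]
    have h4 := le_of_mul_le_mul_left h3 (hc0 n)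
    rw [dist_comm, dist_eq_norm]
    refine abs_le_of_sq_le_sq' ?_ (by positivity) |>.2
    have h5 : (4 / 2 / 2 ^ n : ℝ) ^ 2 = 4 * (1 / 2 ^ n) ^ 2 := by ring
    have h6 : (0 : ℝ) ≤ (1 / 2 ^ n) ^ 2 := by positivity
    linarith
  obtain ⟨x', hx'⟩ := cauchySeq_tendsto_of_complete (cauchySeq_of_le_geometric_two hstep)
  have hlim : ∀ n, ∀ x ∈ D, ∀ Q, (∀ k, q k x ≤ Q) → x' ∈ D ∧ f x' ≤ f x + Q - q n x' := by
    intro n x hx Q hQ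
    have ht : Tendsto (fun k => (xs k, f x + Q + δ k - q n (xs k))) atTop
        (𝓝 (x', f x + Q + 0 - q n x')) :=
      hx'.prodMk_nhds ((tendsto_const_nhds.add hδ_lim).sub
        (((hq_cont n).tendsto x').comp hx'))
    rw [add_zero] at ht
    refine hclosed.mem_of_tendsto ht ?_
    filter_upwards [eventually_ge_atTop n] with k hk
    refine ⟨hxsD k, ?_⟩
    have h1 := hmin k x hx
    have h2 : q n (xs k) ≤ q k (xs k) := hq_mono (xs k) hk
    linarith [hQ k]
  have hsum : ∀ x ∈ D, Summable fun i => c i * ‖x - xs i‖ ^ 2 := by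
    intro x hx
    refine Summable.of_nonneg_of_le (fun i => hterm i x) (fun i => ?_)
      (hcs.summable.mul_right (R ^ 2))
    have := hdiam x hx (xs i) (hxsD i)
    have := (hc0 i).le
    gcongr
  have hqle : ∀ x ∈ D, ∀ k, q k x ≤ ∑' i, c i * ‖x - xs i‖ ^ 2 := fun x hx k => by
    rw [hq_sum]
    exact (hsum x hx).sum_le_tsum _ fun i _ => hterm i x
  have hx'D : x' ∈ D := (hlim 0 _ hne.some_mem _ (hqle _ hne.some_mem)).1
  have hnorm : ∀ i, ‖c i • (x' - xs i)‖ ≤ c i * R := fun i => by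
    rw [norm_smul, Real.norm_of_nonneg (hc0 i).le]
    exact mul_le_mul_of_nonneg_left (hdiam _ hx'D _ (hxsD i)) (hc0 i).le
  have hbs : Summable fun i => c i • (x' - xs i) :=
    Summable.of_norm_bounded (hcs.summable.mul_right R) hnorm
  have hbn : ‖∑' i, c i • (x' - xs i)‖ ≤ 2 * a * R :=
    tsum_of_norm_bounded (hcs.mul_right R) hnorm
  refine ⟨x', hx'D, -(2 : ℝ) • ∑' i, c i • (x' - xs i), ?_, fun x hx => ?_⟩
  · rw [norm_smul]
    norm_num
    linarith
  · have h1 : f x' ≤ f x + (∑' i, c i * ‖x - xs i‖ ^ 2) - ∑' i, c i * ‖x' - xs i‖ ^ 2 := by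
      refine ge_of_tendsto (tendsto_const_nhds.sub (hsum x' hx'D).hasSum.tendsto_sum_nat)
        (Eventually.of_forall fun n => ?_)
      rw [← hq_sum]
      exact (hlim n x hx _ (hqle x hx)).2
    have h2 : HasSum (fun i => c i * ‖x - xs i‖ ^ 2 - c i * ‖x' - xs i‖ ^ 2)
        (2 * a * ‖x - x'‖ ^ 2 + 2 * ⟪x - x', ∑' i, c i • (x' - xs i)⟫) := by
      have h3 := (innerSL ℝ (x - x')).hasSum hbs.hasSum
      refine ((hcs.mul_right (‖x - x'‖ ^ 2)).add (h3.mul_left 2)).congr_fun fun i => ?_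
      have h4 : ‖x - xs i‖ ^ 2 = ‖x - x'‖ ^ 2 + 2 * ⟪x - x', x' - xs i⟫ + ‖x' - xs i‖ ^ 2 := by
        rw [← norm_add_sq_real, sub_add_sub_cancel]
      rw [h4]
      simp only [innerSL_apply_apply, real_inner_smul_right]
      ring
    have h5 := ((hsum x hx).hasSum.sub (hsum x' hx'D).hasSum).unique h2
    rw [real_inner_smul_left, real_inner_comm]
    have h6 : 2 * a * ‖x - x'‖ ^ 2 ≤ η * ‖x - x'‖ ^ 2 := by gcongr
    linarith

theorem regSubdiff_subset_limSubdiff (h : X → EReal) (x : X) :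
    regSubdiff h x ⊆ limSubdiff h x := fun v hv =>
  ⟨fun _ => x, fun _ => v, tendsto_const_nhds, tendsto_const_nhds, fun _ => hv,
    fun _ => tendsto_const_nhds⟩

/-- A proximal subgradient inequality near a point gives a regular subgradient. -/
theorem mem_regSubdiff_of_quadratic_minorant {h : X → EReal} {x v : X} {C ρ : ℝ} (htop : h x ≠ ⊤)
    (hbot : h x ≠ ⊥) (hρ : 0 < ρ)
    (hC : ∀ y, ‖y - x‖ < ρ → h x + ((⟪v, y - x⟫ - C * ‖y - x‖ ^ 2 : ℝ) : EReal) ≤ h y) :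
    v ∈ regSubdiff h x := by
  refine ⟨htop, hbot, fun ε hε => ?_⟩
  have h1 : ∀ᶠ y in 𝓝 x, ‖y - x‖ < ρ := by
    filter_upwards [Metric.ball_mem_nhds x hρ] with y hy using mem_ball_iff_norm.1 hy
  have h2 : ∀ᶠ y in 𝓝 x, C * ‖y - x‖ < ε := by
    have : Continuous fun y => C * ‖y - x‖ := by fun_prop
    exact (this.tendsto x).eventually_lt_const (by simpa using hε)
  filter_upwards [h1, h2] with y hy1 hy2
  refine le_trans ?_ (hC y hy1)
  refine add_le_add_right (EReal.coe_le_coe_iff.2 ?_) _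
  linarith [mul_le_mul_of_nonneg_right hy2.le (norm_nonneg (y - x)), sq ‖y - x‖,
    mul_assoc C ‖y - x‖ ‖y - x‖]

/-- Local near-surjectivity of `∂̂h + (r + 1/2) I` around a point with a subgradient that
satisfies the prox-regularity inequality. -/
theorem exists_regSubdiff_near [CompleteSpace X] {h : X → EReal} {u v a₀ : X} {r R η : ℝ}
    (hlsc : LowerSemicontinuous h) (hbot : ∀ x, h x ≠ ⊥) (htop : h u ≠ ⊤) (hR : 0 < R)
    (hprox : ∀ x, ‖x - u‖ ≤ R → h u + ((⟪v, x - u⟫ - r / 2 * ‖x - u‖ ^ 2 : ℝ) : EReal) ≤ h x)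
    (ha₀ : 8 * ‖a₀‖ < R) (hη : 0 < η) :
    ∃ a ξ : X, ‖a - a₀‖ ≤ η ∧ ‖ξ‖ ≤ 8 * ‖a‖ ∧
      v + a - (r + 1 / 2) • ξ ∈ regSubdiff h (u + ξ) := by
  set D : Set X := {x | ‖x - u‖ ≤ R ∧ h x ≠ ⊤} with hD
  set k : X → ℝ := fun x => (h x).toReal with hk
  have hkD : ∀ x, h x ≠ ⊤ → h x = (k x : EReal) := fun x hx =>
    (EReal.coe_toReal hx (hbot x)).symm
  set q : X → ℝ := fun x => (r + 1 / 2) / 2 * ‖x - u‖ ^ 2 - ⟪v + a₀, x - u⟫ with hq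
  have hq_cont : Continuous q := by fun_prop
  have hclosed : IsClosed {t : X × ℝ | t.1 ∈ D ∧ k t.1 + q t.1 ≤ t.2} := by
    have h1 : IsClosed {t : X × EReal | h t.1 ≤ t.2} := hlsc.isClosed_epigraph
    have h2 : Continuous fun t : X × ℝ => (t.1, ((t.2 - q t.1 : ℝ) : EReal)) :=
      continuous_fst.prodMk (continuous_coe_real_ereal.comp
        (continuous_snd.sub (hq_cont.comp continuous_fst)))
    have h3 : IsClosed {t : X × ℝ | ‖t.1 - u‖ ≤ R} := isClosed_le (by fun_prop) (by fun_prop)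
    convert h3.inter (h1.preimage h2) using 1
    ext ⟨x, M⟩
    simp only [hD, mem_ofPred_eq, mem_inter_iff, mem_preimage, and_assoc]
    refine and_congr_right fun _ => ⟨fun ⟨hx, hle⟩ => ?_, fun hle => ?_⟩
    · rw [hkD x hx]
      exact_mod_cast le_sub_iff_add_le.2 hle
    · have hx : h x ≠ ⊤ := fun hx => by
        rw [hx, top_le_iff] at hle
        exact EReal.coe_ne_top _ hle
      rw [hkD x hx] at hle
      exact ⟨hx, le_sub_iff_add_le.1 (by exact_mod_cast hle)⟩
  have hkprox : ∀ x ∈ D, k u + (⟪v, x - u⟫ - r / 2 * ‖x - u‖ ^ 2) ≤ k x := fun x hx => by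
    have := hprox x hx.1
    rw [hkD x hx.2, hkD u htop] at this
    exact_mod_cast this
  have huD : u ∈ D := ⟨by simpa using hR.le, htop⟩
  have hdiam : ∀ x ∈ D, ∀ y ∈ D, ‖x - y‖ ≤ 2 * R := fun x hx y hy => by
    have h1 := norm_sub_le_norm_sub_add_norm_sub x u y
    have h2 := hx.1
    have h3 := hy.1
    rw [norm_sub_rev] at h3
    linarith
  have hlow : ∀ x ∈ D, k u - ‖a₀‖ * R ≤ k x + q x := fun x hx => by
    have h1 := hkprox x hx
    have h2 := real_inner_le_norm a₀ (x - u)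
    have h3 := mul_le_mul_of_nonneg_left hx.1 (norm_nonneg a₀)
    simp only [hq, inner_add_left]
    nlinarith [sq_nonneg ‖x - u‖]
  obtain ⟨η', hη'0, hη'1, hη'2, hη'3⟩ : ∃ η' : ℝ, 0 < η' ∧ η' ≤ η ∧ η' ≤ 1 / 8 ∧
      8 * (‖a₀‖ + η') < R := by
    refine ⟨min (min η (1 / 8)) ((R / 8 - ‖a₀‖) / 2), ?_, ?_, ?_, ?_⟩
    · refine lt_min (lt_min hη (by norm_num)) (by linarith)
    · exact (min_le_left _ _).trans (min_le_left _ _)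
    · exact (min_le_left _ _).trans (min_le_right _ _)
    · linarith [min_le_right (min η (1 / 8)) ((R / 8 - ‖a₀‖) / 2)]
  obtain ⟨x', hx'D, e, he, hmin⟩ := exists_perturbed_minimizer hclosed ⟨u, huD⟩ (by linarith) hdiam
    hlow hη'0
  have hξ : ‖x' - u‖ ≤ 8 * ‖a₀ + e‖ := by
    have h1 := hmin u huD
    have h2 := hkprox x' hx'D
    have h3 := real_inner_le_norm (a₀ + e) (x' - u)
    rw [← neg_sub x' u, inner_neg_right, norm_neg] at h1
    simp only [hq, inner_add_left, sub_self, norm_zero, inner_zero_right] at h1 h3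
    have h4 : η' * ‖x' - u‖ ^ 2 ≤ 1 / 8 * ‖x' - u‖ ^ 2 := by gcongr
    by_contra! hlt
    have h5 := mul_lt_mul_of_pos_right hlt ((by positivity : (0 : ℝ) ≤ 8 * ‖a₀ + e‖).trans_lt hlt)
    linarith
  have hx'R : ‖x' - u‖ < R := by
    linarith [norm_add_le a₀ e]
  refine ⟨a₀ + e, x' - u, by simpa using he.trans hη'1, hξ, ?_⟩
  rw [add_sub_cancel]
  refine mem_regSubdiff_of_quadratic_minorant (C := η' + (r + 1 / 2) / 2) (ρ := R - ‖x' - u‖)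
    hx'D.2 (hbot x') (by linarith) fun y hy => ?_
  by_cases hytop : h y = ⊤
  · rw [hytop]
    exact le_top
  have hyD : y ∈ D := ⟨by linarith [norm_sub_le_norm_sub_add_norm_sub y x' u], hytop⟩
  have h1 := hmin y hyD
  rw [hkD y hytop, hkD x' hx'D.2]
  norm_cast
  have h2 : ‖y - u‖ ^ 2 = ‖y - x'‖ ^ 2 + 2 * ⟪y - x', x' - u⟫ + ‖x' - u‖ ^ 2 := by
    rw [← norm_add_sq_real, sub_add_sub_cancel]
  have h3 : ⟪v + a₀, y - u⟫ = ⟪v + a₀, y - x'⟫ + ⟪v + a₀, x' - u⟫ := by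
    rw [← inner_add_right, sub_add_sub_cancel]
  have h4 : ⟪v + (a₀ + e) - (r + 1 / 2) • (x' - u), y - x'⟫
      = ⟪v + a₀, y - x'⟫ + ⟪e, y - x'⟫ - (r + 1 / 2) * ⟪y - x', x' - u⟫ := by
    rw [inner_sub_left, ← add_assoc, inner_add_left (v + a₀), real_inner_smul_left,
      real_inner_comm (y - x') (x' - u)]
  simp only [hq] at h1
  rw [h2, h3] at h1
  rw [h4]
  linarith

/-- Adding two quadratic subgradient inequalities yields hypomonotonicity. -/
theorem hypomonotone_of_prox {h : X → EReal} {x u v v' : X} {r : ℝ}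
    (hx : h x ≠ ⊤) (hx' : h x ≠ ⊥) (hu : h u ≠ ⊤) (hu' : h u ≠ ⊥)
    (h1 : h u + ((⟪v, x - u⟫ - r / 2 * ‖x - u‖ ^ 2 : ℝ) : EReal) ≤ h x)
    (h2 : h x + ((⟪v', u - x⟫ - r / 2 * ‖u - x‖ ^ 2 : ℝ) : EReal) ≤ h u) :
    -r * ‖x - u‖ ^ 2 ≤ ⟪v' - v, x - u⟫ := by
  lift h x to ℝ using ⟨hx, hx'⟩ with α
  lift h u to ℝ using ⟨hu, hu'⟩ with β
  norm_cast at h1 h2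
  rw [← neg_sub x u, inner_neg_right, norm_neg] at h2
  rw [inner_sub_left]
  linarith

/-- A limiting subgradient of a function satisfying the corresponding local quadratic minorization
can only exist where the function is finite. -/
theorem ne_top_of_mem_limSubdiff {h : X → EReal} {u v : X} {c : X → ℝ}
    (hv : v ∈ limSubdiff h u) (hc : ∀ᶠ x in 𝓝 u, h u + (c x : EReal) ≤ h x) : h u ≠ ⊤ := by
  obtain ⟨xs, vs, hxs, -, hvs, -⟩ := hv
  obtain ⟨n, hn⟩ := (hxs.eventually hc).exists
  intro htop
  rw [htop, EReal.top_add_coe, top_le_iff] at hn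
  exact (hvs n).1 hn

/-- Pointwise second-order estimate: if `T` is hypomonotone at `(u, v)` with constant `r`, and the
range of `T + (r + 1/2) I` is dense near the image of `(u, v)`, with controlled preimages, then the
regular coderivative of `T` is bounded below. -/
theorem regCoderiv_lower_bound {T : X → Set X} {u v w z : X} {r R : ℝ} (hR : 0 < R)
    (hz : z ∈ regCoderiv T u v w)
    (hdense : ∀ a₀ : X, ‖a₀‖ < R → ∀ η > (0 : ℝ), ∃ a ξ : X, ‖a - a₀‖ ≤ η ∧ ‖ξ‖ ≤ 8 * ‖a‖ ∧
      v + a - (r + 1 / 2) • ξ ∈ T (u + ξ) ∧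
      -r * ‖ξ‖ ^ 2 ≤ ⟪a - (r + 1 / 2) • ξ, ξ⟫) :
    -r * ‖w‖ ^ 2 ≤ ⟪z, w⟫ := by
  set s := r + 1 / 2 with hs
  set d : X := z + s • w with hd
  set K : ℝ := 8 + (1 + 8 * |s|) with hK
  have hK0 : 0 < K := by positivity
  have hpt : ∀ ε > (0 : ℝ), ∃ ρ > (0 : ℝ), ∀ a ξ : X, ‖a‖ < ρ → ‖ξ‖ ≤ 8 * ‖a‖ →
      v + a - s • ξ ∈ T (u + ξ) → -r * ‖ξ‖ ^ 2 ≤ ⟪a - s • ξ, ξ⟫ →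
      ⟪d - w, a⟫ ≤ (‖d‖ + ε * K) * ‖a‖ := by
    intro ε hε
    obtain ⟨ρ, hρ, hball⟩ := Metric.mem_nhdsWithin_iff.1 (hz ε hε)
    refine ⟨ρ / K, by positivity, fun a ξ ha hξ hmem hmono => ?_⟩
    have hν : ‖a - s • ξ‖ ≤ (1 + 8 * |s|) * ‖a‖ := by
      have h1 := norm_sub_le a (s • ξ)
      rw [norm_smul, Real.norm_eq_abs] at h1
      have h2 := mul_le_mul_of_nonneg_left hξ (abs_nonneg s)
      linarith
    have haK : K * ‖a‖ < ρ := by rwa [lt_div_iff₀ hK0, mul_comm] at ha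
    have hsum : ‖ξ‖ + ‖a - s • ξ‖ ≤ K * ‖a‖ := by
      rw [hK, add_mul]
      exact add_le_add hξ hν
    have h0 : v + a - s • ξ - v = a - s • ξ := by abel
    have hin : (u + ξ, v + a - s • ξ) ∈ Metric.ball (u, v) ρ ∩ gph T := by
      refine ⟨?_, hmem⟩
      rw [Metric.mem_ball, Prod.dist_eq, dist_eq_norm, dist_eq_norm, add_sub_cancel_left, h0]
      exact max_lt (by linarith [norm_nonneg (a - s • ξ)]) (by linarith [norm_nonneg ξ])
    have h1 := hball hin
    simp only [mem_ofPred_eq, add_sub_cancel_left, h0, inner_neg_left] at h1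
    have h2 : √(‖ξ‖ ^ 2 + ‖a - s • ξ‖ ^ 2) ≤ K * ‖a‖ := by
      refine le_trans (Real.sqrt_le_iff.2 ⟨by positivity, ?_⟩) hsum
      nlinarith [norm_nonneg ξ, norm_nonneg (a - s • ξ)]
    have h3 := mul_le_mul_of_nonneg_left h2 hε.le
    have h4 : ‖ξ - a‖ ≤ ‖a‖ := by
      refine abs_le_of_sq_le_sq' ?_ (norm_nonneg a) |>.2
      rw [norm_sub_sq_real, real_inner_comm]
      rw [inner_sub_left, real_inner_smul_left, real_inner_self_eq_norm_sq] at hmono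
      rw [hs] at hmono
      linarith
    have h5 : -(‖d‖ * ‖a‖) ≤ ⟪d, ξ - a⟫ := by
      have := (abs_le.1 (abs_real_inner_le_norm d (ξ - a))).1
      have := mul_le_mul_of_nonneg_left h4 (norm_nonneg d)
      linarith
    have h6 : ⟪d, ξ⟫ = ⟪z, ξ⟫ + s * ⟪w, ξ⟫ := by
      rw [hd, inner_add_left, real_inner_smul_left]
    rw [inner_sub_right, real_inner_smul_right] at h1
    rw [inner_sub_right] at h5
    rw [inner_sub_left]
    linarith
  have hall : ∀ ε > (0 : ℝ), ∃ ρ > (0 : ℝ), ∀ a₀ : X, ‖a₀‖ < ρ →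
      ⟪d - w, a₀⟫ ≤ (‖d‖ + ε * K) * ‖a₀‖ := by
    intro ε hε
    obtain ⟨ρ, hρ, h⟩ := hpt ε hε
    refine ⟨min ρ R, lt_min hρ hR, fun a₀ ha₀ => ?_⟩
    have hcl : IsClosed {a : X | ⟪d - w, a⟫ ≤ (‖d‖ + ε * K) * ‖a‖} :=
      isClosed_le (by fun_prop) (by fun_prop)
    have hmem : a₀ ∈ closure {a : X | ⟪d - w, a⟫ ≤ (‖d‖ + ε * K) * ‖a‖} := by
      rw [Metric.mem_closure_iff]
      intro η hη
      have hpos : 0 < ρ - ‖a₀‖ := by linarith [min_le_left ρ R]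
      obtain ⟨a, ξ, h1, h2, h3, h4⟩ := hdense a₀ (ha₀.trans_le (min_le_right _ _))
        (min η (ρ - ‖a₀‖) / 2) (by positivity)
      have h5 : min η (ρ - ‖a₀‖) ≤ η := min_le_left _ _
      have h6 : min η (ρ - ‖a₀‖) ≤ ρ - ‖a₀‖ := min_le_right _ _
      refine ⟨a, h a ξ ?_ h2 h3 h4, ?_⟩
      · linarith [norm_sub_norm_le a a₀]
      · rw [dist_comm, dist_eq_norm]
        linarith
    rwa [hcl.closure_eq] at hmem
  have hle : ‖d - w‖ ≤ ‖d‖ := by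
    refine le_of_forall_pos_le_add fun ε hε => ?_
    by_cases hdw : d - w = 0
    · rw [hdw, norm_zero]
      positivity
    have hpos : 0 < ‖d - w‖ := norm_pos_iff.2 hdw
    obtain ⟨ρ, hρ, h⟩ := hall (ε / K) (by positivity)
    have ht : 0 < ρ / 2 / ‖d - w‖ := by positivity
    have hn : ‖(ρ / 2 / ‖d - w‖) • (d - w)‖ = ρ / 2 := by
      rw [norm_smul, Real.norm_of_nonneg ht.le, div_mul_cancel₀ _ hpos.ne']
    have h1 := h ((ρ / 2 / ‖d - w‖) • (d - w)) (by rw [hn]; linarith)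
    rw [hn, real_inner_smul_right, real_inner_self_eq_norm_sq, sq, ← mul_assoc,
      div_mul_cancel₀ _ hpos.ne', div_mul_cancel₀ _ hK0.ne', mul_comm] at h1
    exact le_of_mul_le_mul_right h1 (by positivity)
  have hsq := pow_le_pow_left₀ (norm_nonneg _) hle 2
  rw [norm_sub_sq_real, hd, inner_add_left, real_inner_smul_left,
    real_inner_self_eq_norm_sq, hs] at hsq
  linarith

/-- second-order necessary condition for parametric prox-regularity
(Lemma 5.2). -/
theorem statement3
    {X : Type*} [NormedAddCommGroup X] [InnerProductSpace ℝ X] [CompleteSpace X]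
    {P : Type*} [MetricSpace P]
    (g : X → P → EReal) (xb vh : X) (pb : P)
    (hg_lsc : LowerSemicontinuous fun t : X × P => g t.1 t.2)
    (hg_proper : ∀ x p, g x p ≠ ⊥)
    (hvh : vh ∈ pSubdiff g xb pb)
    (hA2 : A2 g xb pb vh) (hA3 : A3 g xb pb) :
    ∀ r : ℝ, proxThreshold g xb pb vh < r →
      ∃ ε > (0:ℝ), ∀ u p v, ‖u - xb‖ < ε → dist p pb < ε → ‖v - vh‖ < ε →
        v ∈ pSubdiff g u p →
        ∀ w z, z ∈ regCoderiv (fun y => pSubdiff g y p) u v w →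
          -r * ‖w‖ ^ 2 ≤ ⟪z, w⟫ := by
  intro r hr
  obtain ⟨⟨r₀, hr₀, hprox₀⟩, -⟩ := hA2
  have hne : {r : ℝ | 0 < r ∧ ProxRegWith g xb pb vh r}.Nonempty := ⟨r₀, hr₀, hprox₀⟩
  obtain ⟨r', ⟨-, ε, hε, hprox⟩, hr'⟩ := exists_lt_of_csInf_lt hne hr
  refine ⟨ε / 2, by positivity, fun u p v hu hp hv huv w z hz => ?_⟩
  have hnear : ∀ x, ‖x - u‖ < ε / 2 → ‖x - xb‖ < ε := fun x hx => by
    linarith [norm_sub_le_norm_sub_add_norm_sub x u xb]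
  have hp' : dist p pb < ε := by linarith
  have hproxu : ∀ x, ‖x - u‖ < ε / 2 →
      g u p + ((⟪v, x - u⟫ - r' / 2 * ‖x - u‖ ^ 2 : ℝ) : EReal) ≤ g x p := fun x hx =>
    hprox x u p v (hnear x hx) (by linarith) hp' (by linarith) huv
  have htop : g u p ≠ ⊤ := by
    refine ne_top_of_mem_limSubdiff (h := fun x => g x p)
      (c := fun x => ⟪v, x - u⟫ - r' / 2 * ‖x - u‖ ^ 2) huv ?_
    have h1 : ∀ᶠ x in 𝓝 u, ‖x - u‖ < ε / 2 := by
      filter_upwards [Metric.ball_mem_nhds u (half_pos hε)] with x hx using mem_ball_iff_norm.1 hx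
    exact h1.mono hproxu
  have hlsc : LowerSemicontinuous fun x => g x p :=
    LowerSemicontinuous.comp hg_lsc (g := fun x : X => (x, p)) (by fun_prop)
  set s := r' + 1 / 2 with hs
  have hR : 0 < ε / (64 * (1 + 8 * |s|)) := by positivity
  set R := ε / (64 * (1 + 8 * |s|)) with hRdef
  have hRε : 64 * ((1 + 8 * |s|) * R) = ε := by
    rw [hRdef]
    field_simp
  have hsR : 0 ≤ |s| * R := by positivity
  have hlow : -r' * ‖w‖ ^ 2 ≤ ⟪z, w⟫ := by
    refine regCoderiv_lower_bound hR hz fun a₀ ha₀ η hη => ?_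
    obtain ⟨a, ξ, h1, h2, h3⟩ := exists_regSubdiff_near (h := fun x => g x p) (r := r')
      (R := ε / 4) (η := min η R) (a₀ := a₀) hlsc (fun x => hg_proper x p) htop (by positivity)
      (fun x hx => hproxu x (by linarith)) (by linarith) (lt_min hη hR)
    have hmem := regSubdiff_subset_limSubdiff _ _ h3
    refine ⟨a, ξ, h1.trans (min_le_left _ _), h2, hmem, ?_⟩
    have ha : ‖a‖ < 2 * R := by
      linarith [norm_sub_norm_le a a₀, min_le_right η R]
    have hξ : ‖ξ‖ < ε / 2 := by linarith
    have hν : ‖a - s • ξ‖ < ε / 2 := by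
      have h4 := norm_sub_le a (s • ξ)
      rw [norm_smul, Real.norm_eq_abs] at h4
      have h5 := mul_le_mul_of_nonneg_left (h2.trans (by linarith : 8 * ‖a‖ ≤ 16 * R))
        (abs_nonneg s)
      linarith
    have hv' : ‖v + a - s • ξ - vh‖ < ε := by
      have h4 := norm_add_le (v - vh) (a - s • ξ)
      rw [show v - vh + (a - s • ξ) = v + a - s • ξ - vh by abel] at h4
      linarith
    have h4 := hypomonotone_of_prox (h := fun x => g x p) (v := v) (v' := v + a - s • ξ) (r := r')
      h3.1 h3.2.1 htop (hg_proper u p) (hproxu (u + ξ) (by simpa using hξ))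
      (hprox u (u + ξ) p _ (by linarith) (hnear _ (by simpa using hξ)) hp' hv' hmem)
    rwa [add_sub_cancel_left, add_sub_assoc, add_sub_cancel_left] at h4
  have := mul_le_mul_of_nonneg_right hr'.le (sq_nonneg ‖w‖)
  linarith

end PVS
end
end
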